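/- Let d ≥ 2 be an integer, let r > d(d+1) be an integer, and let X, Y ≫ 1 with X ≫ Y/(log Y)^{M} for some M ≫ 1. Then the number of 2r-tuples of primes (p₁, …, p_{2r}) with Y ≤ p_i ≤ Y + X for all i, satisfying p₁^j + ⋯ + p_r^j = p_{r+1}^j + ⋯ + p_{2r}^j for every 1 ≤ j ≤ d, is O( X^{2r − d(d+1)/2} / (log X)^{2r} ), with implied constant depending only on d, r and M. -/

import Mathlib

noncomputable section
open Finset
namespace VMV

/-- additive character -/
def ee (x : ℝ) : ℂ := Complex.exp (2 * Real.pi * x * Complex.I)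

theorem ee_add (x y : ℝ) : ee (x + y) = ee x * ee y := by
  unfold ee; rw [← Complex.exp_add]; congr 1; push_cast; ring

theorem ee_zero : ee 0 = 1 := by simp [ee]

theorem norm_ee (x : ℝ) : ‖ee x‖ = 1 := by
  unfold ee
  have : (2 * Real.pi * x * Complex.I : ℂ) = ((2 * Real.pi * x : ℝ) : ℂ) * Complex.I := by
    push_cast; ring
  rw [this, Complex.norm_exp_ofReal_mul_I]

theorem ee_int (n : ℤ) : ee n = 1 := by
  unfold ee
  rw [Complex.exp_eq_one_iff]
  exact ⟨n, by push_cast; ring⟩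

theorem ee_add_int (x : ℝ) (n : ℤ) : ee (x + n) = ee x := by
  rw [ee_add, ee_int, mul_one]

theorem ee_neg (x : ℝ) : ee (-x) = (starRingEnd ℂ) (ee x) := by
  unfold ee
  rw [← Complex.exp_conj]; congr 1
  simp
  left; exact (map_ofNat (starRingEnd ℂ) 2).symm

theorem ee_sum {ι : Type*} (s : Finset ι) (f : ι → ℝ) : ee (∑ i ∈ s, f i) = ∏ i ∈ s, ee (f i) := by
  classical
  induction s using Finset.induction_on with
  | empty => simp [ee_zero]
  | insert a s ha ih => rw [sum_insert ha, prod_insert ha, ee_add, ih]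

theorem ee_nat_mul (n : ℕ) (x : ℝ) : ee (n * x) = ee x ^ n := by
  unfold ee; rw [← Complex.exp_nat_mul]; congr 1; push_cast; ring

theorem ee_eq_one_iff (x : ℝ) : ee x = 1 ↔ ∃ n : ℤ, x = n := by
  unfold ee
  rw [Complex.exp_eq_one_iff]
  constructor
  · rintro ⟨n, hn⟩
    refine ⟨n, ?_⟩
    have h2 : (2 * Real.pi * Complex.I : ℂ) ≠ 0 := Complex.two_pi_I_ne_zero
    have : (x : ℂ) * (2 * Real.pi * Complex.I) = n * (2 * Real.pi * Complex.I) := by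
      rw [← hn]; ring
    exact_mod_cast mul_right_cancel₀ h2 this
  · rintro ⟨n, rfl⟩
    exact ⟨n, by push_cast; ring⟩

theorem ee_sub_le (x y : ℝ) : ‖ee x - ee y‖ ≤ 2 * Real.pi * |x - y| := by
  have h : ee x - ee y = ee y * (ee (x - y) - 1) := by
    rw [mul_sub, ← ee_add, mul_one]; congr 2; ring
  rw [h, norm_mul, norm_ee, one_mul]
  unfold ee
  have : (2 * Real.pi * ((x - y : ℝ) : ℂ) * Complex.I : ℂ)
      = Complex.I * ((2 * Real.pi * (x - y) : ℝ) : ℂ) := by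
    push_cast; ring
  rw [this]
  refine (Real.norm_exp_I_mul_ofReal_sub_one_le).trans ?_
  rw [Real.norm_eq_abs, abs_mul, abs_of_pos (by positivity : (0:ℝ) < 2 * Real.pi)]

theorem sum_ee_div (L : ℕ) (hL : 0 < L) (u : ℤ) :
    ∑ l ∈ range L, ee ((l : ℝ) / L * u) = if (L : ℤ) ∣ u then (L : ℂ) else 0 := by
  have hL' : (L : ℝ) ≠ 0 := by positivity
  have h1 : ∀ l ∈ range L, ee ((l : ℝ) / L * u) = ee ((u : ℝ) / L) ^ l := by
    intro l _
    rw [← ee_nat_mul]; congr 1; ring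
  rw [sum_congr rfl h1]
  split_ifs with h
  · obtain ⟨c, rfl⟩ := h
    have : ee (((L * c : ℤ) : ℝ) / L) = 1 := by
      rw [ee_eq_one_iff]; exact ⟨c, by push_cast; field_simp⟩
    rw [this]; simp
  · have hne : ee ((u : ℝ) / L) ≠ 1 := by
      rw [Ne, ee_eq_one_iff]
      rintro ⟨c, hc⟩
      apply h
      refine ⟨c, ?_⟩
      rw [div_eq_iff hL'] at hc
      have : (u : ℝ) = ((c * L : ℤ) : ℝ) := by rw [hc]; push_cast; ring
      have := Int.cast_injective this
      rw [this]; ring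
    rw [geom_sum_eq hne]
    have : ee ((u : ℝ) / L) ^ L = 1 := by
      rw [← ee_nat_mul, ee_eq_one_iff]
      exact ⟨u, by field_simp⟩
    rw [this]; simp

/-- grid of index vectors -/
def Grid {d : ℕ} (L : Fin d → ℕ) : Finset (Fin d → ℕ) := Fintype.piFinset fun j => range (L j)

def pt {d : ℕ} (L : Fin d → ℕ) (l : Fin d → ℕ) : Fin d → ℝ := fun j => (l j : ℝ) / L j

/-- average over the grid -/
def av {d : ℕ} (L : Fin d → ℕ) (φ : (Fin d → ℝ) → ℝ) : ℝ :=
  (∏ j, (L j : ℝ))⁻¹ * ∑ l ∈ Grid L, φ (pt L l)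

theorem sum_grid {d : ℕ} (L : Fin d → ℕ) (hL : ∀ j, 0 < L j) (u : Fin d → ℤ) :
    ∑ l ∈ Grid L, ee (∑ j, pt L l j * u j) =
      if ∀ j, (L j : ℤ) ∣ u j then (∏ j, (L j : ℂ)) else 0 := by
  unfold Grid pt
  simp_rw [ee_sum]
  rw [← Finset.prod_univ_sum (fun j => range (L j)) (fun j l => ee ((l : ℝ) / L j * u j))]
  simp_rw [sum_ee_div _ (hL _)]
  split_ifs with h
  · exact prod_congr rfl fun j _ => if_pos (h j)
  · push Not at h
    obtain ⟨j, hj⟩ := h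
    exact prod_eq_zero (mem_univ j) (if_neg hj)

theorem av_nonneg {d : ℕ} (L : Fin d → ℕ) {φ : (Fin d → ℝ) → ℝ} (h : ∀ α, 0 ≤ φ α) :
    0 ≤ av L φ := by
  unfold av
  exact mul_nonneg (inv_nonneg.2 (prod_nonneg fun _ _ => Nat.cast_nonneg _))
    (sum_nonneg fun _ _ => h _)

theorem av_mono {d : ℕ} (L : Fin d → ℕ) {φ ψ : (Fin d → ℝ) → ℝ} (h : ∀ α, φ α ≤ ψ α) :
    av L φ ≤ av L ψ := by
  unfold av
  exact mul_le_mul_of_nonneg_left (sum_le_sum fun _ _ => h _)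
    (inv_nonneg.2 (prod_nonneg fun _ _ => Nat.cast_nonneg _))

theorem av_add {d : ℕ} (L : Fin d → ℕ) (φ ψ : (Fin d → ℝ) → ℝ) :
    av L (fun α => φ α + ψ α) = av L φ + av L ψ := by
  unfold av; rw [sum_add_distrib, mul_add]

theorem av_mul {d : ℕ} (L : Fin d → ℕ) (c : ℝ) (φ : (Fin d → ℝ) → ℝ) :
    av L (fun α => c * φ α) = c * av L φ := by
  unfold av; rw [← mul_sum]; ring

theorem av_sum {d : ℕ} (L : Fin d → ℕ) {ι : Type*} (s : Finset ι) (φ : ι → (Fin d → ℝ) → ℝ) :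
    av L (fun α => ∑ i ∈ s, φ i α) = ∑ i ∈ s, av L (φ i) := by
  unfold av; rw [sum_comm, mul_sum]

theorem av_const_le {d : ℕ} (L : Fin d → ℕ) (c : ℝ) (hc : 0 ≤ c) : av L (fun _ => c) ≤ c := by
  unfold av Grid
  rw [sum_const, Fintype.card_piFinset]
  simp only [card_range, nsmul_eq_mul]
  push_cast
  by_cases h : (∏ j, (L j : ℝ)) = 0
  · rw [h]; simpa
  · field_simp; rfl

theorem av_const_card {d : ℕ} (L : Fin d → ℕ) (hL : ∀ j, 0 < L j) (c : ℝ) :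
    av L (fun _ => c) = c := by
  unfold av Grid
  rw [sum_const, Fintype.card_piFinset]
  simp only [card_range, nsmul_eq_mul]
  push_cast
  have h : (∏ j, (L j : ℝ)) ≠ 0 := prod_ne_zero_iff.2 fun j _ => by have := hL j; positivity
  field_simp

/-- main orthogonality relation -/
theorem av_sq {d : ℕ} (L : Fin d → ℕ) {S : Type*} (s : Finset S) (w : S → ℝ) (v : S → Fin d → ℤ)
    (hL : ∀ j, 0 < L j) (hv : ∀ x ∈ s, ∀ y ∈ s, ∀ j, |v x j - v y j| < L j) :
    av L (fun α => ‖∑ x ∈ s, (w x : ℂ) * ee (∑ j, α j * v x j)‖ ^ 2) =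
      ∑ x ∈ s, ∑ y ∈ s, if v x = v y then w x * w y else 0 := by
  have key : ∀ α : Fin d → ℝ,
      ((‖∑ x ∈ s, (w x : ℂ) * ee (∑ j, α j * v x j)‖ ^ 2 : ℝ) : ℂ) =
      ∑ x ∈ s, ∑ y ∈ s, ((w x * w y : ℝ) : ℂ) * ee (∑ j, α j * (v x j - v y j : ℤ)) := by
    intro α
    push_cast
    rw [← Complex.mul_conj', map_sum, sum_mul_sum]
    refine sum_congr rfl fun x _ => sum_congr rfl fun y _ => ?_
    rw [map_mul, ← ee_neg, Complex.conj_ofReal]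
    have : ee (∑ j, α j * ((v x j : ℝ) - v y j)) =
      ee (∑ j, α j * v x j) * ee (-∑ j, α j * v y j) := by
      rw [← ee_add, ← sum_neg_distrib, ← sum_add_distrib]; congr 1
      exact sum_congr rfl fun j _ => by ring
    rw [this]; ring
  have hprod : (∏ j, (L j : ℂ)) ≠ 0 := prod_ne_zero_iff.2 fun j _ => by
    have := hL j; exact_mod_cast this.ne'
  apply Complex.ofReal_injective
  unfold av
  push_cast
  have e1 : ∀ l ∈ Grid L, (‖∑ x ∈ s, (w x : ℂ) * ee (∑ j, pt L l j * v x j)‖ : ℂ) ^ 2 =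
      ∑ x ∈ s, ∑ y ∈ s, ((w x * w y : ℝ) : ℂ) * ee (∑ j, pt L l j * (v x j - v y j : ℤ)) := by
    intro l _
    rw [← key]; push_cast; rfl
  rw [sum_congr rfl e1, sum_comm, mul_sum]
  refine sum_congr rfl fun x hx => ?_
  rw [sum_comm, mul_sum]
  refine sum_congr rfl fun y hy => ?_
  rw [← mul_sum, sum_grid L hL (fun j => v x j - v y j)]
  have hiff : (∀ j, (L j : ℤ) ∣ v x j - v y j) ↔ v x = v y := by
    constructor
    · intro h
      funext j
      have := Int.eq_zero_of_abs_lt_dvd (h j) (hv x hx y hy j)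
      omega
    · intro h j; rw [h]; simp
  by_cases h : v x = v y
  · rw [if_pos (hiff.2 h), if_pos h]; push_cast; field_simp
  · rw [if_neg (fun h' => h (hiff.1 h')), if_neg h]; simp

theorem av_sq_mono {d : ℕ} (L : Fin d → ℕ) {S : Type*} (s : Finset S) (w w' : S → ℝ)
    (v : S → Fin d → ℤ)
    (hL : ∀ j, 0 < L j) (hv : ∀ x ∈ s, ∀ y ∈ s, ∀ j, |v x j - v y j| < L j)
    (hw : ∀ x ∈ s, 0 ≤ w x) (hw' : ∀ x ∈ s, w x ≤ w' x) :
    av L (fun α => ‖∑ x ∈ s, (w x : ℂ) * ee (∑ j, α j * v x j)‖ ^ 2) ≤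
    av L (fun α => ‖∑ x ∈ s, (w' x : ℂ) * ee (∑ j, α j * v x j)‖ ^ 2) := by
  rw [av_sq L s w v hL hv, av_sq L s w' v hL hv]
  refine sum_le_sum fun x hx => sum_le_sum fun y hy => ?_
  split_ifs
  · exact mul_le_mul (hw' x hx) (hw' y hy) (hw y hy) ((hw x hx).trans (hw' x hx))
  · exact le_rfl

/-- fibre inequality -/
theorem av_sq_fiber {d : ℕ} (L : Fin d → ℕ) {S Z K : Type*} [DecidableEq Z] [DecidableEq K]
    (s : Finset S)
    (v : S → Fin d → ℤ) (hL : ∀ j, 0 < L j)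
    (hv : ∀ x ∈ s, ∀ y ∈ s, ∀ j, |v x j - v y j| < L j)
    (z : S → Z) (T : Finset Z) (hz : ∀ x ∈ s, z x ∈ T) (m : Z → K)
    (hm : ∀ x ∈ s, ∀ y ∈ s, v x = v y → m (z x) = m (z y))
    (B : ℕ) (hB : ∀ c ∈ T, (T.filter fun c' => m c' = m c).card ≤ B) :
    av L (fun α => ‖∑ x ∈ s, ee (∑ j, α j * v x j)‖ ^ 2) ≤
      B * ∑ c ∈ T, av L (fun α => ‖∑ x ∈ s.filter (fun x => z x = c), ee (∑ j, α j * v x j)‖ ^ 2) := by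
  have one : ∀ s' : Finset S, s' ⊆ s →
      av L (fun α => ‖∑ x ∈ s', ee (∑ j, α j * v x j)‖ ^ 2) =
      ∑ x ∈ s', ∑ y ∈ s', if v x = v y then (1:ℝ) else 0 := by
    intro s' hs'
    have := av_sq L s' (fun _ => 1) v hL (fun x hx y hy => hv x (hs' hx) y (hs' hy))
    simpa using this
  have hsplit : av L (fun α => ‖∑ x ∈ s, ee (∑ j, α j * v x j)‖ ^ 2) =
      ∑ k ∈ T.image m, av L (fun α => ‖∑ x ∈ s.filter (fun x => m (z x) = k),
        ee (∑ j, α j * v x j)‖ ^ 2) := by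
    rw [one s (Subset.refl _)]
    rw [sum_congr rfl (fun k _ => one (s.filter fun x => m (z x) = k) (filter_subset _ _))]
    rw [← sum_fiberwise_of_maps_to (t := T.image m) (g := fun x => m (z x))
      (fun x hx => mem_image_of_mem m (hz x hx))]
    refine sum_congr rfl fun k _ => sum_congr rfl fun x hx => ?_
    rw [sum_filter]
    refine sum_congr rfl fun y hy => ?_
    rw [mem_filter] at hx
    split_ifs with h1 h2 h2
    · rfl
    · exact absurd ((hm x hx.1 y hy h1).symm.trans hx.2) h2
    · rfl
    · rfl
  rw [hsplit]
  have hT : ∑ c ∈ T, av L (fun α => ‖∑ x ∈ s.filter (fun x => z x = c), ee (∑ j, α j * v x j)‖ ^ 2)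
    = ∑ k ∈ T.image m, ∑ c ∈ T.filter (fun c => m c = k),
      av L (fun α => ‖∑ x ∈ s.filter (fun x => z x = c), ee (∑ j, α j * v x j)‖ ^ 2) :=
    (sum_fiberwise_of_maps_to (fun x hx => mem_image_of_mem m hx) _).symm
  rw [hT, mul_sum]
  refine sum_le_sum fun k hk => ?_
  rw [← av_sum, ← av_mul]
  refine av_mono L fun α => ?_
  have e : ∑ x ∈ s.filter (fun x => m (z x) = k), ee (∑ j, α j * v x j) =
      ∑ c ∈ T.filter (fun c => m c = k), ∑ x ∈ s.filter (fun x => z x = c),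
        ee (∑ j, α j * v x j) := by
    rw [← sum_fiberwise_of_maps_to (t := T.filter (fun c => m c = k)) (g := z)]
    · refine sum_congr rfl fun c hc => ?_
      rw [filter_filter]
      refine sum_congr ?_ fun _ _ => rfl
      rw [mem_filter] at hc
      ext x; simp only [mem_filter]
      constructor
      · rintro ⟨a, b, c⟩; exact ⟨a, c⟩
      · rintro ⟨a, b⟩; exact ⟨a, by rw [b]; exact hc.2, b⟩
    · intro x hx; rw [mem_filter] at hx ⊢; exact ⟨hz x hx.1, hx.2⟩
  rw [e]
  have hcard : ((T.filter (fun c => m c = k)).card : ℝ) ≤ B := by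
    obtain ⟨c, hc, rfl⟩ := mem_image.1 hk
    exact_mod_cast hB c hc
  calc _ ≤ (∑ c ∈ T.filter (fun c => m c = k), ‖∑ x ∈ s.filter (fun x => z x = c),
        ee (∑ j, α j * v x j)‖) ^ 2 := by
        gcongr; exact norm_sum_le _ _
    _ ≤ (T.filter (fun c => m c = k)).card * ∑ c ∈ T.filter (fun c => m c = k),
        ‖∑ x ∈ s.filter (fun x => z x = c), ee (∑ j, α j * v x j)‖ ^ 2 := sq_sum_le_card_mul_sum_sq
    _ ≤ _ := by gcongr

/-- power sum vector -/
def pv {ι : Type*} [Fintype ι] (d : ℕ) (x : ι → ℤ) : Fin d → ℤ := fun j => ∑ i, x i ^ ((j : ℕ) + 1)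

def ph {d : ℕ} (α : Fin d → ℝ) (x : ℤ) : ℝ := ∑ j, α j * (x : ℝ) ^ ((j : ℕ) + 1)

def fs {d : ℕ} (A : Finset ℤ) (α : Fin d → ℝ) : ℂ := ∑ x ∈ A, ee (ph α x)

def fsw {d : ℕ} (w : ℤ → ℝ) (A : Finset ℤ) (α : Fin d → ℝ) : ℂ :=
  ∑ x ∈ A, (w x : ℂ) * ee (ph α x)

theorem prod_fsw {ι : Type*} [Fintype ι] [DecidableEq ι] {d : ℕ} (w : ι → ℤ → ℝ)
    (A : ι → Finset ℤ) (α : Fin d → ℝ) :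
    ∏ i, fsw (w i) (A i) α =
      ∑ x ∈ Fintype.piFinset A, ((∏ i, w i (x i) : ℝ) : ℂ) * ee (∑ j, α j * (pv d x j : ℤ)) := by
  unfold fsw
  rw [Finset.prod_univ_sum]
  refine sum_congr rfl fun x _ => ?_
  rw [prod_mul_distrib, ← ee_sum]
  push_cast
  congr 2
  unfold ph pv
  rw [sum_comm]
  refine sum_congr rfl fun j _ => ?_
  rw [← mul_sum]; push_cast; rfl

theorem fsw_one {d : ℕ} (A : Finset ℤ) (α : Fin d → ℝ) : fsw (fun _ => 1) A α = fs A α := by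
  unfold fsw fs; simp

theorem prod_fs {ι : Type*} [Fintype ι] [DecidableEq ι] {d : ℕ}
    (A : ι → Finset ℤ) (α : Fin d → ℝ) :
    ∏ i, fs (A i) α = ∑ x ∈ Fintype.piFinset A, ee (∑ j, α j * (pv d x j : ℤ)) := by
  have := prod_fsw (fun (_ : ι) (_ : ℤ) => (1:ℝ)) A α
  simpa [fsw_one] using this

theorem fsw_pow {d : ℕ} (t : ℕ) (w : ℤ → ℝ) (A : Finset ℤ) (α : Fin d → ℝ) :
    fsw w A α ^ t = ∑ x ∈ Fintype.piFinset (fun _ : Fin t => A),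
      ((∏ i, w (x i) : ℝ) : ℂ) * ee (∑ j, α j * (pv d x j : ℤ)) := by
  rw [← prod_fsw (fun _ => w)]; simp

theorem pv_bound {ι : Type*} [Fintype ι] {d : ℕ} (M : ℕ) (x y : ι → ℤ)
    (hx : ∀ i, 0 ≤ x i ∧ x i ≤ M) (hy : ∀ i, 0 ≤ y i ∧ y i ≤ M) (j : Fin d) :
    |pv d x j - pv d y j| ≤ (Fintype.card ι * M ^ ((j : ℕ) + 1) : ℕ) := by
  have h : ∀ z : ι → ℤ, (∀ i, 0 ≤ z i ∧ z i ≤ M) →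
      0 ≤ pv d z j ∧ pv d z j ≤ (Fintype.card ι * M ^ ((j : ℕ) + 1) : ℕ) := by
    intro z hz
    unfold pv
    refine ⟨sum_nonneg fun i _ => pow_nonneg (hz i).1 _, ?_⟩
    calc _ ≤ ∑ i : ι, (M : ℤ) ^ ((j : ℕ) + 1) :=
          sum_le_sum fun i _ => pow_le_pow_left₀ (hz i).1 (hz i).2 _
      _ = _ := by simp
  have h1 := h x hx
  have h2 := h y hy
  rw [abs_le]; constructor <;> linarith [h1.1, h1.2, h2.1, h2.2]

theorem moment {d : ℕ} (L : Fin d → ℕ) (t M : ℕ) (w : ℤ → ℝ) (A : Finset ℤ)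
    (hA : ∀ x ∈ A, 0 ≤ x ∧ x ≤ M) (hL : ∀ j : Fin d, t * M ^ ((j : ℕ) + 1) < L j) :
    av L (fun α => ‖fsw w A α‖ ^ (2 * t)) =
      ∑ x ∈ Fintype.piFinset (fun _ : Fin t => A), ∑ y ∈ Fintype.piFinset (fun _ : Fin t => A),
        if pv d x = pv d y then (∏ i, w (x i)) * ∏ i, w (y i) else 0 := by
  rw [← av_sq L _ (fun x => ∏ i, w (x i)) (fun x => pv d x)]
  · congr 1; funext α
    rw [mul_comm, pow_mul, ← norm_pow, fsw_pow]
  · intro j; exact (Nat.zero_le _).trans_lt (hL j)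
  · intro x hx y hy j
    rw [Fintype.mem_piFinset] at hx hy
    refine (pv_bound M x y (fun i => hA _ (hx i)) (fun i => hA _ (hy i)) j).trans_lt ?_
    have := hL j
    rw [Fintype.card_fin]; exact_mod_cast this

/-- number of solutions of the Vinogradov system with variables in `A` -/
def Jc (t d : ℕ) (A : Finset ℤ) : ℕ :=
  ((Fintype.piFinset (fun _ : Fin t => A) ×ˢ Fintype.piFinset (fun _ : Fin t => A)).filter
    fun q => pv d q.1 = pv d q.2).card

theorem moment_fs {d : ℕ} (L : Fin d → ℕ) (t M : ℕ) (A : Finset ℤ)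
    (hA : ∀ x ∈ A, 0 ≤ x ∧ x ≤ M) (hL : ∀ j : Fin d, t * M ^ ((j : ℕ) + 1) < L j) :
    av L (fun α => ‖fs A α‖ ^ (2 * t)) = Jc t d A := by
  have := moment L t M (fun _ => 1) A hA hL
  simp_rw [fsw_one] at this
  rw [this]
  unfold Jc
  rw [card_filter, sum_product]
  push_cast
  simp

theorem moment_mono {d : ℕ} (L : Fin d → ℕ) (t M : ℕ) (w w' : ℤ → ℝ) (A : Finset ℤ)
    (hA : ∀ x ∈ A, 0 ≤ x ∧ x ≤ M) (hL : ∀ j : Fin d, t * M ^ ((j : ℕ) + 1) < L j)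
    (hw : ∀ x ∈ A, 0 ≤ w x) (hw' : ∀ x ∈ A, w x ≤ w' x) :
    av L (fun α => ‖fsw w A α‖ ^ (2 * t)) ≤ av L (fun α => ‖fsw w' A α‖ ^ (2 * t)) := by
  rw [moment L t M w A hA hL, moment L t M w' A hA hL]
  refine sum_le_sum fun x hx => sum_le_sum fun y hy => ?_
  rw [Fintype.mem_piFinset] at hx hy
  split_ifs
  · refine mul_le_mul ?_ ?_ ?_ ?_
    · exact prod_le_prod (fun i _ => hw _ (hx i)) (fun i _ => hw' _ (hx i))
    · exact prod_le_prod (fun i _ => hw _ (hy i)) (fun i _ => hw' _ (hy i))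
    · exact prod_nonneg fun i _ => hw _ (hy i)
    · exact prod_nonneg fun i _ => (hw _ (hx i)).trans (hw' _ (hx i))
  · exact le_rfl

theorem Jc_mono {t d : ℕ} {A B : Finset ℤ} (h : A ⊆ B) : Jc t d A ≤ Jc t d B := by
  unfold Jc
  refine card_le_card (filter_subset_filter _ ?_)
  exact product_subset_product (Fintype.piFinset_subset _ _ fun _ => h)
    (Fintype.piFinset_subset _ _ fun _ => h)

theorem Jc_le {t d : ℕ} (A : Finset ℤ) : Jc t d A ≤ A.card ^ (2 * t) := by
  unfold Jc
  refine (card_filter_le _ _).trans ?_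
  rw [card_product, Fintype.card_piFinset_const, ← pow_add, two_mul]

theorem psum_trans {ι R : Type*} [Fintype ι] [CommRing R] (d : ℕ) (x y : ι → R)
    (h : ∀ m ≤ d, ∑ i, x i ^ m = ∑ i, y i ^ m) (c : R) :
    ∀ m ≤ d, ∑ i, (x i + c) ^ m = ∑ i, (y i + c) ^ m := by
  intro m hm
  simp_rw [add_pow]
  rw [sum_comm, sum_comm (s := univ)]
  refine sum_congr rfl fun j hj => ?_
  rw [← sum_mul, ← sum_mul, ← sum_mul, ← sum_mul, h j (by rw [mem_range] at hj; omega)]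

theorem pv_eq_iff {ι : Type*} [Fintype ι] (d : ℕ) (x y : ι → ℤ) :
    pv d x = pv d y ↔ ∀ m ≤ d, ∑ i, x i ^ m = ∑ i, y i ^ m := by
  constructor
  · intro h m hm
    rcases m with _ | m
    · simp
    · exact congrFun h ⟨m, hm⟩
  · intro h; funext j; exact h _ j.2

theorem pv_affine {ι : Type*} [Fintype ι] (d : ℕ) (x y : ι → ℤ) (q c : ℤ) (hq : q ≠ 0) :
    pv d (fun i => q * x i + c) = pv d (fun i => q * y i + c) ↔ pv d x = pv d y := by
  have h1 : ∀ m, ∑ i, (q * x i) ^ m = q ^ m * ∑ i, x i ^ m := fun m => by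
    simp_rw [mul_pow, mul_sum]
  have h2 : ∀ m, ∑ i, (q * y i) ^ m = q ^ m * ∑ i, y i ^ m := fun m => by
    simp_rw [mul_pow, mul_sum]
  rw [pv_eq_iff, pv_eq_iff]
  constructor
  · intro h m hm
    have := psum_trans d _ _ h (-c) m hm
    simp only [add_neg_cancel_right] at this
    rw [h1, h2] at this
    exact mul_left_cancel₀ (pow_ne_zero m hq) this
  · intro h
    refine psum_trans d (fun i => q * x i) (fun i => q * y i) ?_ c
    intro m hm
    rw [h1, h2, h m hm]

theorem Jc_affine (t d : ℕ) (A : Finset ℤ) (q c : ℤ) (hq : q ≠ 0) :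
    Jc t d (A.image fun x => q * x + c) = Jc t d A := by
  symm
  unfold Jc
  refine card_bij (fun z _ => (fun i => q * z.1 i + c, fun i => q * z.2 i + c)) ?_ ?_ ?_
  · intro z hz
    simp only [mem_filter, mem_product, Fintype.mem_piFinset] at hz ⊢
    exact ⟨⟨fun i => mem_image_of_mem _ (hz.1.1 i), fun i => mem_image_of_mem _ (hz.1.2 i)⟩,
      (pv_affine d _ _ q c hq).2 hz.2⟩
  · rintro ⟨x, y⟩ _ ⟨x', y'⟩ _ h
    simp only [Prod.mk.injEq] at h
    ext i
    · have := congrFun h.1 i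
      exact mul_left_cancel₀ hq (add_right_cancel this)
    · have := congrFun h.2 i
      exact mul_left_cancel₀ hq (add_right_cancel this)
  · rintro ⟨x, y⟩ h
    simp only [mem_filter, mem_product, Fintype.mem_piFinset, mem_image] at h
    obtain ⟨⟨hx, hy⟩, he⟩ := h
    choose x' hx' hxe using hx
    choose y' hy' hye using hy
    refine ⟨(x', y'), ?_, ?_⟩
    · simp only [mem_filter, mem_product, Fintype.mem_piFinset]
      refine ⟨⟨hx', hy'⟩, (pv_affine d _ _ q c hq).1 ?_⟩
      simp_rw [hxe, hye]; exact he
    · simp only [Prod.mk.injEq]; exact ⟨funext hxe, funext hye⟩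

end VMV
end

noncomputable section
open Finset
namespace VMV

def cls (p n b : ℕ) (η : ℤ) : Finset ℤ :=
  (Finset.Ico 0 ((p : ℤ) ^ n)).filter fun x => (p : ℤ) ^ b ∣ x - η

def Jn (k p m : ℕ) : ℕ := Jc (k * (k + 1)) k (Finset.Ico 0 ((p : ℤ) ^ m))

theorem cls_range {p n b : ℕ} {η : ℤ} : ∀ x ∈ cls p n b η, 0 ≤ x ∧ x ≤ (p ^ n : ℕ) := by
  intro x hx
  unfold cls at hx
  rw [mem_filter, mem_Ico] at hx
  push_cast
  exact ⟨hx.1.1, hx.1.2.le⟩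

theorem sum_cls {M : Type*} [AddCommMonoid M] {p : ℕ} (hp : 0 < p) (n b : ℕ) (η : ℤ)
    (g : ℤ → M) :
    ∑ x ∈ cls p n b η, g x = ∑ i ∈ range p, ∑ x ∈ cls p n (b + 1) (η + i * (p : ℤ) ^ b), g x := by
  have hp' : (0 : ℤ) < p := by exact_mod_cast hp
  have hpb : (0 : ℤ) < (p : ℤ) ^ b := by positivity
  rw [← sum_fiberwise_of_maps_to (t := range p)
    (g := fun x : ℤ => ((x - η) / (p : ℤ) ^ b % p).toNat)]
  · refine sum_congr rfl fun i hi => sum_congr ?_ fun _ _ => rfl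
    rw [mem_range] at hi
    unfold cls
    rw [filter_filter]
    ext x
    simp only [mem_filter]
    refine and_congr_right fun _ => ?_
    constructor
    · rintro ⟨⟨u, hu⟩, h⟩
      rw [hu, Int.mul_ediv_cancel_left _ hpb.ne'] at h
      have h3 := Int.emod_nonneg u hp'.ne'
      have h4 : u % p = i := by omega
      have h5 := Int.mul_ediv_add_emod u p
      refine ⟨u / p, ?_⟩
      have : x = η + (p : ℤ) ^ b * u := by linarith
      rw [this, pow_succ]
      rw [h4] at h5
      linear_combination (-(p : ℤ) ^ b) * h5
    · rintro ⟨u, hu⟩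
      have h1 : x - η = (p : ℤ) ^ b * (i + p * u) := by
        rw [pow_succ] at hu; linear_combination hu
      refine ⟨⟨_, h1⟩, ?_⟩
      rw [h1, Int.mul_ediv_cancel_left _ hpb.ne', Int.add_mul_emod_self_left,
        Int.emod_eq_of_lt (by positivity) (by exact_mod_cast hi)]
      simp
  · intro x _
    rw [mem_range]
    have h3 := Int.emod_nonneg ((x - η) / (p : ℤ) ^ b) hp'.ne'
    have h4 := Int.emod_lt_of_pos ((x - η) / (p : ℤ) ^ b) hp'
    omega

theorem fs_cls_split {d p : ℕ} (hp : 0 < p) (n b : ℕ) (η : ℤ) (α : Fin d → ℝ) :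
    fs (cls p n b η) α = ∑ i ∈ range p, fs (cls p n (b + 1) (η + i * (p : ℤ) ^ b)) α :=
  sum_cls hp n b η _

theorem cls_subset {p : ℕ} (hp : 0 < p) (n b : ℕ) (hb : b ≤ n) (η : ℤ) :
    cls p n b η ⊆ (Finset.Ico 0 ((p : ℤ) ^ (n - b))).image
      fun x => (p : ℤ) ^ b * x + η % (p : ℤ) ^ b := by
  have hp' : (0 : ℤ) < p := by exact_mod_cast hp
  have hpb : (0 : ℤ) < (p : ℤ) ^ b := by positivity
  intro x hx
  unfold cls at hx
  rw [mem_filter, mem_Ico] at hx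
  obtain ⟨⟨h0, h1⟩, h2⟩ := hx
  have h3 : x % (p : ℤ) ^ b = η % (p : ℤ) ^ b :=
    Int.emod_eq_emod_iff_emod_sub_eq_zero.2 (Int.emod_eq_zero_of_dvd h2)
  rw [mem_image]
  refine ⟨x / (p : ℤ) ^ b, ?_, ?_⟩
  · rw [mem_Ico]
    refine ⟨Int.ediv_nonneg h0 hpb.le, ?_⟩
    rw [Int.ediv_lt_iff_lt_mul hpb, ← pow_add, Nat.sub_add_cancel hb]; exact h1
  · rw [← h3]; exact Int.mul_ediv_add_emod x _

theorem Jc_cls {k p : ℕ} (hp : 0 < p) (n b : ℕ) (hb : b ≤ n) (η : ℤ) :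
    Jc (k * (k + 1)) k (cls p n b η) ≤ Jn k p (n - b) := by
  have hp' : (0 : ℤ) < p := by exact_mod_cast hp
  have hpb : (0 : ℤ) < (p : ℤ) ^ b := by positivity
  unfold Jn
  rw [← Jc_affine _ _ (Finset.Ico 0 ((p : ℤ) ^ (n - b))) ((p : ℤ) ^ b) (η % (p : ℤ) ^ b) hpb.ne']
  exact Jc_mono (cls_subset hp n b hb η)

theorem card_cls {p : ℕ} (hp : 0 < p) (n b : ℕ) (hb : b ≤ n) (η : ℤ) :
    (cls p n b η).card ≤ p ^ (n - b) := by
  refine (card_le_card (cls_subset hp n b hb η)).trans (card_image_le.trans ?_)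
  rw [Int.card_Ico, sub_zero]
  have : (p : ℤ) ^ (n - b) = ((p ^ (n - b) : ℕ) : ℤ) := by push_cast; rfl
  rw [this, Int.toNat_natCast]

def Inj (k p : ℕ) : Finset (Fin k → ℕ) :=
  (Fintype.piFinset fun _ : Fin k => range p).filter Function.Injective

theorem card_Inj (k p : ℕ) : (Inj k p).card ≤ p ^ k := by
  unfold Inj
  refine (card_filter_le _ _).trans ?_
  simp

theorem broad_narrow (k p : ℕ) (hk : 0 < k) (hp : 0 < p) (z : ℕ → ℂ) :
    (∃ i ∈ range p, ‖∑ i ∈ range p, z i‖ ≤ 2 * k * ‖z i‖) ∨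
    ∃ ι ∈ Inj k p, ∀ j, ‖∑ i ∈ range p, z i‖ ≤ 2 * p * ‖z (ι j)‖ := by
  by_contra hcon
  push Not at hcon
  obtain ⟨h1, h2⟩ := hcon
  set Z := ‖∑ i ∈ range p, z i‖ with hZ
  have hk' : (0 : ℝ) < k := by exact_mod_cast hk
  have hp' : (0 : ℝ) < p := by exact_mod_cast hp
  have hZpos : 0 < Z := by
    have := h1 0 (mem_range.2 hp)
    exact (by positivity : (0:ℝ) ≤ 2 * k * ‖z 0‖).trans_lt this
  set B := (range p).filter fun i => Z ≤ 2 * p * ‖z i‖ with hB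
  have hBk : B.card < k := by
    by_contra hc
    push Not at hc
    obtain ⟨t, htB, htk⟩ := exists_subset_card_eq hc
    obtain ⟨j, hj⟩ := h2 (t.orderEmbOfFin htk) (by
      unfold Inj
      rw [mem_filter, Fintype.mem_piFinset]
      exact ⟨fun j => (mem_filter.1 (htB (orderEmbOfFin_mem t htk j))).1,
        (t.orderEmbOfFin htk).injective⟩)
    have := (mem_filter.1 (htB (orderEmbOfFin_mem t htk j))).2
    linarith
  have hsum : Z ≤ ∑ i ∈ B, ‖z i‖ + ∑ i ∈ (range p).filter (fun i => ¬ Z ≤ 2 * p * ‖z i‖), ‖z i‖ := by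
    rw [hB, sum_filter_add_sum_filter_not]; exact norm_sum_le _ _
  have hs1 : ∑ i ∈ B, ‖z i‖ ≤ B.card * (Z / (2 * k)) := by
    rw [← nsmul_eq_mul]
    apply sum_le_card_nsmul
    intro i hi
    have := h1 i (mem_filter.1 hi).1
    rw [le_div_iff₀ (by positivity)]; linarith
  have hs2 : ∑ i ∈ (range p).filter (fun i => ¬ Z ≤ 2 * p * ‖z i‖), ‖z i‖ ≤ p * (Z / (2 * p)) := by
    refine (sum_le_card_nsmul _ _ (Z / (2 * p)) ?_).trans ?_
    · intro i hi
      have := (mem_filter.1 hi).2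
      rw [le_div_iff₀ (by positivity)]; push Not at this; linarith
    · rw [nsmul_eq_mul]
      gcongr
      exact (card_filter_le _ _).trans (by simp)
  have hs3 : (B.card : ℝ) * (Z / (2 * k)) ≤ (k - 1) * (Z / (2 * k)) := by
    gcongr
    have : (B.card : ℝ) + 1 ≤ k := by exact_mod_cast hBk
    linarith
  have e1 : (p : ℝ) * (Z / (2 * p)) = Z / 2 := by field_simp
  have e2 : ((k : ℝ) - 1) * (Z / (2 * k)) = Z / 2 - Z / (2 * k) := by field_simp
  have : 0 < Z / (2 * k) := by positivity
  linarith

/-- well-conditioned product -/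
def FF {k : ℕ} (p n a : ℕ) (ξ : ℤ) (ι : Fin k → ℕ) (α : Fin k → ℝ) : ℝ :=
  ∏ i, ‖fs (cls p n (a + 1) (ξ + ι i * (p : ℤ) ^ a)) α‖

theorem FF_nonneg {k : ℕ} (p n a : ℕ) (ξ : ℤ) (ι : Fin k → ℕ) (α : Fin k → ℝ) :
    0 ≤ FF p n a ξ ι α := prod_nonneg fun _ _ => norm_nonneg _

theorem dichotomy {k : ℕ} (p : ℕ) (hk : 0 < k) (hp : 0 < p) (n b : ℕ) (η : ℤ) (α : Fin k → ℝ) :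
    (∃ i ∈ range p, ‖fs (cls p n b η) α‖ ≤ 2 * k * ‖fs (cls p n (b + 1) (η + i * (p : ℤ) ^ b)) α‖) ∨
    ∃ ι ∈ Inj k p, ‖fs (cls p n b η) α‖ ^ k ≤ (2 * p) ^ k * FF p n b η ι α := by
  rw [fs_cls_split hp n b η α]
  rcases broad_narrow k p hk hp (fun i => fs (cls p n (b + 1) (η + i * (p : ℤ) ^ b)) α) with h | h
  · exact Or.inl h
  · right
    obtain ⟨ι, hι, h⟩ := h
    refine ⟨ι, hι, ?_⟩
    unfold FF
    have : ((2 : ℝ) * p) ^ k = ∏ _i : Fin k, (2 * (p : ℝ)) := by simp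
    rw [this, ← prod_mul_distrib]
    set Z := ‖∑ i ∈ range p, fs (cls p n (b + 1) (η + i * (p : ℤ) ^ b)) α‖
    have e : Z ^ k = ∏ _i : Fin k, Z := by simp
    rw [e]
    exact prod_le_prod (fun _ _ => norm_nonneg _) (fun j _ => h j)

/-- conditioning inequality -/
theorem cond_step {k : ℕ} (p : ℕ) (hk : 0 < k) (hp : 0 < p) (n b : ℕ) (η : ℤ) (L : Fin k → ℕ)
    (G : (Fin k → ℝ) → ℝ) (hG : ∀ α, 0 ≤ G α) (m : ℕ) :
    av L (fun α => G α * ‖fs (cls p n b η) α‖ ^ (k * m)) ≤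
      (2 * k) ^ (k * m) * ∑ i ∈ range p,
        av L (fun α => G α * ‖fs (cls p n (b + 1) (η + i * (p : ℤ) ^ b)) α‖ ^ (k * m)) +
      (2 * p) ^ (k * m) * ∑ ι ∈ Inj k p, av L (fun α => G α * FF p n b η ι α ^ m) := by
  rw [← av_sum, ← av_sum, ← av_mul, ← av_mul, ← av_add]
  refine av_mono L fun α => ?_
  rw [← mul_sum, ← mul_sum]
  have hA : 0 ≤ ∑ i ∈ range p, ‖fs (cls p n (b + 1) (η + i * (p : ℤ) ^ b)) α‖ ^ (k * m) :=
    sum_nonneg fun _ _ => by positivity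
  have hB : 0 ≤ ∑ ι ∈ Inj k p, FF p n b η ι α ^ m :=
    sum_nonneg fun _ _ => pow_nonneg (FF_nonneg _ _ _ _ _ _) _
  have hg := hG α
  rcases dichotomy p hk hp n b η α with ⟨i, hi, h⟩ | ⟨ι, hι, h⟩
  · have h1 : ‖fs (cls p n b η) α‖ ^ (k * m) ≤ (2 * k) ^ (k * m) *
        ∑ i ∈ range p, ‖fs (cls p n (b + 1) (η + i * (p : ℤ) ^ b)) α‖ ^ (k * m) := by
      refine (pow_le_pow_left₀ (norm_nonneg _) h _).trans ?_
      rw [mul_pow]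
      gcongr
      exact single_le_sum (f := fun i : ℕ => ‖fs (cls p n (b + 1) (η + i * (p : ℤ) ^ b)) α‖ ^ (k * m))
        (fun _ _ => by positivity) hi
    have h2 : 0 ≤ (2 * p : ℝ) ^ (k * m) * (G α * ∑ ι ∈ Inj k p, FF p n b η ι α ^ m) := by positivity
    nlinarith [mul_le_mul_of_nonneg_left h1 hg]
  · have h1 : ‖fs (cls p n b η) α‖ ^ (k * m) ≤ (2 * p) ^ (k * m) *
        ∑ ι ∈ Inj k p, FF p n b η ι α ^ m := by
      rw [pow_mul]
      refine (pow_le_pow_left₀ (by positivity) h _).trans ?_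
      rw [mul_pow, ← pow_mul]
      gcongr
      exact single_le_sum (f := fun ι => FF p n b η ι α ^ m)
        (fun _ _ => pow_nonneg (FF_nonneg _ _ _ _ _ _) _) hι
    have h2 : 0 ≤ (2 * k : ℝ) ^ (k * m) * (G α * ∑ i ∈ range p,
      ‖fs (cls p n (b + 1) (η + i * (p : ℤ) ^ b)) α‖ ^ (k * m)) := by positivity
    nlinarith [mul_le_mul_of_nonneg_left h1 hg]

theorem initial_step {k : ℕ} (p : ℕ) (hk : 0 < k) (hp : 0 < p) (n : ℕ) (L : Fin k → ℕ) :
    av L (fun α => ‖fs (cls p n 0 0) α‖ ^ (2 * (k * (k + 1)))) ≤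
      (2 * k) ^ (2 * (k * (k + 1))) * ∑ i ∈ range p,
        av L (fun α => ‖fs (cls p n (0 + 1) (0 + i * (p : ℤ) ^ 0)) α‖ ^ (2 * (k * (k + 1)))) +
      (2 * p) ^ (2 * k) * ∑ ι ∈ Inj k p,
        av L (fun α => FF p n 0 0 ι α ^ 2 * ‖fs (cls p n 0 0) α‖ ^ (k * (2 * k))) := by
  rw [← av_sum, ← av_sum, ← av_mul, ← av_mul, ← av_add]
  refine av_mono L fun α => ?_
  rcases dichotomy p hk hp n 0 0 α with ⟨i, hi, h⟩ | ⟨ι, hι, h⟩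
  · refine le_add_of_le_of_nonneg ?_ (by positivity)
    refine (pow_le_pow_left₀ (norm_nonneg _) h _).trans ?_
    rw [mul_pow]
    gcongr
    exact single_le_sum (f := fun i : ℕ => ‖fs (cls p n (0 + 1) (0 + i * (p : ℤ) ^ 0)) α‖ ^
      (2 * (k * (k + 1)))) (fun _ _ => by positivity) hi
  · refine le_add_of_nonneg_of_le (by positivity) ?_
    have e : 2 * (k * (k + 1)) = k * 2 + k * (2 * k) := by ring
    rw [e, pow_add, pow_mul, mul_comm 2 k, pow_mul]
    have h1 : (‖fs (cls p n 0 0) α‖ ^ k) ^ 2 ≤ ((2 * p) ^ k) ^ 2 * FF p n 0 0 ι α ^ 2 := by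
      rw [← mul_pow]; exact pow_le_pow_left₀ (by positivity) h _
    refine (mul_le_mul_of_nonneg_right h1 (by positivity)).trans ?_
    rw [mul_assoc, ← pow_mul (2 * (p : ℝ)) k 2]
    gcongr
    exact single_le_sum (f := fun ι => FF p n 0 0 ι α ^ 2 * (‖fs (cls p n 0 0) α‖ ^ k) ^ (k * 2))
        (fun _ _ => by positivity) hι

end VMV
end

noncomputable section
open Finset
namespace VMV

theorem newton_unique {R : Type*} [CommRing R] (k : ℕ) (y y' : Fin k → R)
    (hu : ∀ m : ℕ, 1 ≤ m → m ≤ k → IsUnit (m : R))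
    (h : ∀ m ≤ k, ∑ i, y i ^ m = ∑ i, y' i ^ m) (X : R) :
    ∏ i, (X - y i) = ∏ i, (X - y' i) := by
  have he : ∀ m, m ≤ k → MvPolynomial.aeval y (MvPolynomial.esymm (Fin k) R m) =
      MvPolynomial.aeval y' (MvPolynomial.esymm (Fin k) R m) := by
    intro m
    induction m using Nat.strong_induction_on with
    | _ m ih =>
      intro hm
      rcases Nat.eq_zero_or_pos m with rfl | hpos
      · simp
      have key : ∀ z : Fin k → R, (m : R) * MvPolynomial.aeval z (MvPolynomial.esymm (Fin k) R m) =
          (-1) ^ (m + 1) * ∑ a ∈ antidiagonal m with a.1 < m,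
            (-1) ^ a.1 * MvPolynomial.aeval z (MvPolynomial.esymm (Fin k) R a.1) * ∑ i, z i ^ a.2 := by
        intro z
        have := congrArg (MvPolynomial.aeval z) (MvPolynomial.mul_esymm_eq_sum (Fin k) R m)
        simpa [MvPolynomial.psum] using this
      apply (hu m hpos hm).mul_left_cancel
      rw [key, key]
      congr 1
      refine sum_congr rfl fun a ha => ?_
      rw [mem_filter, HasAntidiagonal.mem_antidiagonal] at ha
      rw [ih a.1 ha.2 (by omega), h a.2 (by omega)]
  have hp : ∀ z : Fin k → R, ∏ i, (X - z i) = ∑ j ∈ range (k + 1),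
      (-1) ^ j * (MvPolynomial.aeval z (MvPolynomial.esymm (Fin k) R j) * X ^ (k - j)) := by
    intro z
    have := congrArg (Polynomial.eval X)
      (Multiset.prod_X_sub_X_eq_sum_esymm (univ.val.map z : Multiset R))
    simp only [Multiset.map_map, Multiset.card_map, card_val, card_univ, Fintype.card_fin] at this
    rw [← Finset.prod_eq_multiset_prod, Polynomial.eval_prod, Polynomial.eval_finsetSum] at this
    simpa [MvPolynomial.aeval_esymm_eq_multiset_esymm] using this
  rw [hp, hp]
  refine sum_congr rfl fun j hj => ?_
  rw [mem_range] at hj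
  rw [he j (by omega)]

theorem emod_recover (M N X Y : ℤ) (h1 : X % M = Y % M)
    (h2 : X % (M * N) / M = Y % (M * N) / M) : X % (M * N) = Y % (M * N) := by
  rw [← Int.mul_ediv_add_emod (X % (M * N)) M, ← Int.mul_ediv_add_emod (Y % (M * N)) M, h2,
    Int.emod_emod_of_dvd X (dvd_mul_right M N), Int.emod_emod_of_dvd Y (dvd_mul_right M N), h1]

/-- distinct-mod-`p` roots are determined by their power sums -/
theorem pow_unique (k p e : ℕ) (hp : p.Prime) (hk : k < p) (y y' : Fin k → ℤ) (ι : Fin k → ℕ)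
    (hι : ι ∈ Inj k p) (hy : ∀ i, (p : ℤ) ∣ y i - ι i) (hy' : ∀ i, (p : ℤ) ∣ y' i - ι i)
    (h : ∀ m ≤ k, (p : ℤ) ^ e ∣ ∑ i, y i ^ m - ∑ i, y' i ^ m) (i : Fin k) :
    (p : ℤ) ^ e ∣ y i - y' i := by
  have hcop : ∀ z : ℤ, ¬ (p : ℤ) ∣ z → IsUnit ((z : ℤ) : ZMod (p ^ e)) := by
    intro z hz
    rw [ZMod.coe_int_isUnit_iff_isCoprime]
    push_cast
    apply IsCoprime.pow_left
    exact (Prime.coprime_iff_not_dvd (Nat.prime_iff_prime_int.1 hp)).2 hz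
  have key := newton_unique (R := ZMod (p ^ e)) k (fun i => (y i : ZMod (p ^ e)))
    (fun i => (y' i : ZMod (p ^ e))) ?_ ?_ (y i)
  · rw [prod_eq_zero (mem_univ i) (by simp)] at key
    rw [← mul_prod_erase _ _ (mem_univ i)] at key
    have hun : IsUnit (∏ x ∈ univ.erase i, ((y i : ZMod (p ^ e)) - (y' x : ZMod (p ^ e)))) := by
      rw [IsUnit.prod_iff]
      intro x hx
      rw [mem_erase] at hx
      rw [← Int.cast_sub]
      apply hcop
      intro hd
      have h1 : (p : ℤ) ∣ (ι i : ℤ) - ι x := by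
        have h5 := dvd_sub (dvd_add hd (hy' x)) (hy i)
        have e5 : (ι i : ℤ) - ι x = y i - y' x + (y' x - ι x) - (y i - ι i) := by ring
        rw [e5]; exact h5
      unfold Inj at hι
      rw [mem_filter, Fintype.mem_piFinset] at hι
      have h2 := mem_range.1 (hι.1 i)
      have h3 := mem_range.1 (hι.1 x)
      have h4 := Int.eq_zero_of_abs_lt_dvd h1 (by rw [abs_lt]; omega)
      exact hx.1 (hι.2 (by omega : ι x = ι i))
    have h0 := (hun.mul_left_eq_zero).1 key.symm
    rw [← Int.cast_sub, ZMod.intCast_zmod_eq_zero_iff_dvd] at h0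
    push_cast at h0
    exact h0
  · intro m hm1 hm2
    have := hcop m (by
      intro hd
      have := Int.le_of_dvd (by exact_mod_cast hm1) hd
      omega)
    simpa using this
  · intro m hm
    have := (ZMod.intCast_zmod_eq_zero_iff_dvd (∑ i, y i ^ m - ∑ i, y' i ^ m) (p ^ e)).2
      (by push_cast; exact h m hm)
    push_cast at this
    exact sub_eq_zero.1 this

def TT {k : ℕ} (p a b : ℕ) (ξ : ℤ) (ι : Fin k → ℕ) : Finset (Fin k → ℤ) :=
  Fintype.piFinset fun i => cls p (k * b) (a + 1) (ξ + ι i * (p : ℤ) ^ a)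

def mm {k : ℕ} (p b : ℕ) (η : ℤ) (ζ : Fin k → ℤ) : Fin k → ℤ :=
  fun j => (∑ i, (ζ i - η) ^ ((j : ℕ) + 1)) % (p : ℤ) ^ (((j : ℕ) + 1) * b)

def yy {k : ℕ} (p a : ℕ) (ξ : ℤ) (ζ : Fin k → ℤ) : Fin k → ℤ := fun i => (ζ i - ξ) / (p : ℤ) ^ a

theorem yy_spec {k : ℕ} {p a b : ℕ} (hp : 0 < p) {ξ : ℤ} {ι : Fin k → ℕ} {ζ : Fin k → ℤ}
    (h : ζ ∈ TT p a b ξ ι) (i : Fin k) :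
    ζ i - ξ = (p : ℤ) ^ a * yy p a ξ ζ i ∧ (p : ℤ) ∣ yy p a ξ ζ i - ι i ∧
      0 ≤ ζ i ∧ ζ i < (p : ℤ) ^ (k * b) := by
  have hp' : (0 : ℤ) < p := by exact_mod_cast hp
  have hpa : (0 : ℤ) < (p : ℤ) ^ a := by positivity
  unfold TT at h
  rw [Fintype.mem_piFinset] at h
  have h1 := h i
  unfold cls at h1
  rw [mem_filter, mem_Ico] at h1
  obtain ⟨⟨h2, h3⟩, u, hu⟩ := h1
  have e : ζ i - ξ = (p : ℤ) ^ a * (ι i + p * u) := by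
    rw [pow_succ] at hu; linear_combination hu
  have e2 : yy p a ξ ζ i = ι i + p * u := by
    unfold yy; rw [e, Int.mul_ediv_cancel_left _ hpa.ne']
  rw [e2]
  exact ⟨e, ⟨u, by ring⟩, h2, h3⟩

theorem card_TT {k p a b : ℕ} (hp : 0 < p) (hab : a + 1 ≤ k * b) (ξ : ℤ) (ι : Fin k → ℕ) :
    (TT p a b ξ ι).card ≤ p ^ (k * (k * b - (a + 1))) := by
  unfold TT
  rw [Fintype.card_piFinset]
  refine (prod_le_prod' (fun i _ => card_cls hp (k * b) (a + 1) hab _)).trans ?_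
  simp [← pow_mul, mul_comm]

theorem TT_inj (k p a b : ℕ) (hp : p.Prime) (hk : k < p) (hab : a ≤ b)
    (ξ η : ℤ) (ι : Fin k → ℕ) (hι : ι ∈ Inj k p) (z z' : Fin k → ℤ)
    (hz : z ∈ TT p a b ξ ι) (hz' : z' ∈ TT p a b ξ ι) (hm : mm p b η z = mm p b η z')
    (hu : ∀ j : Fin k,
      (∑ i, (z i - η) ^ ((j : ℕ) + 1)) % (p : ℤ) ^ (k * b) / (p : ℤ) ^ (((j : ℕ) + 1) * b) =
      (∑ i, (z' i - η) ^ ((j : ℕ) + 1)) % (p : ℤ) ^ (k * b) / (p : ℤ) ^ (((j : ℕ) + 1) * b))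
    (hw : ∀ j : Fin k,
      (∑ i, (yy p a ξ z i) ^ ((j : ℕ) + 1)) % (p : ℤ) ^ (k * b - a) /
        (p : ℤ) ^ (k * b - ((j : ℕ) + 1) * a) =
      (∑ i, (yy p a ξ z' i) ^ ((j : ℕ) + 1)) % (p : ℤ) ^ (k * b - a) /
        (p : ℤ) ^ (k * b - ((j : ℕ) + 1) * a)) : z = z' := by
  have hp' : (0 : ℤ) < p := by exact_mod_cast hp.pos
  have h1 : ∀ m ≤ k, ∑ i, ((z i - η : ℤ) : ZMod (p ^ (k * b))) ^ m =
      ∑ i, ((z' i - η : ℤ) : ZMod (p ^ (k * b))) ^ m := by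
    intro m hm'
    rcases m with _ | j
    · simp
    have e : (p : ℤ) ^ (k * b) = (p : ℤ) ^ ((j + 1) * b) * (p : ℤ) ^ (k * b - (j + 1) * b) := by
      rw [← pow_add, Nat.add_sub_cancel' (Nat.mul_le_mul_right b hm')]
    have h2 := hu ⟨j, hm'⟩
    have h3 := congrFun hm ⟨j, hm'⟩
    unfold mm at h3
    simp only at h2 h3
    rw [e] at h2
    have h4 := emod_recover _ _ _ _ h3 h2
    rw [← e] at h4
    have h5 := (ZMod.intCast_eq_intCast_iff' (∑ i, (z i - η) ^ (j + 1)) (∑ i, (z' i - η) ^ (j + 1))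
      (p ^ (k * b))).2 (by push_cast; exact h4)
    push_cast at h5 ⊢
    exact h5
  have h2 := psum_trans k _ _ h1 ((η - ξ : ℤ) : ZMod (p ^ (k * b)))
  have h3 : ∀ m ≤ k, (p : ℤ) ^ (k * b - m * a) ∣
      ∑ i, yy p a ξ z i ^ m - ∑ i, yy p a ξ z' i ^ m := by
    intro m hm'
    have h4 := h2 m hm'
    have h5 : ∀ w : Fin k → ℤ, w ∈ TT p a b ξ ι →
        ∑ i, (((w i - η : ℤ) : ZMod (p ^ (k * b))) + ((η - ξ : ℤ) : ZMod (p ^ (k * b)))) ^ m =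
        ((p : ℤ) ^ (m * a) * ∑ i, yy p a ξ w i ^ m : ℤ) := by
      intro w hw'
      rw [mul_sum]
      push_cast
      refine sum_congr rfl fun i _ => ?_
      have h6 := (yy_spec hp.pos hw' i).1
      have h7 : ((w i : ZMod (p ^ (k * b))) - η + (η - ξ)) = ((p : ℤ) ^ a * yy p a ξ w i : ℤ) := by
        rw [← h6]; push_cast; ring
      rw [h7]; push_cast; rw [mul_pow, ← pow_mul, mul_comm a m]
    rw [h5 z hz, h5 z' hz', ZMod.intCast_eq_intCast_iff, Int.modEq_iff_dvd, ← mul_sub] at h4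
    push_cast at h4
    have hle : m * a ≤ k * b := Nat.mul_le_mul hm' hab
    have e : (p : ℤ) ^ (k * b) = (p : ℤ) ^ (m * a) * (p : ℤ) ^ (k * b - m * a) := by
      rw [← pow_add, Nat.add_sub_cancel' hle]
    rw [e] at h4
    have h8 := Int.dvd_of_mul_dvd_mul_left (by positivity) h4
    rw [← dvd_neg, neg_sub] at h8
    exact h8
  have h4 : ∀ m ≤ k, (p : ℤ) ^ (k * b - a) ∣
      ∑ i, yy p a ξ z i ^ m - ∑ i, yy p a ξ z' i ^ m := by
    intro m hm'
    rcases m with _ | j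
    · simp
    have hle : (j + 1) * a ≤ k * b := Nat.mul_le_mul hm' hab
    have e : (p : ℤ) ^ (k * b - a) = (p : ℤ) ^ (k * b - (j + 1) * a) * (p : ℤ) ^ (j * a) := by
      rw [← pow_add]; congr 1
      have : (j + 1) * a = j * a + a := by ring
      omega
    have h5 := hw ⟨j, hm'⟩
    simp only at h5
    rw [e] at h5
    have h6 := emod_recover _ _ _ _ (Int.emod_eq_emod_iff_emod_sub_eq_zero.2
      (Int.emod_eq_zero_of_dvd (h3 (j + 1) hm'))) h5
    rw [← e] at h6
    exact Int.dvd_of_emod_eq_zero (Int.emod_eq_emod_iff_emod_sub_eq_zero.1 h6)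
  have h5 := pow_unique k p (k * b - a) hp hk _ _ ι hι
    (fun i => (yy_spec hp.pos hz i).2.1) (fun i => (yy_spec hp.pos hz' i).2.1) h4
  funext i
  have hk0 : 1 ≤ k := i.pos
  have hle : a ≤ k * b := hab.trans (Nat.le_mul_of_pos_left b hk0)
  have h6 : (p : ℤ) ^ (k * b) ∣ z i - z' i := by
    have e : (p : ℤ) ^ (k * b) = (p : ℤ) ^ a * (p : ℤ) ^ (k * b - a) := by
      rw [← pow_add, Nat.add_sub_cancel' hle]
    have e2 : z i - z' i = (p : ℤ) ^ a * (yy p a ξ z i - yy p a ξ z' i) := by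
      linear_combination (yy_spec hp.pos hz i).1 - (yy_spec hp.pos hz' i).1
    rw [e, e2]
    exact mul_dvd_mul_left _ (h5 i)
  have h7 := (yy_spec hp.pos hz i).2.2
  have h8 := (yy_spec hp.pos hz' i).2.2
  have h9 := Int.eq_zero_of_abs_lt_dvd h6 (by rw [abs_lt]; constructor <;> linarith [h7.1, h7.2, h8.1, h8.2])
  linarith

theorem fiber_count (k p a b : ℕ) (hp : p.Prime) (hk : k < p) (hab : a ≤ b)
    (ξ η : ℤ) (ι : Fin k → ℕ) (hι : ι ∈ Inj k p) (c : Fin k → ℤ) :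
    ((TT p a b ξ ι).filter fun c' => mm p b η c' = mm p b η c).card ≤
      p ^ (k * (k - 1) / 2 * (a + b)) := by
  have hp' : (0 : ℤ) < p := by exact_mod_cast hp.pos
  set U : Finset (Fin k → ℤ) := Fintype.piFinset fun j : Fin k =>
    Finset.Ico (0 : ℤ) ((p : ℤ) ^ ((k - 1 - j) * b)) with hU
  set V : Finset (Fin k → ℤ) := Fintype.piFinset fun j : Fin k =>
    Finset.Ico (0 : ℤ) ((p : ℤ) ^ ((j : ℕ) * a)) with hV
  have hI : ∀ e : ℕ, (Finset.Ico (0 : ℤ) ((p : ℤ) ^ e)).card = p ^ e := by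
    intro e
    rw [Int.card_Ico, sub_zero]
    have : (p : ℤ) ^ e = ((p ^ e : ℕ) : ℤ) := by push_cast; rfl
    rw [this, Int.toNat_natCast]
  have hs : ∑ j : Fin k, (j : ℕ) = k * (k - 1) / 2 := by
    rw [Fin.sum_univ_eq_sum_range (fun j => j) k, Finset.sum_range_id]
  have hs2 : ∑ j : Fin k, (k - 1 - (j : ℕ)) = k * (k - 1) / 2 := by
    rw [Fin.sum_univ_eq_sum_range (fun j => k - 1 - j) k, Finset.sum_range_reflect (fun j => j) k,
      Finset.sum_range_id]
  have hcard : (U ×ˢ V).card = p ^ (k * (k - 1) / 2 * (a + b)) := by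
    rw [card_product, hU, hV, Fintype.card_piFinset, Fintype.card_piFinset]
    simp_rw [hI]
    rw [prod_pow_eq_pow_sum, prod_pow_eq_pow_sum, ← sum_mul, ← sum_mul, hs, hs2, ← pow_add]
    congr 1; ring
  rw [← hcard]
  have hdiv : ∀ (X : ℤ) (e f : ℕ), f ≤ e →
      X % (p : ℤ) ^ e / (p : ℤ) ^ f ∈ Finset.Ico (0 : ℤ) ((p : ℤ) ^ (e - f)) := by
    intro X e f hef
    rw [mem_Ico]
    have hpe : (0 : ℤ) < (p : ℤ) ^ e := by positivity
    have hpf : (0 : ℤ) < (p : ℤ) ^ f := by positivity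
    refine ⟨Int.ediv_nonneg (Int.emod_nonneg _ hpe.ne') hpf.le, ?_⟩
    rw [Int.ediv_lt_iff_lt_mul hpf, ← pow_add, Nat.sub_add_cancel hef]
    exact Int.emod_lt_of_pos _ hpe
  refine card_le_card_of_injOn (fun z => (
      fun j : Fin k => (∑ i, (z i - η) ^ ((j : ℕ) + 1)) % (p : ℤ) ^ (k * b) /
        (p : ℤ) ^ (((j : ℕ) + 1) * b),
      fun j : Fin k => (∑ i, (yy p a ξ z i) ^ ((j : ℕ) + 1)) % (p : ℤ) ^ (k * b - a) /
        (p : ℤ) ^ (k * b - ((j : ℕ) + 1) * a))) ?_ ?_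
  · intro z _
    simp only [coe_product, Set.mem_prod, mem_coe, hU, hV, Fintype.mem_piFinset]
    constructor
    · intro j
      have := hdiv (∑ i, (z i - η) ^ ((j : ℕ) + 1)) (k * b) (((j : ℕ) + 1) * b)
        (Nat.mul_le_mul_right b j.2)
      rwa [← Nat.sub_mul, show k - ((j : ℕ) + 1) = k - 1 - j by omega] at this
    · intro j
      have hle : ((j : ℕ) + 1) * a ≤ k * b := Nat.mul_le_mul j.2 hab
      have e : ((j : ℕ) + 1) * a = j * a + a := by ring
      have := hdiv (∑ i, (yy p a ξ z i) ^ ((j : ℕ) + 1)) (k * b - a) (k * b - ((j : ℕ) + 1) * a)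
        (by omega)
      rwa [show k * b - a - (k * b - ((j : ℕ) + 1) * a) = j * a by omega] at this
  · intro z hz z' hz' h
    simp only [coe_filter, Set.mem_ofPred_eq] at hz hz'
    simp only [Prod.mk.injEq] at h
    exact TT_inj k p a b hp hk hab ξ η ι hι z z' hz.1 hz'.1 (hz.2.trans hz'.2.symm)
      (fun j => congrFun h.1 j) (fun j => congrFun h.2 j)

end VMV
end

noncomputable section
open Finset
namespace VMV

theorem prod_le_sum_pow {k : ℕ} (hk : 0 < k) (u : Fin k → ℝ) (hu : ∀ i, 0 ≤ u i) :
    ∏ i, u i ≤ ∑ i, u i ^ k := by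
  have : Nonempty (Fin k) := ⟨⟨0, hk⟩⟩
  obtain ⟨i0, hi0⟩ := Finite.exists_max u
  calc ∏ i, u i ≤ ∏ _i : Fin k, u i0 := prod_le_prod (fun i _ => hu i) (fun i _ => hi0 i)
    _ = u i0 ^ k := by simp
    _ ≤ _ := single_le_sum (f := fun i => u i ^ k) (fun i _ => pow_nonneg (hu i) k) (mem_univ i0)

abbrev Idx (k : ℕ) := Fin k ⊕ Fin k × Fin k

def AA {k : ℕ} (A : Fin k → Finset ℤ) (p n b : ℕ) (η : ℤ) (ι' : Fin k → ℕ) : Idx k → Finset ℤ :=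
  Sum.elim A (fun q => cls p n (b + 1) (η + ι' q.1 * (p : ℤ) ^ b))

theorem prod_AA {k : ℕ} (A : Fin k → Finset ℤ) (p n b : ℕ) (η : ℤ) (ι' : Fin k → ℕ)
    (α : Fin k → ℝ) :
    ‖∏ q, fs (AA A p n b η ι' q) α‖ ^ 2 = (∏ i, ‖fs (A i) α‖) ^ 2 * FF p n b η ι' α ^ (2 * k) := by
  rw [Fintype.prod_sum_type, Fintype.prod_prod_type]
  simp only [AA, Sum.elim_inl, Sum.elim_inr, prod_const, card_univ, Fintype.card_fin]
  rw [norm_mul, norm_prod, norm_prod, mul_pow]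
  congr 1
  simp_rw [norm_pow]
  rw [prod_pow, ← pow_mul, mul_comm 2 k]; rfl

theorem mm_eq_of_pv {k p b : ℕ} (η : ℤ) (x y : Idx k → ℤ)
    (hx : ∀ q, (p : ℤ) ^ b ∣ x (Sum.inr q) - η) (hy : ∀ q, (p : ℤ) ^ b ∣ y (Sum.inr q) - η)
    (h : pv k x = pv k y) :
    mm p b η (fun i : Fin k => x (Sum.inl i) % (p : ℤ) ^ (k * b)) =
      mm p b η (fun i : Fin k => y (Sum.inl i) % (p : ℤ) ^ (k * b)) := by
  have h1 := psum_trans k x y ((pv_eq_iff k x y).1 h) (-η)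
  funext j
  have h2 := h1 (j + 1) j.2
  rw [Fintype.sum_sum_type, Fintype.sum_sum_type] at h2
  unfold mm
  have hA : ∀ w : Idx k → ℤ, (∑ i : Fin k, (w (Sum.inl i) % (p : ℤ) ^ (k * b) - η) ^ ((j : ℕ) + 1)) ≡
      ∑ i : Fin k, (w (Sum.inl i) + -η) ^ ((j : ℕ) + 1) [ZMOD (p : ℤ) ^ (((j : ℕ) + 1) * b)] := by
    intro w
    apply Int.ModEq.sum
    intro i _
    apply Int.ModEq.pow
    rw [← sub_eq_add_neg]
    apply Int.ModEq.sub_right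
    apply Int.ModEq.of_dvd (pow_dvd_pow (p : ℤ) (Nat.mul_le_mul_right b j.2 : ((j : ℕ) + 1) * b ≤ k * b))
    exact Int.mod_modEq _ _
  have hB : ∀ w : Idx k → ℤ, (∀ q, (p : ℤ) ^ b ∣ w (Sum.inr q) - η) →
      (∑ q : Fin k × Fin k, (w (Sum.inr q) + -η) ^ ((j : ℕ) + 1)) ≡ 0
        [ZMOD (p : ℤ) ^ (((j : ℕ) + 1) * b)] := by
    intro w hw
    rw [Int.modEq_zero_iff_dvd]
    apply dvd_sum
    intro q _
    rw [← sub_eq_add_neg, mul_comm, pow_mul]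
    exact pow_dvd_pow_of_dvd (hw q) _
  have h3 := hA x
  have h4 := hA y
  have h5 := hB x hx
  have h6 := hB y hy
  refine h3.trans (Int.ModEq.trans ?_ h4.symm)
  have h7 : (∑ i : Fin k, (x (Sum.inl i) + -η) ^ ((j : ℕ) + 1)) =
      ∑ i : Fin k, (y (Sum.inl i) + -η) ^ ((j : ℕ) + 1) +
      (∑ q : Fin k × Fin k, (y (Sum.inr q) + -η) ^ ((j : ℕ) + 1)) -
      (∑ q : Fin k × Fin k, (x (Sum.inr q) + -η) ^ ((j : ℕ) + 1)) := by linarith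
  rw [h7]
  have h8 := ((Int.ModEq.refl (∑ i : Fin k, (y (Sum.inl i) + -η) ^ ((j : ℕ) + 1))).add h6).sub h5
  simpa using h8

theorem congr_step {k : ℕ} (p n a b : ℕ) (hk0 : 0 < k) (hp : p.Prime) (hk : k < p) (hab : a ≤ b)
    (hab' : a + 1 ≤ k * b) (L : Fin k → ℕ)
    (hL : ∀ j : Fin k, k * (k + 1) * (p ^ n) ^ ((j : ℕ) + 1) < L j)
    (ξ η : ℤ) (ι ι' : Fin k → ℕ) (hι : ι ∈ Inj k p) (M : ℝ)
    (hM : ∀ ζ : ℤ, av L (fun α => ‖fs (cls p n (k * b) ζ) α‖ ^ (2 * k) *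
      FF p n b η ι' α ^ (2 * k)) ≤ M) :
    av L (fun α => FF p n a ξ ι α ^ 2 * FF p n b η ι' α ^ (2 * k)) ≤
      p ^ (k * (k - 1) / 2 * (a + b)) * (p ^ (k * (k * b - (a + 1))) * (k * M)) := by
  have hp' : (0 : ℤ) < p := by exact_mod_cast hp.pos
  set A : Fin k → Finset ℤ := fun i => cls p n (a + 1) (ξ + ι i * (p : ℤ) ^ a) with hA
  set s := Fintype.piFinset (AA A p n b η ι') with hs
  have hrange : ∀ x ∈ s, ∀ q, 0 ≤ x q ∧ x q ≤ (p ^ n : ℕ) := by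
    intro x hx q
    rw [hs, Fintype.mem_piFinset] at hx
    have := hx q
    rcases q with i | q
    · exact cls_range _ this
    · exact cls_range _ this
  have hLHS : av L (fun α => FF p n a ξ ι α ^ 2 * FF p n b η ι' α ^ (2 * k)) =
      av L (fun α => ‖∑ x ∈ s, ee (∑ j, α j * (pv k x j : ℤ))‖ ^ 2) := by
    congr 1; funext α
    rw [← prod_fs, prod_AA]; rfl
  have hMn : 0 ≤ M := (av_nonneg L fun α => by
    have := FF_nonneg p n b η ι' α
    positivity).trans (hM 0)
  rw [hLHS]
  have hfib := av_sq_fiber L s (fun x => pv k x) (fun j => (Nat.zero_le _).trans_lt (hL j)) ?_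
    (fun x => fun i : Fin k => x (Sum.inl i) % (p : ℤ) ^ (k * b)) (TT p a b ξ ι) ?_ (mm p b η) ?_
    (p ^ (k * (k - 1) / 2 * (a + b)))
    (fun c _ => fiber_count k p a b hp hk hab ξ η ι hι c)
  · refine hfib.trans ?_
    push_cast
    refine mul_le_mul_of_nonneg_left ?_ (by positivity)
    refine (sum_le_card_nsmul _ _ (k * M) ?_).trans ?_
    · intro c hc
      have e : s.filter (fun x => (fun i : Fin k => x (Sum.inl i) % (p : ℤ) ^ (k * b)) = c) =
          Fintype.piFinset (AA (fun i => cls p n (k * b) (c i)) p n b η ι') := by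
        ext x
        rw [mem_filter, hs, Fintype.mem_piFinset, Fintype.mem_piFinset]
        have hc' := hc
        unfold TT at hc'
        rw [Fintype.mem_piFinset] at hc'
        constructor
        · rintro ⟨h1, h2⟩ q
          rcases q with i | q
          · have h3 := h1 (Sum.inl i)
            have h4 := congrFun h2 i
            simp only [AA, Sum.elim_inl, hA, cls, mem_filter] at h3 ⊢
            refine ⟨h3.1, ?_⟩
            rw [← h4]
            exact Int.dvd_self_sub_emod
          · exact h1 (Sum.inr q)
        · intro h1
          have h3 : ∀ i, x (Sum.inl i) % (p : ℤ) ^ (k * b) = c i := by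
            intro i
            have h4 := h1 (Sum.inl i)
            have h5 := hc' i
            simp only [AA, Sum.elim_inl, cls, mem_filter, mem_Ico] at h4 h5
            rw [Int.emod_eq_emod_iff_emod_sub_eq_zero.2 (Int.emod_eq_zero_of_dvd h4.2)]
            exact Int.emod_eq_of_lt h5.1.1 h5.1.2
          refine ⟨?_, funext h3⟩
          intro q
          rcases q with i | q
          · have h4 := h1 (Sum.inl i)
            have h5 := hc' i
            simp only [AA, Sum.elim_inl, hA, cls, mem_filter] at h4 h5 ⊢
            refine ⟨h4.1, ?_⟩
            have h6 := dvd_add ((pow_dvd_pow (p : ℤ) hab').trans h4.2) h5.2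
            rwa [sub_add_sub_cancel] at h6
          · exact h1 (Sum.inr q)
      rw [e]
      have e2 : ∀ α : Fin k → ℝ, ‖∑ x ∈ Fintype.piFinset (AA (fun i => cls p n (k * b) (c i)) p n b η ι'),
          ee (∑ j, α j * (pv k x j : ℤ))‖ ^ 2 ≤ ∑ i, ‖fs (cls p n (k * b) (c i)) α‖ ^ (2 * k) *
            FF p n b η ι' α ^ (2 * k) := by
        intro α
        rw [← prod_fs, prod_AA, ← sum_mul, ← prod_pow]
        have := FF_nonneg p n b η ι' α
        gcongr
        refine (prod_le_sum_pow hk0 _ fun i => by positivity).trans (le_of_eq ?_)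
        exact sum_congr rfl fun i _ => by rw [← pow_mul]
      refine (av_mono L e2).trans ?_
      rw [av_sum]
      refine (sum_le_card_nsmul _ _ M fun i _ => hM (c i)).trans ?_
      simp
    · rw [nsmul_eq_mul]
      refine mul_le_mul_of_nonneg_right ?_ (by positivity)
      exact_mod_cast card_TT hp.pos hab' ξ ι
  · intro x hx y hy j
    refine (pv_bound (p ^ n) x y (hrange x hx) (hrange y hy) j).trans_lt ?_
    have := hL j
    have e : Fintype.card (Idx k) = k * (k + 1) := by
      simp [Fintype.card_sum, Fintype.card_prod]; ring
    rw [e]; exact_mod_cast this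
  · intro x hx
    unfold TT
    rw [Fintype.mem_piFinset]
    intro i
    rw [hs, Fintype.mem_piFinset] at hx
    have h1 := hx (Sum.inl i)
    simp only [AA, Sum.elim_inl, hA, cls, mem_filter, mem_Ico] at h1 ⊢
    have hpk : (0 : ℤ) < (p : ℤ) ^ (k * b) := by positivity
    refine ⟨⟨Int.emod_nonneg _ hpk.ne', Int.emod_lt_of_pos _ hpk⟩, ?_⟩
    have h2 : (p : ℤ) ^ (a + 1) ∣ x (Sum.inl i) - x (Sum.inl i) % (p : ℤ) ^ (k * b) :=
      (pow_dvd_pow (p : ℤ) hab').trans Int.dvd_self_sub_emod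
    have h3 := dvd_sub h1.2 h2
    obtain ⟨u, hu⟩ := h3; exact ⟨u, by linear_combination hu⟩
  · intro x hx y hy hxy
    rw [hs, Fintype.mem_piFinset] at hx hy
    refine mm_eq_of_pv η x y ?_ ?_ hxy
    · intro q
      have h1 := hx (Sum.inr q)
      simp only [AA, Sum.elim_inr, cls, mem_filter] at h1
      have h2 := (pow_dvd_pow (p : ℤ) (Nat.le_succ b)).trans h1.2
      have h3 := dvd_add h2 (Dvd.intro_left (ι' q.1 : ℤ) rfl : (p : ℤ) ^ b ∣ ι' q.1 * (p : ℤ) ^ b)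
      obtain ⟨u, hu⟩ := h3; exact ⟨u, by linear_combination hu⟩
    · intro q
      have h1 := hy (Sum.inr q)
      simp only [AA, Sum.elim_inr, cls, mem_filter] at h1
      have h2 := (pow_dvd_pow (p : ℤ) (Nat.le_succ b)).trans h1.2
      have h3 := dvd_add h2 (Dvd.intro_left (ι' q.1 : ℤ) rfl : (p : ℤ) ^ b ∣ ι' q.1 * (p : ℤ) ^ b)
      obtain ⟨u, hu⟩ := h3; exact ⟨u, by linear_combination hu⟩

end VMV
end

noncomputable section
open Finset
namespace VMV

theorem holder_sum {ι : Type*} (s : Finset ι) (m : ℕ) (hm : 1 ≤ m) (w u v : ι → ℝ)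
    (hw : ∀ i ∈ s, 0 ≤ w i) (hu : ∀ i ∈ s, 0 ≤ u i) (hv : ∀ i ∈ s, 0 ≤ v i)
    (h : ∀ i ∈ s, w i ^ m = u i * v i ^ (m - 1)) :
    (∑ i ∈ s, w i) ^ m ≤ (∑ i ∈ s, u i) * (∑ i ∈ s, v i) ^ (m - 1) := by
  rcases hm.lt_or_eq with hm | rfl
  swap
  · simp at h; simp; exact le_of_eq (sum_congr rfl h)
  have hm0 : (0 : ℝ) < m := by positivity
  have hm1 : (0 : ℝ) < m - 1 := by
    have : (1 : ℝ) < m := by exact_mod_cast hm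
    linarith
  have hcast : ((m - 1 : ℕ) : ℝ) = m - 1 := by push_cast [hm.le]; ring
  set q : ℝ := m / (m - 1) with hq
  have hpq : (m : ℝ).HolderConjugate q := by
    rw [Real.holderConjugate_iff]
    refine ⟨by linarith, ?_⟩
    rw [hq]; field_simp; ring
  have key := Real.inner_le_Lp_mul_Lq_of_nonneg s hpq (f := fun i => u i ^ (1 / (m : ℝ)))
    (g := fun i => v i ^ (1 / q)) (fun i hi => Real.rpow_nonneg (hu i hi) _)
    (fun i hi => Real.rpow_nonneg (hv i hi) _)
  have hq0 : q ≠ 0 := by rw [hq]; positivity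
  have e1 : ∑ i ∈ s, (u i ^ (1 / (m : ℝ))) ^ (m : ℝ) = ∑ i ∈ s, u i := by
    refine sum_congr rfl fun i hi => ?_
    rw [← Real.rpow_mul (hu i hi), one_div_mul_cancel hm0.ne', Real.rpow_one]
  have e2 : ∑ i ∈ s, (v i ^ (1 / q)) ^ q = ∑ i ∈ s, v i := by
    refine sum_congr rfl fun i hi => ?_
    rw [← Real.rpow_mul (hv i hi), one_div_mul_cancel hq0, Real.rpow_one]
  have e3 : ∑ i ∈ s, u i ^ (1 / (m : ℝ)) * v i ^ (1 / q) = ∑ i ∈ s, w i := by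
    refine sum_congr rfl fun i hi => ?_
    have hu' := hu i hi
    have hv' := hv i hi
    rw [← pow_left_inj₀ (by positivity) (hw i hi) (by omega : m ≠ 0), h i hi, mul_pow,
      ← Real.rpow_natCast (u i ^ _), ← Real.rpow_natCast (v i ^ _), ← Real.rpow_mul hu',
      ← Real.rpow_mul hv', one_div_mul_cancel hm0.ne', Real.rpow_one]
    congr 1
    rw [← Real.rpow_natCast, hcast]; congr 1
    rw [hq]; field_simp
  rw [e1, e2, e3] at key
  have hU : 0 ≤ ∑ i ∈ s, u i := sum_nonneg hu
  have hV : 0 ≤ ∑ i ∈ s, v i := sum_nonneg hv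
  refine (pow_le_pow_left₀ (sum_nonneg hw) key m).trans (le_of_eq ?_)
  rw [mul_pow, ← Real.rpow_natCast ((∑ i ∈ s, u i) ^ _), ← Real.rpow_natCast ((∑ i ∈ s, v i) ^ _),
    ← Real.rpow_mul hU, ← Real.rpow_mul hV, one_div_mul_cancel hm0.ne', Real.rpow_one]
  congr 1
  rw [← Real.rpow_natCast, hcast]; congr 1
  rw [hq]; field_simp

theorem av_holder {d : ℕ} (L : Fin d → ℕ) (m : ℕ) (hm : 1 ≤ m) (w u v : (Fin d → ℝ) → ℝ)
    (hw : ∀ α, 0 ≤ w α) (hu : ∀ α, 0 ≤ u α) (hv : ∀ α, 0 ≤ v α)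
    (h : ∀ α, w α ^ m = u α * v α ^ (m - 1)) :
    av L w ^ m ≤ av L u * av L v ^ (m - 1) := by
  unfold av
  have := holder_sum (Grid L) m hm (fun l => w (pt L l)) (fun l => u (pt L l))
    (fun l => v (pt L l)) (fun _ _ => hw _) (fun _ _ => hu _) (fun _ _ => hv _) (fun _ _ => h _)
  rw [mul_pow, mul_pow]
  have e : m = m - 1 + 1 := by omega
  set P := (∏ j, (L j : ℝ))⁻¹
  have hP : 0 ≤ P := inv_nonneg.2 (prod_nonneg fun _ _ => Nat.cast_nonneg _)
  calc P ^ m * _ ≤ P ^ m * ((∑ l ∈ Grid L, u (pt L l)) * (∑ l ∈ Grid L, v (pt L l)) ^ (m - 1)) := by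
        gcongr
    _ = P * (∑ l ∈ Grid L, u (pt L l)) * (P ^ (m - 1) * (∑ l ∈ Grid L, v (pt L l)) ^ (m - 1)) := by
        conv_lhs => rw [e, pow_succ]
        rw [Nat.add_sub_cancel]; ring

/-- standing data of the congruencing argument -/
structure Dat (k p n : ℕ) (L : Fin k → ℕ) : Prop where
  hk : 2 ≤ k
  hp : p.Prime
  hkp : k < p
  hL : ∀ j : Fin k, k * (k + 1) * (p ^ n) ^ ((j : ℕ) + 1) < L j

variable {k p n : ℕ} {L : Fin k → ℕ}

theorem av_cls (H : Dat k p n L) (b : ℕ) (hb : b ≤ n) (η : ℤ) :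
    av L (fun α => ‖fs (cls p n b η) α‖ ^ (2 * (k * (k + 1)))) ≤ Jn k p (n - b) := by
  rw [moment_fs L _ (p ^ n) _ cls_range H.hL]
  exact_mod_cast Jc_cls H.hp.pos n b hb η

theorem av_FF (H : Dat k p n L) (b : ℕ) (hb : b + 1 ≤ n) (η : ℤ) (ι : Fin k → ℕ) :
    av L (fun α => (FF p n b η ι α ^ 2) ^ (k + 1)) ≤ k * Jn k p (n - (b + 1)) := by
  have h1 : ∀ α : Fin k → ℝ, (FF p n b η ι α ^ 2) ^ (k + 1) ≤
      ∑ i, ‖fs (cls p n (b + 1) (η + ι i * (p : ℤ) ^ b)) α‖ ^ (2 * (k * (k + 1))) := by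
    intro α
    unfold FF
    rw [← prod_pow, ← prod_pow]
    refine (prod_le_sum_pow (by have := H.hk; omega) _ fun i => by positivity).trans (le_of_eq ?_)
    refine sum_congr rfl fun i _ => ?_
    rw [← pow_mul, ← pow_mul]; congr 1; ring
  refine (av_mono L h1).trans ?_
  rw [av_sum]
  refine (sum_le_card_nsmul _ _ (Jn k p (n - (b + 1)) : ℝ) fun i _ => av_cls H _ hb _).trans ?_
  simp

/-- trivial bound, `I` version and `K` version -/
theorem triv_bound (X Y : (Fin k → ℝ) → ℝ) (hX : ∀ α, 0 ≤ X α)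
    (hY : ∀ α, 0 ≤ Y α) (A B : ℝ) (hA : av L (fun α => X α ^ (k + 1)) ≤ A)
    (hB : av L (fun α => Y α ^ (k + 1)) ≤ B) :
    av L (fun α => X α * Y α ^ k) ^ (k + 1) ≤ A * B ^ k := by
  have := av_holder L (k + 1) (by omega) (fun α => X α * Y α ^ k) (fun α => X α ^ (k + 1))
    (fun α => Y α ^ (k + 1)) (fun α => mul_nonneg (hX α) (pow_nonneg (hY α) _))
    (fun α => pow_nonneg (hX α) _) (fun α => pow_nonneg (hY α) _)
    (fun α => by rw [Nat.add_sub_cancel, mul_pow, ← pow_mul, ← pow_mul]; ring)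
  rw [Nat.add_sub_cancel] at this
  have h0 : 0 ≤ av L (fun α => Y α ^ (k + 1)) := av_nonneg L fun α => pow_nonneg (hY α) _
  have h1 : 0 ≤ av L (fun α => X α ^ (k + 1)) := av_nonneg L fun α => pow_nonneg (hX α) _
  refine this.trans ?_
  exact mul_le_mul hA (pow_le_pow_left₀ h0 hB _) (pow_nonneg h0 _) (h1.trans hA)

/-- congruencing step with Hölder: `K(a,b)` in terms of `I(b,kb)` -/
theorem K_step (H : Dat k p n L) (a b : ℕ) (hab : a ≤ b) (hab' : a + 1 ≤ k * b) (hbn : b + 1 ≤ n)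
    (ξ η : ℤ) (ι ι' : Fin k → ℕ) (hι : ι ∈ Inj k p) (Q : ℝ)
    (hQ : ∀ ζ, av L (fun α => FF p n b η ι' α ^ 2 * ‖fs (cls p n (k * b) ζ) α‖ ^ (k * (2 * k))) ≤ Q) :
    av L (fun α => FF p n a ξ ι α ^ 2 * FF p n b η ι' α ^ (2 * k)) ^ k ≤
      (p ^ (k * (k - 1) / 2 * (a + b)) * (p ^ (k * (k * b - (a + 1))) * k)) ^ k *
        (Q * (k * Jn k p (n - (b + 1))) ^ (k - 1)) := by
  have hk := H.hk
  have hQ0 : 0 ≤ Q := (av_nonneg L fun α => by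
    have := FF_nonneg p n b η ι' α
    positivity).trans (hQ 0)
  set W := Q * (k * (Jn k p (n - (b + 1)) : ℝ)) ^ (k - 1) with hW
  have hW0 : 0 ≤ W := by positivity
  have h1 : ∀ ζ, av L (fun α => ‖fs (cls p n (k * b) ζ) α‖ ^ (2 * k) *
      FF p n b η ι' α ^ (2 * k)) ^ k ≤ W := by
    intro ζ
    have := av_holder L k (by omega)
      (fun α => ‖fs (cls p n (k * b) ζ) α‖ ^ (2 * k) * FF p n b η ι' α ^ (2 * k))
      (fun α => FF p n b η ι' α ^ 2 * ‖fs (cls p n (k * b) ζ) α‖ ^ (k * (2 * k)))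
      (fun α => (FF p n b η ι' α ^ 2) ^ (k + 1))
      (fun α => by have := FF_nonneg p n b η ι' α; positivity)
      (fun α => by have := FF_nonneg p n b η ι' α; positivity)
      (fun α => by have := FF_nonneg p n b η ι' α; positivity) ?_
    · refine this.trans ?_
      refine mul_le_mul (hQ ζ) ?_ ?_ hQ0
      · refine pow_le_pow_left₀ ?_ (av_FF H b hbn η ι') _
        exact av_nonneg L fun α => by positivity
      · exact pow_nonneg (av_nonneg L fun α => by positivity) _
    · intro α
      obtain ⟨k', rfl⟩ : ∃ k', k = k' + 1 := ⟨k - 1, by omega⟩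
      rw [Nat.add_sub_cancel]; ring
  set M := W ^ (1 / (k : ℝ)) with hM
  have hMk : M ^ k = W := by
    rw [hM, one_div, Real.rpow_inv_natCast_pow hW0 (by omega)]
  have hM0 : 0 ≤ M := by positivity
  have h2 := congr_step p n a b (by omega) H.hp H.hkp hab hab' L H.hL ξ η ι ι' hι M (fun ζ => by
    have := h1 ζ
    rw [← hMk] at this
    exact le_of_pow_le_pow_left₀ (by omega) hM0 this)
  have h3 := pow_le_pow_left₀ (av_nonneg L fun α => by
    have := FF_nonneg p n a ξ ι α
    have := FF_nonneg p n b η ι' α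
    positivity) h2 k
  refine h3.trans (le_of_eq ?_)
  rw [← hMk, ← mul_pow]; ring

end VMV
end

noncomputable section
open Finset
namespace VMV

variable {k p n : ℕ} {L : Fin k → ℕ}

theorem root_le (m : ℕ) (hm : 1 ≤ m) (x c P e : ℝ) (hc : 0 ≤ c) (hP : 0 < P)
    (h : x ^ m ≤ c ^ m * P ^ (m * e)) : x ≤ c * P ^ e := by
  apply le_of_pow_le_pow_left₀ (n := m) (by omega) (by positivity)
  rwa [mul_pow, ← Real.rpow_natCast (P ^ e), ← Real.rpow_mul hP.le, mul_comm e]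

/-- exponent -/
def Ex (k n a b : ℝ) : ℝ := (2 * k - k * (k + 1) / 2) * (n - a) + 2 * k ^ 2 * (n - b)

def lam (k : ℕ) (η : ℝ) : ℝ := 2 * (k * (k + 1)) - k * (k + 1) / 2 + η

theorem lam_ge (k : ℕ) (hk : 2 ≤ k) (η : ℝ) (hη : 0 ≤ η) : 9 ≤ lam k η := by
  unfold lam
  have : (2 : ℝ) ≤ k := by exact_mod_cast hk
  nlinarith

/-- Hypothesis on J with exponent excess eta -/
def PJ (k p : ℕ) (A η : ℝ) : Prop := ∀ m : ℕ, (Jn k p m : ℝ) ≤ A * (p : ℝ) ^ (m * lam k η)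

theorem triv_gen (H : Dat k p n L) (A η : ℝ) (hA : 1 ≤ A) (hη : 0 ≤ η) (a b : ℕ) (hab : a ≤ b)
    (X Y : (Fin k → ℝ) → ℝ) (hX : ∀ α, 0 ≤ X α) (hY : ∀ α, 0 ≤ Y α)
    (h1 : av L (fun α => X α ^ (k + 1)) ≤ k * A * (p : ℝ) ^ (((n : ℝ) - a) * lam k η))
    (h2 : av L (fun α => Y α ^ (k + 1)) ≤ k * A * (p : ℝ) ^ (((n : ℝ) - b) * lam k η)) :
    av L (fun α => X α * Y α ^ k) ≤
      k * A * (p : ℝ) ^ (Ex k n a b + η * n + (k * (k + 1) / 2) * b) := by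
  have hp1 : (1 : ℝ) ≤ p := by exact_mod_cast H.hp.pos
  have hp0 : (0 : ℝ) < p := by linarith
  apply root_le (k + 1) (by omega) _ _ _ _ (by positivity) hp0
  refine (triv_bound X Y hX hY _ _ h1 h2).trans ?_
  rw [mul_pow ((k : ℝ) * A) _ k, mul_mul_mul_comm, ← pow_succ', ← Real.rpow_natCast (_ ^ (_ : ℝ)) k,
    ← Real.rpow_mul hp0.le, ← Real.rpow_add hp0]
  gcongr
  unfold Ex lam
  have hab' : (a : ℝ) ≤ b := by exact_mod_cast hab
  have ha : (0 : ℝ) ≤ a := by positivity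
  have hk : (0 : ℝ) ≤ k := by positivity
  push_cast
  have e1 : 0 ≤ η * (a + k * b) := by positivity
  have e2 : 0 ≤ (k * (k + 1) / 2 : ℝ) * (k * a + b) := by positivity
  nlinarith

theorem J_le (hp : 1 ≤ p) {A η : ℝ} (hA : 0 ≤ A) (hk : 2 ≤ k) (hη : 0 ≤ η) (hJ : PJ k p A η)
    (b : ℕ) (hb : b ≤ n) (x : ℝ) (hx : x ≤ b) :
    (Jn k p (n - b) : ℝ) ≤ A * (p : ℝ) ^ (((n : ℝ) - x) * lam k η) := by
  refine (hJ _).trans ?_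
  have := lam_ge k hk η hη
  have hp1 : (1 : ℝ) ≤ p := by exact_mod_cast hp
  push_cast [hb]
  gcongr

theorem triv_K (H : Dat k p n L) (A η : ℝ) (hA : 1 ≤ A) (hη : 0 ≤ η) (hJ : PJ k p A η)
    (a b : ℕ) (hab : a ≤ b) (hb : b + 1 ≤ n) (ξ ζ : ℤ) (ι ι' : Fin k → ℕ) :
    av L (fun α => FF p n a ξ ι α ^ 2 * FF p n b ζ ι' α ^ (2 * k)) ≤
      k * A * (p : ℝ) ^ (Ex k n a b + η * n + (k * (k + 1) / 2) * b) := by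
  have hk := H.hk
  have := triv_gen H A η hA hη a b hab (fun α => FF p n a ξ ι α ^ 2) (fun α => FF p n b ζ ι' α ^ 2)
    (fun α => by positivity) (fun α => by positivity) ?_ ?_
  · simp_rw [← pow_mul] at this; exact this
  · refine (av_FF H a (by omega) ξ ι).trans ?_
    rw [mul_assoc]
    refine mul_le_mul_of_nonneg_left (J_le H.hp.pos (by linarith) hk hη hJ _ (by omega) _ ?_)
      (by positivity)
    push_cast; linarith
  · refine (av_FF H b (by omega) ζ ι').trans ?_
    rw [mul_assoc]
    refine mul_le_mul_of_nonneg_left (J_le H.hp.pos (by linarith) hk hη hJ _ (by omega) _ ?_)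
      (by positivity)
    push_cast; linarith

theorem triv_I (H : Dat k p n L) (A η : ℝ) (hA : 1 ≤ A) (hη : 0 ≤ η) (hJ : PJ k p A η)
    (a b : ℕ) (hab : a ≤ b) (ha : a + 1 ≤ n) (hb : b ≤ n) (ξ ζ : ℤ) (ι : Fin k → ℕ) :
    av L (fun α => FF p n a ξ ι α ^ 2 * ‖fs (cls p n b ζ) α‖ ^ (k * (2 * k))) ≤
      k * A * (p : ℝ) ^ (Ex k n a b + η * n + (k * (k + 1) / 2) * b) := by
  have hk := H.hk
  have hk' : (1 : ℝ) ≤ k := by exact_mod_cast (by omega : 1 ≤ k)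
  have hp0 : (0 : ℝ) < p := by exact_mod_cast H.hp.pos
  have := triv_gen H A η hA hη a b hab (fun α => FF p n a ξ ι α ^ 2)
    (fun α => ‖fs (cls p n b ζ) α‖ ^ (2 * k))
    (fun α => by positivity) (fun α => by positivity) ?_ ?_
  · simp_rw [← pow_mul] at this
    rw [mul_comm k (2 * k)]; exact this
  · refine (av_FF H a (by omega) ξ ι).trans ?_
    rw [mul_assoc]
    refine mul_le_mul_of_nonneg_left (J_le H.hp.pos (by linarith) hk hη hJ _ (by omega) _ ?_)
      (by positivity)
    push_cast; linarith
  · simp_rw [← pow_mul]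
    rw [mul_assoc 2]
    refine (av_cls H b hb ζ).trans ?_
    refine (J_le H.hp.pos (by linarith) hk hη hJ _ hb b le_rfl).trans ?_
    rw [mul_assoc]
    exact le_mul_of_one_le_left (by positivity) hk'

/-- conditioning -/
theorem cond_I (H : Dat k p n L) (hpk : (2 * k) ^ (k * (2 * k)) ≤ p) (A η δ Am : ℝ) (hA : 1 ≤ A)
    (hη : 0 ≤ η) (hδ : 0 ≤ δ) (hAm : 0 ≤ Am)
    (hJ : PJ k p A η) (a c h' : ℕ) (hac : a ≤ c) (ha : a + 1 ≤ n) (hc : c + h' ≤ n)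
    (hδH : δ * c ≤ h')
    (hK : ∀ h : ℕ, h < h' → ∀ (ξ ζ : ℤ) (ι ι' : Fin k → ℕ), ι ∈ Inj k p → ι' ∈ Inj k p →
      av L (fun α => FF p n a ξ ι α ^ 2 * FF p n (c + h) ζ ι' α ^ (2 * k)) ≤
        Am * (p : ℝ) ^ (Ex k n a (c + h) + η * n + (k * (k + 1) / 2 - δ) * (c + h)))
    (ξ ζ : ℤ) (ι : Fin k → ℕ) (hι : ι ∈ Inj k p) :
    av L (fun α => FF p n a ξ ι α ^ 2 * ‖fs (cls p n c ζ) α‖ ^ (k * (2 * k))) ≤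
      (k * A + 2 * ((2 * p) ^ (k * (2 * k)) * p ^ k * Am)) *
        (p : ℝ) ^ (Ex k n a c + η * n + (k * (k + 1) / 2 - δ) * c) := by
  have hk := H.hk
  have hk' : (2 : ℝ) ≤ k := by exact_mod_cast hk
  have hp0 : (0 : ℝ) < p := by exact_mod_cast H.hp.pos
  have hp2 : (2 : ℝ) ≤ p := by exact_mod_cast H.hp.two_le
  have hp1 : (1 : ℝ) ≤ p := by linarith
  set W := Ex k n a c + η * n + (k * (k + 1) / 2 - δ) * c with hW
  set A3 := (k * A + 2 * ((2 * p) ^ (k * (2 * k)) * p ^ k * Am) : ℝ) with hA3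
  have hC0 : 0 ≤ ((2 * p) ^ (k * (2 * k)) * p ^ k * Am : ℝ) := by positivity
  have hA30 : 0 ≤ A3 := by positivity
  have hEx : ∀ h : ℝ, Ex k n a (c + h) = Ex k n a c - 2 * k ^ 2 * h := by
    intro h; unfold Ex; ring
  have main : ∀ g : ℕ, g ≤ h' → ∀ ζ : ℤ,
      av L (fun α => FF p n a ξ ι α ^ 2 * ‖fs (cls p n (c + (h' - g)) ζ) α‖ ^ (k * (2 * k))) ≤
      A3 * (p : ℝ) ^ (W - 2 * k ^ 2 * ((h' - g : ℕ) : ℝ) + (k * (k + 1) / 2 + 1) * ((h' - g : ℕ) : ℝ)) := by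
    intro g
    induction g with
    | zero =>
      intro _ ζ
      refine (triv_I H A η hA hη hJ a (c + (h' - 0)) (by omega) ha (by omega) ξ ζ ι).trans ?_
      refine mul_le_mul (by rw [hA3]; linarith) ?_ (by positivity) hA30
      apply Real.rpow_le_rpow_of_exponent_le hp1
      push_cast [Nat.sub_zero]
      rw [hEx, hW]
      nlinarith
    | succ g ih =>
      intro hg ζ
      set h := h' - (g + 1) with hh
      have hh1 : h' - g = h + 1 := by omega
      rw [hh1] at ih
      have step := cond_step p (by omega) H.hp.pos n (c + h) ζ L
        (fun α => FF p n a ξ ι α ^ 2) (fun α => by positivity) (2 * k)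
      refine step.trans ?_
      set V := (p : ℝ) ^ (W - 2 * k ^ 2 * (h : ℝ) + (k * (k + 1) / 2 + 1) * (h : ℝ)) with hV
      have hV0 : 0 ≤ V := by positivity
      have t1 : ((2 : ℝ) * k) ^ (k * (2 * k)) * ∑ i ∈ range p,
          av L (fun α => FF p n a ξ ι α ^ 2 *
            ‖fs (cls p n (c + h + 1) (ζ + i * (p : ℤ) ^ (c + h))) α‖ ^ (k * (2 * k))) ≤ A3 * V / 2 := by
        have i1 : ∀ i ∈ range p, av L (fun α => FF p n a ξ ι α ^ 2 *
            ‖fs (cls p n (c + h + 1) (ζ + i * (p : ℤ) ^ (c + h))) α‖ ^ (k * (2 * k))) ≤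
            A3 * (p : ℝ) ^ (W - 2 * k ^ 2 * ((h + 1 : ℕ) : ℝ) + (k * (k + 1) / 2 + 1) * ((h + 1 : ℕ) : ℝ)) :=
          fun i _ => ih (by omega) _
        have i2 := sum_le_card_nsmul _ _ _ i1
        rw [card_range, nsmul_eq_mul] at i2
        have i3 : ((2 : ℝ) * k) ^ (k * (2 * k)) ≤ p := by exact_mod_cast hpk
        refine (mul_le_mul i3 i2 (sum_nonneg fun i _ => av_nonneg L fun α => by positivity)
          hp0.le).trans ?_
        have i4 : (p : ℝ) ^ (W - 2 * k ^ 2 * ((h + 1 : ℕ) : ℝ) + (k * (k + 1) / 2 + 1) * ((h + 1 : ℕ) : ℝ)) ≤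
            V * (p : ℝ) ^ (-3 : ℝ) := by
          rw [hV, ← Real.rpow_add hp0]
          apply Real.rpow_le_rpow_of_exponent_le hp1
          push_cast
          nlinarith
        have i5 : (p : ℝ) ^ (-3 : ℝ) = ((p : ℝ) ^ 3)⁻¹ := by
          rw [Real.rpow_neg hp0.le]; norm_cast
        rw [i5] at i4
        calc (p : ℝ) * (p * (A3 * _)) ≤ p * (p * (A3 * (V * ((p : ℝ) ^ 3)⁻¹))) := by gcongr
          _ = A3 * V / p := by field_simp
          _ ≤ A3 * V / 2 := by gcongr
      have t2 : ((2 : ℝ) * p) ^ (k * (2 * k)) * ∑ ι' ∈ Inj k p,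
          av L (fun α => FF p n a ξ ι α ^ 2 * FF p n (c + h) ζ ι' α ^ (2 * k)) ≤ A3 * V / 2 := by
        have i1 := sum_le_card_nsmul (Inj k p) _ _ (fun ι' hι' => hK h (by omega) ξ ζ ι ι' hι hι')
        rw [nsmul_eq_mul] at i1
        have i2 : ((Inj k p).card : ℝ) ≤ (p : ℝ) ^ k := by exact_mod_cast card_Inj k p
        have i3 : (p : ℝ) ^ (Ex k n a (c + h) + η * n + (k * (k + 1) / 2 - δ) * (c + h)) ≤ V := by
          apply Real.rpow_le_rpow_of_exponent_le hp1
          rw [hEx, hW]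
          have : 0 ≤ δ * h := by positivity
          nlinarith
        calc _ ≤ ((2 : ℝ) * p) ^ (k * (2 * k)) * ((p : ℝ) ^ k * (Am * V)) := by
              gcongr
              exact i1.trans (by gcongr)
          _ = ((2 * p) ^ (k * (2 * k)) * p ^ k * Am : ℝ) * V := by ring
          _ ≤ A3 / 2 * V := by
              gcongr
              have : 0 ≤ k * A := by positivity
              rw [hA3]; linarith
          _ = _ := by ring
      linarith
  have := main h' le_rfl ζ
  simpa using this

end VMV
end

noncomputable section
open Finset
namespace VMV

variable {k p n : ℕ} {L : Fin k → ℕ}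

def MM (k : ℕ) : ℕ → ℕ
  | 0 => 2
  | m + 1 => MM k m * (k * (1 + m * (k * (k + 1))))

theorem MM_ge (k : ℕ) (hk : 1 ≤ k) (m : ℕ) : 2 ≤ MM k m := by
  induction m with
  | zero => exact le_rfl
  | succ m ih =>
    unfold MM
    exact ih.trans (Nat.le_mul_of_pos_right _ (by positivity))

theorem cast_half (k : ℕ) (hk : 1 ≤ k) : ((k * (k - 1) / 2 : ℕ) : ℝ) = k * (k - 1) / 2 := by
  rw [Nat.cast_div]
  · push_cast [hk]; ring
  · rw [mul_comm]; have := Nat.even_mul_succ_self (k - 1)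
    rw [Nat.sub_add_cancel hk] at this; exact this.two_dvd
  · norm_num

theorem claim (hk : 2 ≤ k) (hpk : (2 * k) ^ (k * (2 * k)) ≤ p) (A η θ : ℝ) (hA : 1 ≤ A)
    (hη : 0 ≤ η) (hθ : 0 ≤ θ) (hθη : k * θ ≤ (k - 1) * η) (hθD : θ ≤ k * (k + 1))
    (hJ : PJ k p A η) (m : ℕ) :
    ∃ Am : ℝ, 1 ≤ Am ∧ ∀ (n : ℕ) (L : Fin k → ℕ), Dat k p n L → ∀ a b : ℕ, a ≤ b → 1 ≤ b →
      MM k m * b ≤ n → ∀ (ξ ζ : ℤ) (ι ι' : Fin k → ℕ), ι ∈ Inj k p → ι' ∈ Inj k p →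
      av L (fun α => FF p n a ξ ι α ^ 2 * FF p n b ζ ι' α ^ (2 * k)) ≤
        Am * (p : ℝ) ^ (Ex k n a b + η * n + (k * (k + 1) / 2 - m * θ) * b) := by
  have hk' : (2 : ℝ) ≤ k := by exact_mod_cast hk
  induction m with
  | zero =>
    refine ⟨k * A, by nlinarith, ?_⟩
    intro n L H a b hab hb hn ξ ζ ι ι' _ _
    unfold MM at hn
    have := triv_K H A η hA hη hJ a b hab (by omega) ξ ζ ι ι'
    simpa using this
  | succ m ih =>
    obtain ⟨Am, hAm, ih⟩ := ih
    set A3 := (k * A + 2 * ((2 * p) ^ (k * (2 * k)) * p ^ k * Am) : ℝ) with hA3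
    have hkA : 1 ≤ k * A := by nlinarith
    have hA31 : 1 ≤ A3 := by
      have : 0 ≤ ((2 * p) ^ (k * (2 * k)) * p ^ k * Am : ℝ) := by positivity
      linarith
    refine ⟨k * (A3 * (k * A)), ?_, ?_⟩
    · have : 1 ≤ A3 * (k * A) := one_le_mul_of_one_le_of_one_le hA31 hkA
      nlinarith
    intro n L H a b hab hb hn ξ ζ ι ι' hι hι'
    have hp0 : (0 : ℝ) < p := by exact_mod_cast H.hp.pos
    have hp1 : (1 : ℝ) ≤ p := by exact_mod_cast H.hp.pos
    have hM := MM_ge k (by omega) m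
    set h' := m * (k * (k + 1)) * (k * b) with hh'
    have hn' : MM k m * (k * b + h') ≤ n := by
      refine le_trans (le_of_eq ?_) hn
      rw [MM, hh']; ring
    have hn2 : 2 * (k * b + h') ≤ n := (Nat.mul_le_mul_right _ hM).trans hn'
    have hbk : 2 * b ≤ k * b := Nat.mul_le_mul_right _ hk
    have hI : ∀ ζ' : ℤ, av L (fun α => FF p n b ζ ι' α ^ 2 *
        ‖fs (cls p n (k * b) ζ') α‖ ^ (k * (2 * k))) ≤ A3 *
        (p : ℝ) ^ (Ex k n b (k * b) + η * n + (k * (k + 1) / 2 - m * θ) * (k * b)) := by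
      intro ζ'
      have := cond_I H hpk A η (m * θ) Am hA hη (by positivity) (by linarith) hJ b (k * b) h'
        (by omega) (by omega) (by omega) ?_ ?_ ζ ζ' ι' hι'
      · push_cast at this; exact this
      · rw [hh']
        push_cast
        have : (0 : ℝ) ≤ m * (k * b) := by positivity
        nlinarith
      · intro h hh ξ ζ ι ι' hι hι'
        have := ih n L H b (k * b + h) (by omega) (by omega)
          ((Nat.mul_le_mul_left _ (by omega)).trans hn') ξ ζ ι ι' hι hι'
        push_cast at this ⊢
        exact this
    have hK := K_step H a b hab (by omega) (by omega) ξ ζ ι ι' hι _ hI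
    apply root_le k (by omega) _ _ _ _ (by positivity) hp0
    refine hK.trans ?_
    have hJb := J_le H.hp.pos (by linarith) hk hη hJ (b + 1) (by omega : b + 1 ≤ n) b (by push_cast; linarith)
    have h1 : (p : ℝ) ^ (k * (k * b - (a + 1))) ≤ (p : ℝ) ^ ((k : ℝ) * (k * b - a)) := by
      rw [← Real.rpow_natCast]
      apply Real.rpow_le_rpow_of_exponent_le hp1
      push_cast [(by omega : a + 1 ≤ k * b)]
      nlinarith
    have h2 : (p : ℝ) ^ (k * (k - 1) / 2 * (a + b)) = (p : ℝ) ^ ((k : ℝ) * (k - 1) / 2 * (a + b)) := by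
      rw [← Real.rpow_natCast]
      push_cast [cast_half k (by omega)]
      rfl
    rw [h2]
    have h3 : (A3 * (k * A) ^ (k - 1) : ℝ) ≤ (A3 * (k * A)) ^ k := by
      rw [mul_pow A3]
      exact mul_le_mul (le_self_pow₀ hA31 (show k ≠ 0 by omega)) (pow_le_pow_right₀ hkA (by omega))
        (by positivity) (by positivity)
    calc _ ≤ ((p : ℝ) ^ ((k : ℝ) * (k - 1) / 2 * (a + b)) * ((p : ℝ) ^ ((k : ℝ) * (k * b - a)) * k)) ^ k *
        (A3 * (p : ℝ) ^ (Ex k n b (k * b) + η * n + (k * (k + 1) / 2 - m * θ) * (k * b)) *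
          (k * (A * (p : ℝ) ^ (((n : ℝ) - b) * lam k η))) ^ (k - 1)) := by gcongr
      _ = (k : ℝ) ^ k * (A3 * (k * A) ^ (k - 1)) * (p : ℝ) ^ (((k : ℝ) * (k - 1) / 2 * (a + b) + k * (k * b - a)) * k +
          (Ex k n b (k * b) + η * n + (k * (k + 1) / 2 - m * θ) * (k * b)) +
          (((n : ℝ) - b) * lam k η) * (k - 1 : ℕ)) := by
        generalize Ex k n b (k * b) + η * n + (k * (k + 1) / 2 - m * θ) * (k * b) = w1
        generalize ((n : ℝ) - b) * lam k η = w2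
        rw [Real.rpow_add hp0, Real.rpow_add hp0, Real.rpow_mul_natCast hp0.le, Real.rpow_mul_natCast hp0.le,
          Real.rpow_add hp0]
        ring
      _ ≤ (k : ℝ) ^ k * (A3 * (k * A)) ^ k * (p : ℝ) ^ ((k : ℝ) * (Ex k n a b + η * n + (k * (k + 1) / 2 - (m + 1 : ℕ) * θ) * b)) := by
        gcongr
        unfold Ex lam
        push_cast [(by omega : 1 ≤ k)]
        have : (k * θ) * b ≤ ((k - 1) * η) * b := by gcongr
        linarith
      _ = _ := by rw [← mul_pow]

end VMV
end

noncomputable section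
open Finset
namespace VMV

variable {k p n : ℕ} {L : Fin k → ℕ}

theorem fs_cls_full {d p : ℕ} (hp : 0 < p) (n b : ℕ) (α : Fin d → ℝ) :
    fs (cls p n 0 0) α = ∑ ζ ∈ range (p ^ b), fs (cls p n b (ζ : ℤ)) α := by
  have hpb : (0 : ℤ) < (p : ℤ) ^ b := by positivity
  unfold fs
  rw [← sum_fiberwise_of_maps_to (t := range (p ^ b)) (g := fun x : ℤ => (x % (p : ℤ) ^ b).toNat)]
  · refine sum_congr rfl fun i hi => sum_congr ?_ fun _ _ => rfl
    rw [mem_range] at hi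
    have hi' : (i : ℤ) < (p : ℤ) ^ b := by exact_mod_cast hi
    unfold cls
    rw [filter_filter]
    ext x
    simp only [mem_filter]
    refine and_congr_right fun _ => ?_
    have h3 := Int.emod_nonneg x hpb.ne'
    constructor
    · rintro ⟨_, h⟩
      have h4 : x % (p : ℤ) ^ b = i := by omega
      rw [← h4]
      exact Int.dvd_self_sub_emod
    · rintro h
      refine ⟨by simp, ?_⟩
      have h5 := Int.emod_emod_of_dvd x (dvd_refl ((p : ℤ) ^ b))
      have : x % (p : ℤ) ^ b = i := by
        rw [Int.emod_eq_emod_iff_emod_sub_eq_zero.2 (Int.emod_eq_zero_of_dvd h)]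
        exact Int.emod_eq_of_lt (by positivity) hi'
      rw [this]; simp
  · intro x _
    rw [mem_range]
    have h3 := Int.emod_nonneg x hpb.ne'
    have h4 := Int.emod_lt_of_pos x hpb
    have : (((p ^ b : ℕ)) : ℤ) = (p : ℤ) ^ b := by push_cast; rfl
    omega

theorem av_full (H : Dat k p n L) (b : ℕ) (X : (Fin k → ℝ) → ℝ) (hX : ∀ α, 0 ≤ X α) (w : ℕ)
    (Q : ℝ) (hQ : ∀ ζ : ℤ, av L (fun α => X α * ‖fs (cls p n b ζ) α‖ ^ w) ≤ Q) (hw : 1 ≤ w) :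
    av L (fun α => X α * ‖fs (cls p n 0 0) α‖ ^ w) ≤ ((p : ℝ) ^ b) ^ w * Q := by
  have hpt : ∀ α, X α * ‖fs (cls p n 0 0) α‖ ^ w ≤
      ((p : ℝ) ^ b) ^ (w - 1) * ∑ ζ ∈ range (p ^ b), X α * ‖fs (cls p n b (ζ : ℤ)) α‖ ^ w := by
    intro α
    rw [fs_cls_full H.hp.pos n b α, ← mul_sum, mul_left_comm]
    refine mul_le_mul_of_nonneg_left ?_ (hX α)
    have e : w = w - 1 + 1 := by omega
    have h1 := pow_sum_le_card_mul_sum_pow (s := range (p ^ b))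
      (f := fun ζ : ℕ => ‖fs (cls p n b (ζ : ℤ)) α‖) (fun _ _ => norm_nonneg _) (w - 1)
    rw [← e, card_range] at h1
    refine (pow_le_pow_left₀ (norm_nonneg _) (norm_sum_le _ _) _).trans ?_
    push_cast at h1
    exact h1
  refine (av_mono L hpt).trans ?_
  rw [av_mul, av_sum]
  have h2 := sum_le_card_nsmul (range (p ^ b)) _ _ (fun ζ _ => hQ (ζ : ℤ))
  rw [card_range, nsmul_eq_mul] at h2
  push_cast at h2
  calc _ ≤ ((p : ℝ) ^ b) ^ (w - 1) * ((p : ℝ) ^ b * Q) := by gcongr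
    _ = ((p : ℝ) ^ b) ^ (w - 1 + 1) * Q := by ring
    _ = _ := by rw [Nat.sub_add_cancel hw]

theorem Jn_triv (k p n : ℕ) : (Jn k p n : ℝ) ≤ (p : ℝ) ^ (2 * (k * (k + 1)) * n) := by
  have : Jn k p n ≤ (p ^ n) ^ (2 * (k * (k + 1))) := by
    refine (Jc_le _).trans (le_of_eq ?_)
    rw [Int.card_Ico, sub_zero]
    have : (p : ℤ) ^ n = ((p ^ n : ℕ) : ℤ) := by push_cast; rfl
    rw [this, Int.toNat_natCast]
  rw [mul_comm, pow_mul]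
  exact_mod_cast this

set_option maxHeartbeats 1000000 in
theorem improve (hk : 2 ≤ k) (hp : p.Prime) (hkp : k < p) (hpk : (2 * k) ^ (k * (2 * k)) ≤ p)
    (η₀ : ℝ) (h0 : 0 < η₀) (h0' : η₀ ≤ 1) :
    ∃ c : ℝ, 0 < c ∧ c ≤ 1 ∧ ∀ η A : ℝ, 1 ≤ A → η₀ ≤ η → PJ k p A η → ∃ A', 1 ≤ A' ∧ PJ k p A' (η - c) := by
  have hk' : (2 : ℝ) ≤ k := by exact_mod_cast hk
  have hp0 : (0 : ℝ) < p := by exact_mod_cast hp.pos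
  have hp1 : (1 : ℝ) ≤ p := by exact_mod_cast hp.pos
  have hp2 : (2 : ℝ) ≤ p := by exact_mod_cast hp.two_le
  set θ := η₀ / 2 with hθ
  obtain ⟨m, hm⟩ := exists_nat_ge ((k * (k + 1) / 2 + 1) / θ)
  have hm' : (k * (k + 1) / 2 - m * θ : ℝ) ≤ -1 := by
    rw [div_le_iff₀ (by positivity)] at hm
    linarith
  set M' := MM k m * (1 + m * (k * (k + 1))) with hM'
  have hM2 : 2 ≤ M' := (MM_ge k (by omega) m).trans (Nat.le_mul_of_pos_right _ (by positivity))
  have hM2' : (2 : ℝ) ≤ M' := by exact_mod_cast hM2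
  refine ⟨1 / M', by positivity, ?_, ?_⟩
  · rw [div_le_one (by positivity)]; linarith
  intro η A hA hη hJ
  have hθη : k * θ ≤ (k - 1) * η := by nlinarith
  have hθD : θ ≤ k * (k + 1) := by nlinarith
  obtain ⟨Am, hAm, hcl⟩ := claim hk hpk A η θ hA (by linarith) (by positivity) hθη hθD hJ m
  set A3 := (k * A + 2 * ((2 * p) ^ (k * (2 * k)) * p ^ k * Am) : ℝ) with hA3
  have hA30 : 0 ≤ A3 := by positivity
  set lam' := lam k (η - 1 / M') with hlam'
  have hl' : 8 ≤ lam' := by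
    have := lam_ge k hk η (by linarith)
    have : lam' = lam k η - 1 / M' := by rw [hlam']; unfold lam; ring
    have : (1 : ℝ) / M' ≤ 1 := by rw [div_le_one (by positivity)]; linarith
    linarith
  set B := ((2 * p : ℝ) ^ (2 * k) * (p ^ k * (A3 * p))) with hB
  have hB0 : 0 ≤ B := by positivity
  -- recursion
  have hrec : ∀ n : ℕ, M' ≤ n → (Jn k p n : ℝ) ≤ p ^ 3 * Jn k p (n - 1) + B * (p : ℝ) ^ (n * lam') := by
    intro n hn
    set L : Fin k → ℕ := fun j => k * (k + 1) * (p ^ n) ^ ((j : ℕ) + 1) + 1 with hL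
    have H : Dat k p n L := ⟨hk, hp, hkp, fun j => Nat.lt_succ_self _⟩
    have h1 := initial_step p (by omega : 0 < k) hp.pos n L
    have hcl0 : cls p n 0 0 = Finset.Ico 0 ((p : ℤ) ^ n) := by
      unfold cls; simp
    have h2 : av L (fun α => ‖fs (cls p n 0 0) α‖ ^ (2 * (k * (k + 1)))) = Jn k p n := by
      rw [moment_fs L _ (p ^ n) _ cls_range H.hL, hcl0]; rfl
    rw [h2] at h1
    refine h1.trans (add_le_add ?_ ?_)
    · have i2 := sum_le_card_nsmul (range p) _ _
        (fun i _ => av_cls H (0 + 1) (by omega : 0 + 1 ≤ n) (0 + i * (p : ℤ) ^ 0))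
      rw [card_range, nsmul_eq_mul, zero_add] at i2
      have i3 : ((2 : ℝ) * k) ^ (2 * (k * (k + 1))) ≤ (p : ℝ) ^ 2 := by
        calc ((2 : ℝ) * k) ^ (2 * (k * (k + 1))) ≤ ((2 : ℝ) * k) ^ (k * (2 * k) * 2) := by
              apply pow_le_pow_right₀ (by linarith)
              nlinarith
          _ = (((2 : ℝ) * k) ^ (k * (2 * k))) ^ 2 := by rw [pow_mul]
          _ ≤ _ := by
              gcongr
              exact_mod_cast hpk
      refine (mul_le_mul i3 i2 (sum_nonneg fun i _ => av_nonneg L fun α => by positivity)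
        (by positivity)).trans (le_of_eq (by ring))
    · set b := n / M' with hb
      have hb1 : 1 ≤ b := (Nat.one_le_div_iff (by omega)).2 hn
      have hbn : M' * b ≤ n := Nat.mul_div_le _ _
      set h' := m * (k * (k + 1)) * b with hh'
      have hMb : MM k m * (b + h') ≤ n := by
        refine le_trans (le_of_eq ?_) hbn
        rw [hM', hh']; ring
      have hbh : 2 * (b + h') ≤ n := (Nat.mul_le_mul_right _ (MM_ge k (by omega) m)).trans hMb
      have hI : ∀ ι ∈ Inj k p, ∀ ζ : ℤ, av L (fun α => FF p n 0 0 ι α ^ 2 *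
          ‖fs (cls p n b ζ) α‖ ^ (k * (2 * k))) ≤
          A3 * (p : ℝ) ^ (Ex k n 0 b + η * n + (k * (k + 1) / 2 - m * θ) * b) := by
        intro ι hι ζ
        have := cond_I H hpk A η (m * θ) Am hA (by linarith) (by positivity) (by linarith) hJ 0 b h'
          (by omega) (by omega) (by omega) ?_ ?_ 0 ζ ι hι
        · simpa using this
        · rw [hh']
          push_cast
          have : (0 : ℝ) ≤ m * b := by positivity
          nlinarith
        · intro h hh ξ ζ ι ι' hι hι'
          have := hcl n L H 0 (b + h) (by omega) (by omega)
            ((Nat.mul_le_mul_left _ (by omega)).trans hMb) ξ ζ ι ι' hι hι'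
          push_cast at this ⊢
          exact this
      have hI2 : ∀ ι ∈ Inj k p, av L (fun α => FF p n 0 0 ι α ^ 2 *
          ‖fs (cls p n 0 0) α‖ ^ (k * (2 * k))) ≤ A3 * p * (p : ℝ) ^ (n * lam') := by
        intro ι hι
        refine (av_full H b _ (fun α => by positivity) _ _ (hI ι hι) (by nlinarith)).trans ?_
        have e1 : ((p : ℝ) ^ b) ^ (k * (2 * k)) = (p : ℝ) ^ ((b : ℝ) * (k * (2 * k))) := by
          rw [← pow_mul, ← Real.rpow_natCast]; push_cast; rfl
        rw [e1, mul_left_comm, ← Real.rpow_add hp0, mul_assoc]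
        refine mul_le_mul_of_nonneg_left ?_ hA30
        rw [← Real.rpow_one_add' hp0.le (by positivity)]
        apply Real.rpow_le_rpow_of_exponent_le hp1
        have hb2 : (n : ℝ) / M' ≤ b + 1 := by
          rw [div_le_iff₀ (by positivity)]
          have : n < M' * (b + 1) := Nat.lt_mul_div_succ n (by omega)
          have : (n : ℝ) < M' * (b + 1) := by exact_mod_cast this
          linarith
        have hb3 : (k * (k + 1) / 2 - m * θ : ℝ) * b ≤ -1 * b := by gcongr
        have : (n : ℝ) * lam' = n * lam k η - n / M' := by rw [hlam']; unfold lam; ring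
        rw [this]
        unfold Ex lam
        linarith
      have i1 := sum_le_card_nsmul (Inj k p) _ _ hI2
      rw [nsmul_eq_mul] at i1
      have i2 : ((Inj k p).card : ℝ) ≤ (p : ℝ) ^ k := by exact_mod_cast card_Inj k p
      calc _ ≤ ((2 : ℝ) * p) ^ (2 * k) * ((p : ℝ) ^ k * (A3 * p * (p : ℝ) ^ (n * lam'))) := by
              gcongr
              exact i1.trans (by gcongr)
        _ = _ := by rw [hB]; ring
  -- induction
  set A' := (p : ℝ) ^ (2 * (k * (k + 1)) * M') + 2 * B with hA'
  have hpM : (1 : ℝ) ≤ (p : ℝ) ^ (2 * (k * (k + 1)) * M') := one_le_pow₀ hp1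
  have hA'1 : 1 ≤ A' := by linarith
  refine ⟨A', hA'1, fun n => ?_⟩
  rw [← hlam']
  induction n with
  | zero =>
    have := Jn_triv k p 0
    rw [mul_zero, pow_zero] at this
    rw [Nat.cast_zero, zero_mul, Real.rpow_zero, mul_one]; linarith
  | succ n ih =>
    have hpow1 : (1 : ℝ) ≤ (p : ℝ) ^ (((n + 1 : ℕ) : ℝ) * lam') := Real.one_le_rpow hp1 (by positivity)
    by_cases hn : M' ≤ n + 1
    · refine (hrec _ hn).trans ?_
      rw [Nat.add_sub_cancel]
      have e : (p : ℝ) ^ 3 * (p : ℝ) ^ (n * lam') ≤ (p : ℝ) ^ (((n + 1 : ℕ) : ℝ) * lam') / 2 := by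
        rw [le_div_iff₀ (by norm_num)]
        calc (p : ℝ) ^ 3 * (p : ℝ) ^ (n * lam') * 2 ≤ (p : ℝ) ^ 3 * (p : ℝ) ^ (n * lam') * p := by gcongr
          _ = (p : ℝ) ^ (n * lam' + 4) := by
            rw [Real.rpow_add hp0, show (4 : ℝ) = (4 : ℕ) by norm_num, Real.rpow_natCast]; ring
          _ ≤ _ := by
            apply Real.rpow_le_rpow_of_exponent_le hp1
            push_cast; nlinarith
      calc _ ≤ (p : ℝ) ^ 3 * (A' * (p : ℝ) ^ (n * lam')) + B * (p : ℝ) ^ (((n + 1 : ℕ) : ℝ) * lam') := by gcongr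
        _ = A' * ((p : ℝ) ^ 3 * (p : ℝ) ^ (n * lam')) + B * (p : ℝ) ^ (((n + 1 : ℕ) : ℝ) * lam') := by ring
        _ ≤ A' * ((p : ℝ) ^ (((n + 1 : ℕ) : ℝ) * lam') / 2) + (A' / 2) * (p : ℝ) ^ (((n + 1 : ℕ) : ℝ) * lam') := by
          gcongr
          linarith
        _ = _ := by ring
    · refine (Jn_triv k p (n + 1)).trans ?_
      have : (p : ℝ) ^ (2 * (k * (k + 1)) * (n + 1)) ≤ A' := by
        have : (p : ℝ) ^ (2 * (k * (k + 1)) * (n + 1)) ≤ (p : ℝ) ^ (2 * (k * (k + 1)) * M') :=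
          pow_le_pow_right₀ hp1 (Nat.mul_le_mul_left _ (by omega))
        linarith
      refine this.trans (le_mul_of_one_le_right (by linarith) hpow1)

theorem PJ_mono (hp : 1 ≤ p) {A A' η η' : ℝ} (hA : 0 ≤ A) (h : A ≤ A') (h' : η ≤ η') (H : PJ k p A η) :
    PJ k p A' η' := by
  intro m
  have hp1 : (1 : ℝ) ≤ p := by exact_mod_cast hp
  refine (H m).trans ?_
  have : lam k η ≤ lam k η' := by unfold lam; linarith
  have hA' : 0 ≤ A' := hA.trans h
  gcongr

theorem PJ_all (hk : 2 ≤ k) (hp : p.Prime) (hkp : k < p) (hpk : (2 * k) ^ (k * (2 * k)) ≤ p)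
    (ε : ℝ) (hε : 0 < ε) (hε1 : ε ≤ 1) : ∃ A : ℝ, 1 ≤ A ∧ PJ k p A ε := by
  obtain ⟨c, hc, hc1, h⟩ := improve hk hp hkp hpk ε hε hε1
  have main : ∀ i : ℕ, ∃ A : ℝ, 1 ≤ A ∧ PJ k p A (max ε (k * (k + 1) / 2 - i * c)) := by
    intro i
    induction i with
    | zero =>
      refine ⟨1, le_rfl, ?_⟩
      apply PJ_mono hp.pos zero_le_one le_rfl (η := (k * (k + 1) / 2 : ℝ))
      · refine le_trans ?_ (le_max_right _ _); simp
      · intro m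
        refine (Jn_triv k p m).trans (le_of_eq ?_)
        rw [← Real.rpow_natCast, one_mul]
        congr 1
        unfold lam
        push_cast; ring
    | succ i ih =>
      obtain ⟨A, hA, hJ⟩ := ih
      by_cases hi : (k * (k + 1) / 2 - i * c : ℝ) ≤ ε
      · refine ⟨A, hA, PJ_mono hp.pos (by linarith) le_rfl ?_ hJ⟩
        rw [max_eq_left hi]; exact le_max_left _ _
      · push Not at hi
        obtain ⟨A', hA', hJ'⟩ := h _ A hA (le_max_left _ _) hJ
        refine ⟨A', hA', PJ_mono hp.pos (by linarith) le_rfl ?_ hJ'⟩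
        rw [max_eq_right hi.le]
        refine le_trans (le_of_eq ?_) (le_max_right _ _)
        push_cast; ring
  obtain ⟨i, hi⟩ := exists_nat_ge ((k * (k + 1) / 2 : ℝ) / c)
  obtain ⟨A, hA, hJ⟩ := main i
  rw [div_le_iff₀ hc] at hi
  rw [max_eq_left (by linarith)] at hJ
  exact ⟨A, hA, hJ⟩

/-- Vinogradov mean value theorem -/
theorem vmvt (k : ℕ) (hk : 2 ≤ k) (ε : ℝ) (hε : 0 < ε) (hε1 : ε ≤ 1) :
    ∃ A : ℝ, 1 ≤ A ∧ ∀ N : ℕ, 1 ≤ N →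
      (Jc (k * (k + 1)) k (Finset.Ico 0 (N : ℤ)) : ℝ) ≤ A * (N : ℝ) ^ (lam k ε) := by
  obtain ⟨p, hp1, hp⟩ := Nat.exists_infinite_primes (k + 1 + (2 * k) ^ (k * (2 * k)))
  obtain ⟨A, hA, hJ⟩ := PJ_all hk hp (by omega) (by omega) ε hε hε1
  have hp1' : (1 : ℝ) ≤ p := by exact_mod_cast hp.pos
  have hl := lam_ge k hk ε hε.le
  have hpl : 1 ≤ (p : ℝ) ^ lam k ε := Real.one_le_rpow hp1' (by linarith)
  refine ⟨A * (p : ℝ) ^ lam k ε, one_le_mul_of_one_le_of_one_le hA hpl, fun N hN => ?_⟩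
  set m := Nat.log p N + 1 with hm
  have h1 : N ≤ p ^ m := (Nat.lt_pow_succ_log_self hp.one_lt N).le
  have h2 : p ^ Nat.log p N ≤ N := Nat.pow_log_le_self p (by omega)
  have h3 : (Jc (k * (k + 1)) k (Finset.Ico 0 (N : ℤ)) : ℝ) ≤ Jn k p m := by
    have : Jc (k * (k + 1)) k (Finset.Ico 0 (N : ℤ)) ≤ Jn k p m :=
      Jc_mono (Finset.Ico_subset_Ico_right (by exact_mod_cast h1))
    exact_mod_cast this
  refine h3.trans ((hJ m).trans ?_)
  rw [mul_assoc, Real.rpow_mul (by positivity), ← Real.mul_rpow (by positivity) (by positivity)]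
  gcongr
  rw [Real.rpow_natCast, hm, pow_succ, mul_comm]
  gcongr
  exact_mod_cast h2

end VMV
end

noncomputable section
open Finset
namespace VMV

/-- distance to the nearest integer -/
def nn (x : ℝ) : ℝ := |x - round x|

theorem nn_nonneg (x : ℝ) : 0 ≤ nn x := abs_nonneg _
theorem nn_le (x : ℝ) (a : ℤ) : nn x ≤ |x - a| := round_le x a
theorem nn_half (x : ℝ) : nn x ≤ 1 / 2 := abs_sub_round x
theorem nn_nat_mul (k : ℕ) (x : ℝ) : nn (k * x) ≤ k * nn x := by
  refine (nn_le _ (k * round x)).trans (le_of_eq ?_)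
  unfold nn
  push_cast
  rw [← mul_sub, abs_mul, Nat.abs_cast]

theorem card_int_le (s : Finset ℤ) (x ρ : ℝ) (hρ : 0 ≤ ρ) (h : ∀ z ∈ s, |(z : ℝ) - x| ≤ ρ) :
    (s.card : ℝ) ≤ 2 * ρ + 1 := by
  have hs : s ⊆ Finset.Icc ⌈x - ρ⌉ ⌊x + ρ⌋ := by
    intro z hz
    have := abs_le.1 (h z hz)
    rw [mem_Icc]
    exact ⟨Int.ceil_le.2 (by linarith), Int.le_floor.2 (by linarith)⟩
  have h1 := card_le_card hs
  rw [Int.card_Icc] at h1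
  have h2 : (s.card : ℝ) ≤ ((⌊x + ρ⌋ + 1 - ⌈x - ρ⌉).toNat : ℝ) := by exact_mod_cast h1
  refine h2.trans ?_
  rcases le_total 0 (⌊x + ρ⌋ + 1 - ⌈x - ρ⌉) with h3 | h3
  · have : ((⌊x + ρ⌋ + 1 - ⌈x - ρ⌉).toNat : ℝ) = ((⌊x + ρ⌋ + 1 - ⌈x - ρ⌉ : ℤ) : ℝ) := by
      exact_mod_cast congrArg (Int.cast (R := ℝ)) (Int.toNat_of_nonneg h3)
    rw [this]
    push_cast
    have := Int.floor_le (x + ρ)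
    have := Int.le_ceil (x - ρ)
    linarith
  · rw [Int.toNat_of_nonpos h3]; simp; linarith

theorem count_lin (c η ε : ℝ) (hη : η ≠ 0) (hε : 0 ≤ ε) (hε2 : ε ≤ 1 / 2) (M : ℕ) (s : Finset ℕ)
    (hs : ∀ m ∈ s, m < M ∧ nn (c + m * η) ≤ ε) :
    (s.card : ℝ) ≤ (M * |η| + 2) * (2 * ε / |η| + 1) := by
  have hη0 : 0 < |η| := abs_pos.2 hη
  set t := s.image (fun m : ℕ => round (c + m * η)) with ht
  have h1 : (t.card : ℝ) ≤ M * |η| + 2 := by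
    have := card_int_le t (c + M / 2 * η) (ε + M / 2 * |η|) (by positivity) ?_
    · linarith
    · intro z hz
      rw [ht, mem_image] at hz
      obtain ⟨m, hm, rfl⟩ := hz
      obtain ⟨hm1, hm2⟩ := hs m hm
      have hm1' : (m : ℝ) ≤ M := by exact_mod_cast hm1.le
      have e : (round (c + m * η) : ℝ) - (c + M / 2 * η) =
        -((c + m * η) - round (c + m * η)) + (m - M / 2) * η := by ring
      rw [e]
      refine (abs_add_le _ _).trans ?_
      rw [abs_neg, abs_mul]
      unfold nn at hm2
      gcongr
      rw [abs_le]; constructor <;> linarith [(Nat.cast_nonneg m : (0 : ℝ) ≤ m)]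
  have h2 : ∀ z ∈ t, ((s.filter fun m : ℕ => round (c + m * η) = z).card : ℝ) ≤ 2 * ε / |η| + 1 := by
    intro z _
    have h3 := card_int_le ((s.filter fun m : ℕ => round (c + m * η) = z).image (fun m : ℕ => (m : ℤ)))
      ((z - c) / η) (ε / |η|) (by positivity) ?_
    · rw [card_image_of_injective _ Nat.cast_injective] at h3
      refine h3.trans (le_of_eq (by ring))
    · intro y hy
      rw [mem_image] at hy
      obtain ⟨m, hm, rfl⟩ := hy
      rw [mem_filter] at hm
      have := (hs m hm.1).2
      unfold nn at this
      rw [hm.2] at this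
      rw [le_div_iff₀ hη0, ← abs_mul]
      refine le_trans (le_of_eq ?_) this
      congr 1
      push_cast
      field_simp
      ring
  have h4 : s.card = ∑ z ∈ t, (s.filter fun m : ℕ => round (c + m * η) = z).card :=
    card_eq_sum_card_image _ _
  rw [h4]
  push_cast
  refine (sum_le_card_nsmul _ _ _ h2).trans ?_
  rw [nsmul_eq_mul]
  gcongr

theorem recur (γ ε δ : ℝ) (N Q : ℕ) (hδ : 0 < δ) (hδ1 : δ ≤ 1) (hε : 0 ≤ ε) (hε1 : ε ≤ δ / 16)
    (hQ : 8 ≤ Q * δ) (hN : 8 * Q ≤ N * δ) (H : Finset ℕ) (hH : ∀ h ∈ H, h < N ∧ nn (h * γ) ≤ ε)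
    (hc : δ * N ≤ H.card) : ∃ k : ℕ, 1 ≤ k ∧ k ≤ Q ∧ nn (k * γ) ≤ 16 * k * ε / (δ * N) := by
  have hQ0 : 0 < Q := by
    rcases Nat.eq_zero_or_pos Q with h | h
    · subst h; norm_num at hQ
    · exact h
  have hQ0' : (0 : ℝ) < Q := by exact_mod_cast hQ0
  have hN0 : (0 : ℝ) < N := by
    have : 0 < (N : ℝ) * δ := by linarith
    exact pos_of_mul_pos_left this hδ.le
  obtain ⟨k, hk0, hkQ, hk⟩ := Real.exists_nat_abs_mul_sub_round_le γ hQ0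
  refine ⟨k, hk0, hkQ, ?_⟩
  set η := k * γ - round (k * γ) with hη
  change |η| ≤ _
  have hk0' : (0 : ℝ) < k := by exact_mod_cast hk0
  have hkQ' : (k : ℝ) ≤ Q := by exact_mod_cast hkQ
  rcases eq_or_ne η 0 with h0 | h0
  · rw [h0, abs_zero]; positivity
  have hη0 : 0 < |η| := abs_pos.2 h0
  set M := N / k + 1 with hM
  have hkM : (k : ℝ) * M ≤ 2 * N := by
    have h1 : k * M ≤ N + k := by
      rw [hM, mul_add]; have := Nat.mul_div_le N k; omega
    have h2 : (k : ℝ) * M ≤ N + k := by exact_mod_cast h1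
    nlinarith
  have hfib : ∀ r ∈ range k, ((H.filter fun h => h % k = r).card : ℝ) ≤
      (M * |η| + 2) * (2 * ε / |η| + 1) := by
    intro r _
    have hinj : Set.InjOn (fun h => h / k) (H.filter fun h => h % k = r : Finset ℕ) := by
      intro a ha b hb hab
      simp only [coe_filter, Set.mem_ofPred_eq] at ha hb
      dsimp only at hab
      rw [← Nat.div_add_mod a k, ← Nat.div_add_mod b k, hab, ha.2, hb.2]
    rw [← card_image_of_injOn hinj]
    apply count_lin (r * γ) η ε h0 hε (by linarith) M
    intro m hm
    rw [mem_image] at hm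
    obtain ⟨h, hh, rfl⟩ := hm
    rw [mem_filter] at hh
    obtain ⟨h1, h2⟩ := hH h hh.1
    refine ⟨?_, ?_⟩
    · rw [hM]
      exact Nat.lt_succ_of_le (Nat.div_le_div_right h1.le)
    · refine le_trans ?_ h2
      refine (nn_le _ (round (h * γ) - (h / k : ℕ) * round (k * γ))).trans (le_of_eq ?_)
      unfold nn
      congr 1
      have e : (h : ℝ) = k * (h / k : ℕ) + r := by
        have := Nat.div_add_mod h k
        rw [hh.2] at this
        exact_mod_cast this.symm
      rw [hη, Int.cast_sub, Int.cast_mul, Int.cast_natCast]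
      have e2 : (h : ℝ) * γ = (k * (h / k : ℕ) + r) * γ := by rw [← e]
      linear_combination -e2
  have hsum : (H.card : ℝ) ≤ k * ((M * |η| + 2) * (2 * ε / |η| + 1)) := by
    have h4 : H.card = ∑ r ∈ range k, (H.filter fun h => h % k = r).card :=
      card_eq_sum_card_fiberwise (fun h _ => by simpa using Nat.mod_lt _ hk0)
    rw [h4]
    push_cast
    refine (sum_le_card_nsmul _ _ _ hfib).trans ?_
    rw [nsmul_eq_mul, card_range]
  have hη1 : |η| ≤ δ / 8 := by
    refine hk.trans ?_
    rw [div_le_div_iff₀ (by positivity) (by norm_num)]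
    linarith
  have e1 : k * ((M * |η| + 2) * (2 * ε / |η| + 1)) = k * M * (2 * ε + |η|) + 4 * k * ε / |η| + 2 * k := by
    field_simp
    ring
  have e2 : k * M * (2 * ε + |η|) ≤ 2 * N * (2 * (δ / 16) + δ / 8) := by gcongr
  have e3 : δ * N / 4 ≤ 4 * k * ε / |η| := by
    rw [e1] at hsum
    linarith
  rw [div_le_div_iff₀ (by norm_num) hη0] at e3
  rw [le_div_iff₀ (by positivity)]
  linarith

end VMV
end

noncomputable section
open Finset
namespace VMV

/-- `f` is a polynomial of degree at most `i+1` with top coefficient `α` (difference form). -/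
def IsT : ℕ → ℝ → (ℕ → ℝ) → Prop
  | 0, α, f => ∃ c, ∀ n, f n = α * n + c
  | i + 1, α, f => ∀ h : ℕ, IsT i ((i + 2) * h * α) (fun n => f (n + h) - f n)

theorem IsT_comp (i : ℕ) : ∀ (α : ℝ) (f : ℕ → ℝ) (n₀ q : ℕ), IsT i α f →
    IsT i ((q : ℝ) ^ (i + 1) * α) (fun m => f (n₀ + q * m)) := by
  induction i with
  | zero =>
    rintro α f n₀ q ⟨c, hc⟩
    refine ⟨α * n₀ + c, fun n => ?_⟩
    dsimp only; rw [hc]; push_cast; ring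
  | succ i ih =>
    intro α f n₀ q hf h
    have := ih _ _ n₀ q (hf (q * h))
    convert this using 1
    · push_cast; ring
    · funext n
      congr 2
      ring_nf

def Dh (a : ℕ → ℂ) (h M : ℕ) : ℂ := ∑ n ∈ range M, a (n + h) * (starRingEnd ℂ) (a n)

theorem vdc_id (a : ℕ → ℂ) (ha : ∀ n, ‖a n‖ = 1) (N : ℕ) :
    ‖∑ n ∈ range N, a n‖ ^ 2 = N + 2 * (∑ h ∈ range N, Dh a (h + 1) (N - 1 - h)).re := by
  induction N with
  | zero => simp
  | succ N ih =>
    have h1 : ∑ h ∈ range (N + 1), Dh a (h + 1) (N + 1 - 1 - h) =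
        ∑ h ∈ range N, Dh a (h + 1) (N - 1 - h) + a N * (starRingEnd ℂ) (∑ n ∈ range N, a n) := by
      rw [sum_range_succ, map_sum, ← sum_range_reflect (fun n => (starRingEnd ℂ) (a n)) N, mul_sum,
        ← sum_add_distrib]
      have : Dh a (N + 1) (N + 1 - 1 - N) = 0 := by
        rw [show N + 1 - 1 - N = 0 by omega]; simp [Dh]
      rw [this, add_zero]
      refine sum_congr rfl fun h hh => ?_
      rw [mem_range] at hh
      rw [show N + 1 - 1 - h = (N - 1 - h) + 1 by omega]
      unfold Dh
      rw [sum_range_succ, show N - 1 - h + (h + 1) = N by omega]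
    rw [h1, sum_range_succ]
    have h2 : ‖∑ n ∈ range N, a n + a N‖ ^ 2 = ‖∑ n ∈ range N, a n‖ ^ 2 + 1 +
        2 * (a N * (starRingEnd ℂ) (∑ n ∈ range N, a n)).re := by
      have e := ha N
      rw [← Complex.normSq_eq_norm_sq, ← Complex.normSq_eq_norm_sq, Complex.normSq_add]
      rw [Complex.normSq_eq_norm_sq (a N), e]
      simp only [Complex.mul_re, Complex.conj_re, Complex.conj_im]
      ring
    rw [h2, ih, Complex.add_re]
    push_cast; ring

theorem vdc (a : ℕ → ℂ) (ha : ∀ n, ‖a n‖ = 1) (N : ℕ) :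
    ‖∑ n ∈ range N, a n‖ ^ 2 ≤ N + 2 * ∑ h ∈ range N, ‖Dh a (h + 1) (N - 1 - h)‖ := by
  rw [vdc_id a ha]
  gcongr
  exact (Complex.re_le_norm _).trans (norm_sum_le _ _)

theorem Dh_le (a : ℕ → ℂ) (ha : ∀ n, ‖a n‖ = 1) (h M : ℕ) : ‖Dh a h M‖ ≤ M := by
  unfold Dh
  refine (norm_sum_le _ _).trans ?_
  simp [ha]

theorem ee_sub_one_ge (x : ℝ) : 4 * nn x ≤ ‖ee x - 1‖ := by
  set η := x - round x with hη
  have h1 : ee x = ee η := by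
    have := ee_add_int η (round x)
    rw [← this, hη]; congr 1; ring
  have h2 : ‖ee η - 1‖ = 2 * |Real.sin (Real.pi * η)| := by
    unfold ee
    have : (2 * Real.pi * η * Complex.I : ℂ) = Complex.I * ((2 * Real.pi * η : ℝ) : ℂ) := by
      push_cast; ring
    rw [this, Complex.norm_exp_I_mul_ofReal_sub_one, norm_mul, Real.norm_eq_abs, Real.norm_eq_abs]
    rw [show 2 * Real.pi * η / 2 = Real.pi * η by ring]; norm_num
  rw [h1, h2]
  have h3 : nn x = |η| := rfl
  have h4 : |η| ≤ 1 / 2 := nn_half x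
  have h5 : |Real.sin (Real.pi * η)| = Real.sin (Real.pi * |η|) := by
    rcases le_total 0 η with h | h
    · rw [abs_of_nonneg h] at *
      exact abs_of_nonneg (Real.sin_nonneg_of_nonneg_of_le_pi (by positivity)
        (by nlinarith [Real.pi_pos]))
    · rw [abs_of_nonpos h] at *
      rw [mul_neg, Real.sin_neg]
      refine abs_of_nonpos (Real.sin_nonpos_of_nonpos_of_neg_pi_le ?_ ?_)
      · nlinarith [Real.pi_pos]
      · nlinarith [Real.pi_pos]
  rw [h5, h3]
  have := Real.mul_le_sin (x := Real.pi * |η|) (by positivity) (by nlinarith [Real.pi_pos])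
  have e : 2 / Real.pi * (Real.pi * |η|) = 2 * |η| := by field_simp
  linarith

theorem top_zero (f : ℕ → ℝ) (α : ℝ) (hf : IsT 0 α f) (N : ℕ) (hN : 1 ≤ N) (T : ℝ) (hT : 2 ≤ T)
    (h : N / T ≤ ‖∑ n ∈ range N, ee (f n)‖) : nn α ≤ T / N := by
  obtain ⟨c, hc⟩ := hf
  have hN' : (0 : ℝ) < N := by exact_mod_cast hN
  have h1 : (ee α - 1) * ∑ n ∈ range N, ee (f n) = ee (f N) - ee (f 0) := by
    rw [← sum_range_sub (fun n => ee (f n)), mul_sum]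
    refine sum_congr rfl fun n _ => ?_
    rw [sub_mul, one_mul, ← ee_add, hc, hc]
    congr 2; push_cast; ring
  have h2 : ‖ee α - 1‖ * ‖∑ n ∈ range N, ee (f n)‖ ≤ 2 := by
    rw [← norm_mul, h1]
    refine (norm_sub_le _ _).trans ?_
    rw [norm_ee, norm_ee]; norm_num
  have h3 : 4 * nn α * (N / T) ≤ 2 := by
    refine le_trans ?_ h2
    have := ee_sub_one_ge α
    gcongr
  rw [le_div_iff₀ hN']
  have : 4 * nn α * (N / T) = 4 * nn α * N / T := by ring
  rw [this, div_le_iff₀ (by linarith)] at h3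
  nlinarith

theorem pigeon {ι : Type*} (s : Finset ι) (g : ι → ℕ) (B : ℕ) (hg : ∀ i ∈ s, g i ∈ Finset.Icc 1 B) (hs : s.Nonempty) :
    ∃ q ∈ Finset.Icc 1 B, s.card ≤ B * (s.filter fun i => g i = q).card := by
  obtain ⟨i, hi⟩ := hs
  have h1 : (Finset.Icc 1 B).Nonempty := ⟨_, hg i hi⟩
  obtain ⟨q, hq, h⟩ := exists_max_image (Finset.Icc 1 B) (fun q => (s.filter fun i => g i = q).card) h1
  refine ⟨q, hq, ?_⟩
  rw [card_eq_sum_card_fiberwise (f := g) (t := Finset.Icc 1 B) (fun i hi => hg i hi)]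
  refine (sum_le_card_nsmul _ _ _ h).trans ?_
  simp

end VMV
end

noncomputable section
open Finset
namespace VMV

theorem nat_le_pow {T : ℝ} (hT : 2 ≤ T) (c : ℕ) : (c : ℝ) ≤ T ^ c := by
  have h1 : (c : ℝ) ≤ 2 ^ c := by exact_mod_cast (Nat.lt_two_pow_self (n := c)).le
  exact h1.trans (by gcongr)

theorem pw {T : ℝ} (hT : 2 ≤ T) {a b : ℕ} (h : a ≤ b) : T ^ a ≤ T ^ b :=
  pow_le_pow_right₀ (by linarith) h

theorem top (i : ℕ) : ∃ C : ℕ, ∀ (f : ℕ → ℝ) (α : ℝ), IsT i α f → ∀ N : ℕ, 1 ≤ N → ∀ T : ℝ, 2 ≤ T →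
    N / T ≤ ‖∑ n ∈ range N, ee (f n)‖ →
    ∃ q : ℕ, 1 ≤ q ∧ (q : ℝ) ≤ T ^ C ∧ nn (q * α) ≤ T ^ C / (N : ℝ) ^ (i + 1) := by
  induction i with
  | zero =>
    refine ⟨1, fun f α hf N hN T hT h => ⟨1, le_rfl, ?_, ?_⟩⟩
    · push_cast; linarith
    · simpa using top_zero f α hf N hN T hT h
  | succ i ih =>
    obtain ⟨C0, ih⟩ := ih
    set E := 6 + 5 * (C0 + (i + 1)) with hE
    set K := 2 * E + 8 with hK
    refine ⟨K * (i + 2) + 3 * E + 8 + (i + 2), fun f α hf N hN T hT h => ?_⟩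
    have hN' : (0 : ℝ) < N := by exact_mod_cast hN
    have hN1 : (1 : ℝ) ≤ N := by exact_mod_cast hN
    have hT0 : 0 < T := by linarith
    by_cases hNK : (N : ℝ) < T ^ K
    · refine ⟨1, le_rfl, ?_, ?_⟩
      · push_cast; exact one_le_pow₀ (by linarith)
      · refine (nn_half _).trans ?_
        rw [le_div_iff₀ (by positivity)]
        have h1 : (N : ℝ) ^ (i + 1 + 1) ≤ (T ^ K) ^ (i + 2) := by gcongr
        rw [← pow_mul] at h1
        have h2 := h1.trans (pw hT (by omega : K * (i + 2) ≤ K * (i + 2) + 3 * E + 8 + (i + 2)))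
        have : 0 < (N : ℝ) ^ (i + 1 + 1) := by positivity
        linarith
    push Not at hNK
    have hNpow : ∀ a, a ≤ K → T ^ a ≤ N := fun a ha => (pw hT ha).trans hNK
    have e8 : (8 : ℝ) ≤ T ^ 3 := by
      calc (8 : ℝ) = 2 ^ 3 := by norm_num
        _ ≤ T ^ 3 := by gcongr
    have e16 : (16 : ℝ) ≤ T ^ 4 := by
      calc (16 : ℝ) = 2 ^ 4 := by norm_num
        _ ≤ T ^ 4 := by gcongr
    set T1 := 8 * T ^ 2 with hT1
    have hT1' : T1 ≤ T ^ 5 := by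
      calc T1 ≤ T ^ 3 * T ^ 2 := by rw [hT1]; gcongr
        _ = T ^ 5 := by ring
    have hT12 : 2 ≤ T1 := by nlinarith
    have hT10 : 0 < T1 := by linarith
    set a : ℕ → ℂ := fun n => ee (f n) with ha
    have ha1 : ∀ n, ‖a n‖ = 1 := fun n => norm_ee _
    have hv := vdc a ha1 N
    have hS2 : ((N : ℝ) / T) ^ 2 ≤ ‖∑ n ∈ range N, a n‖ ^ 2 := by gcongr
    have hN2T : 2 * T ^ 2 ≤ N := by
      have := hNpow 3 (by omega)
      nlinarith
    set H0 := (range N).filter fun h => N / T1 ≤ ‖Dh a (h + 1) (N - 1 - h)‖ with hH0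
    have hsum : ∑ h ∈ range N, ‖Dh a (h + 1) (N - 1 - h)‖ ≤ H0.card * N + N * (N / T1) := by
      rw [← sum_filter_add_sum_filter_not (range N) (fun h => N / T1 ≤ ‖Dh a (h + 1) (N - 1 - h)‖)]
      refine add_le_add ?_ ?_
      · have := sum_le_card_nsmul H0 (fun h => ‖Dh a (h + 1) (N - 1 - h)‖) N (fun h _ => by
          refine (Dh_le a ha1 _ _).trans ?_
          exact_mod_cast (by omega : N - 1 - h ≤ N))
        rwa [nsmul_eq_mul] at this
      · refine (sum_le_card_nsmul _ _ (N / T1) (fun h hh => ?_)).trans ?_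
        · rw [mem_filter] at hh
          exact (not_le.1 hh.2).le
        · rw [nsmul_eq_mul]
          gcongr
          have := card_filter_le (range N) (fun h => ¬ N / T1 ≤ ‖Dh a (h + 1) (N - 1 - h)‖)
          rw [card_range] at this
          exact this
    have hH0card : N / T1 ≤ H0.card := by
      have h1 : (N : ℝ) ^ 2 / T ^ 2 ≤ N + 2 * (H0.card * N + N * (N / T1)) := by
        rw [← div_pow]; linarith
      have h2 : (N : ℝ) ^ 2 / T ^ 2 = 8 * (N * (N / T1)) := by
        rw [hT1]; field_simp
      have h3 : (N : ℝ) ≤ 4 * (N * (N / T1)) := by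
        have : (1 : ℝ) ≤ 4 * (N / T1) := by
          rw [hT1, ← mul_div_assoc, le_div_iff₀ (by positivity)]; linarith
        nlinarith
      have h4 : N * (N / T1) ≤ N * (H0.card : ℝ) := by linarith
      exact le_of_mul_le_mul_left h4 hN'
    have hNT1 : 0 < N / T1 := by positivity
    set B := T ^ (5 * (C0 + (i + 1))) with hB
    have hB1 : 1 ≤ B := one_le_pow₀ (by linarith)
    have hT1B : T1 ^ (C0 + (i + 1)) ≤ B := by
      rw [hB, pow_mul]
      gcongr
    have hT1C : T1 ^ C0 ≤ B := le_trans (pow_le_pow_right₀ (by linarith) (by omega)) hT1B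
    set ε := B / (N : ℝ) ^ (i + 1) with hε
    have hgood : ∀ h ∈ H0, ∃ q : ℕ, 1 ≤ q ∧ (q : ℝ) ≤ B ∧
        nn ((h + 1 : ℕ) * (q * (i + 2) * α)) ≤ ε := by
      intro h hh
      rw [hH0, mem_filter, mem_range] at hh
      obtain ⟨hhN, hh⟩ := hh
      set ℓ := N - 1 - h with hℓ
      have hℓ1 : N / T1 ≤ (ℓ : ℝ) := hh.trans (Dh_le a ha1 _ _)
      have hℓ0 : 0 < (ℓ : ℝ) := hNT1.trans_le hℓ1
      have hℓ0' : 1 ≤ ℓ := by exact_mod_cast hℓ0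
      have hℓN : (ℓ : ℝ) ≤ N := by exact_mod_cast (by omega : ℓ ≤ N)
      have e : Dh a (h + 1) ℓ = ∑ n ∈ range ℓ, ee (f (n + (h + 1)) - f n) := by
        unfold Dh
        refine sum_congr rfl fun n _ => ?_
        rw [ha, sub_eq_add_neg, ee_add, ee_neg]
      rw [e] at hh
      obtain ⟨q, hq1, hq2, hq3⟩ := ih _ _ (hf (h + 1)) ℓ hℓ0' T1 hT12
        (le_trans (by gcongr) hh)
      refine ⟨q, hq1, hq2.trans hT1C, ?_⟩
      have e2 : ((h + 1 : ℕ) : ℝ) * (q * (i + 2) * α) = q * ((i + 2) * (h + 1 : ℕ) * α) := by ring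
      rw [e2]
      refine hq3.trans ?_
      calc T1 ^ C0 / (ℓ : ℝ) ^ (i + 1) ≤ T1 ^ C0 / (N / T1) ^ (i + 1) := by gcongr
        _ = T1 ^ (C0 + (i + 1)) / (N : ℝ) ^ (i + 1) := by
          rw [div_pow, pow_add]; field_simp; try ring
        _ ≤ ε := by rw [hε]; gcongr
    choose! g hg1 hg2 hg3 using hgood
    have hH0ne : H0.Nonempty := by
      rw [← card_pos]
      have : (0 : ℝ) < H0.card := hNT1.trans_le hH0card
      exact_mod_cast this
    obtain ⟨q, hq, hqc⟩ := pigeon H0 g ⌊B⌋₊ (fun h hh => by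
      rw [mem_Icc]; exact ⟨hg1 h hh, Nat.le_floor (hg2 h hh)⟩) hH0ne
    rw [mem_Icc] at hq
    have hqB : (q : ℝ) ≤ B := (Nat.le_floor_iff (by linarith)).1 hq.2
    set H1 := H0.filter fun h => g h = q with hH1
    set H := H1.image (fun h => h + 1) with hH
    have hHc : H.card = H1.card := card_image_of_injective _ (add_left_injective 1)
    have hqc' : (H0.card : ℝ) ≤ B * H.card := by
      have : (H0.card : ℝ) ≤ ⌊B⌋₊ * H1.card := by exact_mod_cast hqc
      rw [hHc]
      refine this.trans ?_
      gcongr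
      exact Nat.floor_le (by linarith)
    set δ := 1 / T ^ E with hδ
    have hTE : 1 ≤ T ^ E := one_le_pow₀ (by linarith)
    have hE' : T ^ E = T * T ^ 5 * B := by rw [hE, hB]; ring
    have hBE : B ≤ T ^ E := by rw [hB]; exact pw hT (by omega)
    have hδN : δ * (N + 1 : ℕ) ≤ H.card := by
      have h1 : (N : ℝ) ≤ B * H.card * T1 := by
        rw [div_le_iff₀ hT10] at hH0card
        exact hH0card.trans (by gcongr)
      rw [hδ, one_div_mul_eq_div, div_le_iff₀ (by positivity)]
      push_cast
      have h2 : B * H.card * T1 ≤ B * H.card * T ^ 5 := by gcongr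
      calc (N : ℝ) + 1 ≤ T * N := by nlinarith
        _ ≤ T * (B * H.card * T ^ 5) := by gcongr; linarith
        _ = _ := by rw [hE']; ring
    set Q := ⌈8 * T ^ E⌉₊ with hQ
    have hQ1 : 8 * T ^ E ≤ Q := Nat.le_ceil _
    have hQ2 : (Q : ℝ) ≤ T ^ (E + 4) := by
      have := (Nat.ceil_lt_add_one (by positivity : 0 ≤ 8 * T ^ E)).le
      rw [← hQ] at this
      calc (Q : ℝ) ≤ 16 * T ^ E := by linarith
        _ ≤ T ^ 4 * T ^ E := by gcongr
        _ = _ := by ring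
    have hNN : (N : ℝ) ≤ N ^ (i + 1) := le_self_pow₀ hN1 (by omega)
    have side0 : ε ≤ δ / 16 := by
      rw [hε, hδ, div_div, div_le_div_iff₀ (by positivity) (by positivity), one_mul]
      calc B * (T ^ E * 16) ≤ T ^ E * (T ^ E * T ^ 4) := by gcongr
        _ = T ^ (E + E + 4) := by ring
        _ ≤ N := hNpow _ (by omega)
        _ ≤ _ := hNN
    have side1 : 8 ≤ (Q : ℝ) * δ := by
      rw [hδ, mul_one_div, le_div_iff₀ (by positivity)]; exact hQ1
    have side2 : 8 * (Q : ℝ) ≤ (N + 1 : ℕ) * δ := by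
      rw [hδ, mul_one_div, le_div_iff₀ (by positivity)]
      push_cast
      calc 8 * (Q : ℝ) * T ^ E ≤ T ^ 3 * T ^ (E + 4) * T ^ E := by gcongr
        _ = T ^ (2 * E + 7) := by ring
        _ ≤ N := hNpow _ (by omega)
        _ ≤ N + 1 := by linarith
    have side3 : ∀ h ∈ H, h < N + 1 ∧ nn (h * (q * (i + 2) * α)) ≤ ε := by
      intro h hh
      rw [hH, mem_image] at hh
      obtain ⟨h', hh', rfl⟩ := hh
      rw [hH1, mem_filter] at hh'
      refine ⟨?_, ?_⟩
      · have := hh'.1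
        rw [hH0, mem_filter, mem_range] at this
        omega
      · have := hg3 h' hh'.1
        rwa [hh'.2] at this
    obtain ⟨k, hk1, hk2, hk3⟩ := recur (q * (i + 2) * α) ε δ (N + 1) Q (by positivity)
      (by rw [hδ, div_le_one (by positivity)]; exact hTE) (by positivity) side0 side1 side2 H side3 hδN
    have hk2' : (k : ℝ) ≤ T ^ (E + 4) := le_trans (by exact_mod_cast hk2) hQ2
    have hi2 : ((i + 2 : ℕ) : ℝ) ≤ T ^ (i + 2) := nat_le_pow hT (i + 2)
    refine ⟨k * q * (i + 2), ?_, ?_, ?_⟩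
    · have := hq.1; exact Nat.mul_pos (Nat.mul_pos hk1 this) (by omega)
    · calc ((k * q * (i + 2) : ℕ) : ℝ) = k * q * ((i + 2 : ℕ) : ℝ) := by push_cast; ring
        _ ≤ T ^ (E + 4) * T ^ E * T ^ (i + 2) := by
          gcongr
          exact hqB.trans hBE
        _ = T ^ (2 * E + 4 + (i + 2)) := by ring
        _ ≤ _ := pw hT (by omega)
    · have e : ((k * q * (i + 2) : ℕ) : ℝ) * α = k * (q * (i + 2) * α) := by push_cast; ring
      rw [e]
      refine hk3.trans ?_
      have h1 : 16 * k * ε / (δ * (N + 1 : ℕ)) = 16 * k * B * T ^ E / (N ^ (i + 1) * (N + 1)) := by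
        rw [hδ, hε]; push_cast; field_simp
      rw [h1]
      have h2 : 16 * k * B * T ^ E ≤ T ^ (K * (i + 2) + 3 * E + 8 + (i + 2)) := by
        calc 16 * k * B * T ^ E ≤ T ^ 4 * T ^ (E + 4) * T ^ E * T ^ E := by gcongr
          _ = T ^ (3 * E + 8) := by ring
          _ ≤ _ := pw hT (by omega)
      rw [pow_succ (N : ℝ) (i + 1)]
      gcongr
      linarith

end VMV
end

noncomputable section
open Finset
namespace VMV

theorem IsT_poly (i : ℕ) : ∀ P : Polynomial ℝ, P.natDegree ≤ i + 1 →
    IsT i (P.coeff (i + 1)) (fun n => P.eval (n : ℝ)) := by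
  induction i with
  | zero =>
    intro P hP
    refine ⟨P.coeff 0, fun n => ?_⟩
    dsimp only
    rw [Polynomial.eval_eq_sum_range' (n := 2) (by omega)]
    simp [sum_range_succ]; ring
  | succ i ih =>
    intro P hP h
    set Q := Polynomial.taylor (h : ℝ) P - P with hQ
    have hder : ∀ n, i + 1 ≤ n → (Polynomial.taylor (h : ℝ) P).coeff n =
        P.coeff n + (n + 1) * P.coeff (n + 1) * h := by
      intro n hn
      rw [Polynomial.taylor_coeff, Polynomial.eval_eq_sum_range' (n := 2)]
      · simp [sum_range_succ, Polynomial.hasseDeriv_coeff]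
        left
        rw [add_comm 1 n, Nat.choose_succ_self_right]; push_cast; ring
      · refine Nat.lt_succ_of_le ((Polynomial.natDegree_hasseDeriv_le _ _).trans ?_)
        omega
    have hz : ∀ n, i + 2 < n → P.coeff n = 0 := fun n hn =>
      Polynomial.coeff_eq_zero_of_natDegree_lt (by omega)
    have hdeg : Q.natDegree ≤ i + 1 := by
      rw [Polynomial.natDegree_le_iff_coeff_eq_zero]
      intro n hn
      rw [hQ, Polynomial.coeff_sub, hder n (by omega), hz (n + 1) (by omega)]
      ring
    have h1 := ih Q hdeg
    convert h1 using 1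
    · rw [hQ, Polynomial.coeff_sub, hder _ le_rfl]
      push_cast; ring
    · funext n
      rw [hQ, Polynomial.eval_sub, Polynomial.taylor_eval]
      push_cast
      ring_nf

/-- polynomial with coefficients `c` -/
def pe (c : ℕ → ℝ) (d : ℕ) (x : ℝ) : ℝ := ∑ j ∈ range (d + 1), c j * x ^ j

theorem IsT_pe (c : ℕ → ℝ) (i : ℕ) : IsT i (c (i + 1)) (fun n => pe c (i + 1) (n : ℝ)) := by
  set P : Polynomial ℝ := ∑ j ∈ range (i + 1 + 1), Polynomial.C (c j) * Polynomial.X ^ j with hP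
  have h1 : P.natDegree ≤ i + 1 := by
    apply Polynomial.natDegree_sum_le_of_forall_le
    intro j hj
    rw [mem_range] at hj
    exact (Polynomial.natDegree_C_mul_X_pow_le _ _).trans (by omega)
  have h2 : P.coeff (i + 1) = c (i + 1) := by
    rw [hP, Polynomial.finsetSum_coeff]
    simp [Polynomial.coeff_X_pow]
  have h3 := IsT_poly i P h1
  rw [h2] at h3
  convert h3 using 1
  funext n
  rw [hP, Polynomial.eval_finsetSum]
  simp [pe]

theorem pow_shift (n₀ q m B : ℕ) (hB : n₀ + q * m ≤ B) (j : ℕ) :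
    ∃ Z : ℕ, (n₀ + q * m) ^ (j + 1) = n₀ ^ (j + 1) + q * Z ∧ Z ≤ m * (j + 1) * B ^ j := by
  induction j with
  | zero => exact ⟨m, by ring, by simp⟩
  | succ j ih =>
    obtain ⟨Z, hZ, hZ'⟩ := ih
    refine ⟨m * n₀ ^ (j + 1) + (n₀ + q * m) * Z, ?_, ?_⟩
    · rw [pow_succ, hZ]; ring
    · calc m * n₀ ^ (j + 1) + (n₀ + q * m) * Z ≤ m * B ^ (j + 1) + B * (m * (j + 1) * B ^ j) := by
            gcongr; omega
        _ = _ := by ring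

theorem shift_sum (u : ℕ → ℂ) (hu : ∀ n, ‖u n‖ = 1) (N s : ℕ) :
    ‖∑ n ∈ range N, u n - ∑ n ∈ range N, u (n + s)‖ ≤ 2 * s := by
  induction s with
  | zero => simp
  | succ s ih =>
    have h1 : ∑ n ∈ range N, u (n + s) - ∑ n ∈ range N, u (n + (s + 1)) = u s - u (N + s) := by
      have h0 := sum_range_sub' (fun n => u (n + s)) N
      rw [zero_add] at h0
      rw [← sum_sub_distrib, ← h0]
      refine sum_congr rfl fun n _ => ?_
      rw [add_right_comm, add_assoc]
    have h2 : ‖u s - u (N + s)‖ ≤ 2 := by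
      refine (norm_sub_le _ _).trans ?_
      rw [hu, hu]; norm_num
    have h3 : ∑ n ∈ range N, u n - ∑ n ∈ range N, u (n + (s + 1)) =
      (∑ n ∈ range N, u n - ∑ n ∈ range N, u (n + s)) + (u s - u (N + s)) := by rw [← h1]; ring
    rw [h3]
    refine (norm_add_le _ _).trans ?_
    push_cast; linarith

theorem avg_shift (u : ℕ → ℂ) (hu : ∀ n, ‖u n‖ = 1) (N q ℓ : ℕ) (hN : 1 ≤ N) (T : ℝ) (hT : 0 < T)
    (h : N / T ≤ ‖∑ n ∈ range N, u n‖) (hℓ : 4 * T * (q * ℓ) ≤ N) :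
    ∃ n₀ < N, ℓ / (2 * T) ≤ ‖∑ m ∈ range ℓ, u (n₀ + q * m)‖ := by
  by_contra hcon
  push Not at hcon
  have hN' : (0 : ℝ) < N := by exact_mod_cast hN
  have h1 : ‖ℓ * ∑ n ∈ range N, u n - ∑ n ∈ range N, ∑ m ∈ range ℓ, u (n + q * m)‖ ≤ ℓ * (2 * (q * ℓ)) := by
    have e : (ℓ : ℂ) * ∑ n ∈ range N, u n - ∑ n ∈ range N, ∑ m ∈ range ℓ, u (n + q * m) =
        ∑ m ∈ range ℓ, (∑ n ∈ range N, u n - ∑ n ∈ range N, u (n + q * m)) := by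
      rw [sum_sub_distrib, sum_comm]; simp
    rw [e]
    refine (norm_sum_le _ _).trans ?_
    have e2 : (ℓ : ℝ) * (2 * (q * ℓ)) = (range ℓ).card • (2 * ((q : ℝ) * ℓ)) := by
      rw [card_range, nsmul_eq_mul]
    rw [e2]
    refine sum_le_card_nsmul _ _ _ fun m hm => ?_
    rw [mem_range] at hm
    refine (shift_sum u hu N (q * m)).trans ?_
    push_cast
    gcongr
  have h2 : ‖∑ n ∈ range N, ∑ m ∈ range ℓ, u (n + q * m)‖ < N * (ℓ / (2 * T)) := by
    refine (norm_sum_le _ _).trans_lt ?_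
    have := sum_lt_sum_of_nonempty (s := range N) ⟨0, mem_range.2 hN⟩
      (fun n hn => hcon n (mem_range.1 hn))
    simpa using this
  have h3 : ℓ * (N / T) ≤ ‖ℓ * ∑ n ∈ range N, u n‖ := by
    rw [norm_mul, Complex.norm_natCast]; gcongr
  have h4 := norm_sub_norm_le (ℓ * ∑ n ∈ range N, u n) (∑ n ∈ range N, ∑ m ∈ range ℓ, u (n + q * m))
  have h5 : ℓ * (N / T) < N * (ℓ / (2 * T)) + ℓ * (2 * (q * ℓ)) := by linarith
  have h6 : ℓ * (2 * (q * ℓ)) ≤ N * (ℓ / (2 * T)) := by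
    rw [← mul_div_assoc, le_div_iff₀ (by positivity)]
    have : (0 : ℝ) ≤ ℓ := by positivity
    nlinarith
  have h7 : ℓ * (N / T) = N * (ℓ / (2 * T)) + N * (ℓ / (2 * T)) := by field_simp; ring
  linarith

end VMV
end

noncomputable section
open Finset
namespace VMV

theorem pe_split (c : ℕ → ℝ) (e g n₀ q m N ℓ : ℕ) (θ : ℕ → ℝ) (a : ℕ → ℤ) (B : ℝ)
    (hB : n₀ + q * m ≤ 2 * N) (hm : m ≤ ℓ) (hN : 1 ≤ N)
    (hθ : ∀ j, e < j → j ≤ e + g → q * c j = a j + θ j ∧ |θ j| ≤ B / (N : ℝ) ^ j) :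
    ∃ (z : ℤ) (er : ℝ), pe c (e + g) (n₀ + q * m : ℕ) = pe c e (n₀ + q * m : ℕ) +
      (∑ j ∈ range g, c (e + 1 + j) * (n₀ : ℝ) ^ (e + 1 + j)) + z + er ∧
      |er| ≤ g * (B * (e + g) * 2 ^ (e + g) * ℓ / N) := by
  induction g with
  | zero => exact ⟨0, 0, by simp [pe], by simp⟩
  | succ g ih =>
    obtain ⟨z, er, h1, h2⟩ := ih (fun j h1 h2 => hθ j h1 (by omega))
    obtain ⟨Z, hZ, hZ'⟩ := pow_shift n₀ q m _ hB (e + g)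
    obtain ⟨h3, h4⟩ := hθ (e + g + 1) (by omega) (by omega)
    have hN' : (0 : ℝ) < N := by exact_mod_cast hN
    have hB0 : 0 ≤ B := by
      have := (abs_nonneg _).trans h4
      by_contra hb
      push Not at hb
      have : B / (N : ℝ) ^ (e + g + 1) < 0 := div_neg_of_neg_of_pos hb (by positivity)
      linarith
    refine ⟨z + a (e + g + 1) * Z, er + θ (e + g + 1) * Z, ?_, ?_⟩
    · have h5 : pe c (e + (g + 1)) (n₀ + q * m : ℕ) = pe c (e + g) (n₀ + q * m : ℕ) +
          c (e + g + 1) * ((n₀ + q * m : ℕ) : ℝ) ^ (e + g + 1) := by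
        unfold pe; rw [← add_assoc, sum_range_succ]
      have h6 : ((n₀ + q * m : ℕ) : ℝ) ^ (e + g + 1) = (n₀ : ℝ) ^ (e + g + 1) + q * Z := by
        exact_mod_cast hZ
      rw [h5, h1, h6, sum_range_succ, show e + 1 + g = e + g + 1 by ring]
      push_cast
      linear_combination (Z : ℝ) * h3
    · have h7 : (Z : ℝ) ≤ ℓ * (e + g + 1) * (2 * N) ^ (e + g) := by
        have : Z ≤ ℓ * (e + g + 1) * (2 * N) ^ (e + g) := hZ'.trans (by gcongr)
        exact_mod_cast this
      have h8 : |θ (e + g + 1) * Z| ≤ B * (e + (g + 1)) * 2 ^ (e + (g + 1)) * ℓ / N := by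
        rw [abs_mul, Nat.abs_cast]
        calc |θ (e + g + 1)| * (Z : ℝ) ≤ B / (N : ℝ) ^ (e + g + 1) * (ℓ * (e + g + 1) * (2 * N) ^ (e + g)) := by
              gcongr
          _ = B * (e + (g + 1)) * 2 ^ (e + g) * ℓ / N := by
              rw [mul_pow, pow_succ]; field_simp; ring
          _ ≤ _ := by
              gcongr
              · norm_num
              · omega
      have h9 : |er| ≤ g * (B * (e + (g + 1)) * 2 ^ (e + (g + 1)) * ℓ / N) := by
        refine h2.trans ?_
        gcongr
        · linarith
        · norm_num
        · omega
      refine (abs_add_le _ _).trans ?_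
      push_cast
      linarith

theorem weyl_step (e g C0 : ℕ) (hC0 : ∀ c : ℕ → ℝ, ∀ N : ℕ, 1 ≤ N → ∀ T : ℝ, 2 ≤ T →
      N / T ≤ ‖∑ n ∈ range N, ee (pe c (e + 1 + g) n)‖ →
      ∃ q : ℕ, 1 ≤ q ∧ (q : ℝ) ≤ T ^ C0 ∧ ∀ j, e + 1 < j → j ≤ e + 1 + g → nn (q * c j) ≤ T ^ C0 / (N : ℝ) ^ j) :
    ∃ C : ℕ, ∀ c : ℕ → ℝ, ∀ N : ℕ, 1 ≤ N → ∀ T : ℝ, 2 ≤ T →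
      N / T ≤ ‖∑ n ∈ range N, ee (pe c (e + 1 + g) n)‖ →
      ∃ q : ℕ, 1 ≤ q ∧ (q : ℝ) ≤ T ^ C ∧ ∀ j, e < j → j ≤ e + 1 + g → nn (q * c j) ≤ T ^ C / (N : ℝ) ^ j := by
  obtain ⟨C1, hC1⟩ := top e
  obtain ⟨d, hd⟩ : ∃ d, d = e + 1 + g := ⟨_, rfl⟩
  rw [← hd] at hC0 ⊢
  set E := C0 + 6 + 3 * d with hE
  refine ⟨E * d + 3 * C1 + C0 * (d + 1) + (E + 1) * d, fun c N hN T hT h => ?_⟩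
  set C := E * d + 3 * C1 + C0 * (d + 1) + (E + 1) * d with hC
  have hT0 : 0 < T := by linarith
  have hT1 : 1 ≤ T := by linarith
  have hN' : (0 : ℝ) < N := by exact_mod_cast hN
  rcases lt_or_ge (N : ℝ) (T ^ E) with hs | hl
  · refine ⟨1, le_rfl, by simpa using one_le_pow₀ hT1, fun j h1 h2 => ?_⟩
    refine (nn_half _).trans ?_
    rw [le_div_iff₀ (by positivity)]
    calc 1 / 2 * (N : ℝ) ^ j ≤ (N : ℝ) ^ j := by linarith [pow_pos hN' j]
      _ ≤ (T ^ E) ^ j := by gcongr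
      _ = T ^ (E * j) := by rw [pow_mul]
      _ ≤ T ^ C := by
        apply pw hT
        calc E * j ≤ E * d := by gcongr
          _ ≤ C := by rw [hC]; omega
  · obtain ⟨q, hq1, hqT, hq⟩ := hC0 c N hN T hT h
    set ℓ := ⌊(N : ℝ) / T ^ E⌋₊ with hℓ
    have hx1 : 1 ≤ (N : ℝ) / T ^ E := by rw [le_div_iff₀ (by positivity)]; linarith
    have hℓ1 : 1 ≤ ℓ := Nat.le_floor (by simpa using hx1)
    have hℓu : (ℓ : ℝ) ≤ N / T ^ E := Nat.floor_le (by positivity)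
    have hℓ1' : (1 : ℝ) ≤ ℓ := by exact_mod_cast hℓ1
    have hℓl : (N : ℝ) / T ^ E ≤ 2 * ℓ := by
      have := Nat.lt_floor_add_one ((N : ℝ) / T ^ E)
      rw [← hℓ] at this; linarith
    have hT4 : 4 ≤ T ^ 2 := by nlinarith
    have hqℓ : 4 * T * (q * ℓ) ≤ N := by
      calc 4 * T * (q * ℓ) ≤ T ^ 2 * T * (T ^ C0 * (N / T ^ E)) := by gcongr
        _ = T ^ (3 + C0) * (N / T ^ E) := by rw [pow_add]; ring
        _ ≤ T ^ E * (N / T ^ E) := by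
          have := pw hT (show 3 + C0 ≤ E by omega)
          gcongr
        _ = N := by field_simp
    have hqℓ' : q * ℓ ≤ N := by
      have : (q : ℝ) * ℓ ≤ N := by
        have : 0 ≤ (q : ℝ) * ℓ := by positivity
        nlinarith
      exact_mod_cast this
    obtain ⟨n₀, hn₀, hn⟩ := avg_shift (fun n => ee (pe c d n)) (fun n => norm_ee _) N q ℓ hN T hT0 h hqℓ
    have herr : ∀ m ∈ range ℓ, ∃ er : ℝ, |er| ≤ 1 / T ^ 6 ∧
        ee (pe c d (n₀ + q * m : ℕ)) =
        ee (∑ j ∈ range g, c (e + 1 + 1 + j) * (n₀ : ℝ) ^ (e + 1 + 1 + j)) * ee (pe c (e + 1) (n₀ + q * m : ℕ) + er) := by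
      intro m hm
      rw [mem_range] at hm
      obtain ⟨z, er, h1, h2⟩ := pe_split c (e + 1) g n₀ q m N ℓ (fun j => q * c j - round (q * c j))
        (fun j => round (q * c j)) (T ^ C0) (by nlinarith) hm.le hN
        (fun j h1 h2 => ⟨by ring, hq j h1 (by omega)⟩)
      refine ⟨er, ?_, ?_⟩
      · refine h2.trans ?_
        have hgd : (g : ℝ) ≤ T ^ d := by
          refine (nat_le_pow hT g).trans (pw hT (by omega))
        have hdd : ((e + 1 : ℕ) : ℝ) + g ≤ T ^ d := by
          have := nat_le_pow hT d
          have h9 : ((e + 1 : ℕ) : ℝ) + g = d := by rw [hd]; push_cast; ring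
          rw [h9]; exact this
        calc (g : ℝ) * (T ^ C0 * (((e + 1 : ℕ) : ℝ) + g) * 2 ^ (e + 1 + g) * ℓ / N)
            = g * (T ^ C0 * (((e + 1 : ℕ) : ℝ) + g) * 2 ^ d * ℓ / N) := by rw [hd]
          _ ≤ T ^ d * (T ^ C0 * T ^ d * T ^ d * (N / T ^ E) / N) := by
              gcongr
          _ = T ^ (C0 + 3 * d) / T ^ E := by
              rw [show T ^ (C0 + 3 * d) = T ^ C0 * (T ^ d) ^ 3 by rw [← pow_mul, ← pow_add, mul_comm 3 d]]; field_simp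
          _ = 1 / T ^ 6 := by
              rw [hE, show C0 + 6 + 3 * d = (C0 + 3 * d) + 6 by ring, pow_add T (C0 + 3 * d) 6]
              field_simp
          _ ≤ _ := le_rfl
      · rw [← hd] at h1
        rw [h1, ← ee_add]
        refine Eq.trans ?_ (ee_add_int _ z)
        congr 1; ring
    choose! er her1 her2 using herr
    have hsum : ∑ m ∈ range ℓ, ee (pe c d (n₀ + q * m : ℕ)) =
        ee (∑ j ∈ range g, c (e + 1 + 1 + j) * (n₀ : ℝ) ^ (e + 1 + 1 + j)) *
          ∑ m ∈ range ℓ, ee (pe c (e + 1) (n₀ + q * m : ℕ) + er m) := by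
      rw [mul_sum]; exact sum_congr rfl her2
    have hbig : (ℓ : ℝ) / T ^ 3 ≤ ‖∑ m ∈ range ℓ, ee (pe c (e + 1) (n₀ + q * m : ℕ))‖ := by
      rw [hsum, norm_mul, norm_ee, one_mul] at hn
      have h1 : ‖∑ m ∈ range ℓ, ee (pe c (e + 1) (n₀ + q * m : ℕ) + er m) -
          ∑ m ∈ range ℓ, ee (pe c (e + 1) (n₀ + q * m : ℕ))‖ ≤ ℓ * (8 / T ^ 6) := by
        rw [← sum_sub_distrib]
        refine (norm_sum_le _ _).trans ?_
        have : (ℓ : ℝ) * (8 / T ^ 6) = (range ℓ).card • (8 / T ^ 6) := by rw [card_range, nsmul_eq_mul]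
        rw [this]
        refine sum_le_card_nsmul _ _ _ fun m hm => ?_
        refine (ee_sub_le _ _).trans ?_
        rw [add_sub_cancel_left]
        calc 2 * Real.pi * |er m| ≤ 8 * (1 / T ^ 6) := by
              gcongr
              · linarith [Real.pi_lt_d2]
              · exact her1 m hm
          _ = _ := by ring
      have h2 := norm_sub_norm_le (∑ m ∈ range ℓ, ee (pe c (e + 1) (n₀ + q * m : ℕ) + er m))
        (∑ m ∈ range ℓ, ee (pe c (e + 1) (n₀ + q * m : ℕ)))
      have h3 : (ℓ : ℝ) / T ^ 3 + ℓ * (8 / T ^ 6) ≤ ℓ / (2 * T) := by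
        have : 1 / T ^ 3 + 8 / T ^ 6 ≤ 1 / (2 * T) := by
          rw [div_add_div _ _ (by positivity) (by positivity), div_le_div_iff₀ (by positivity) (by positivity)]
          have h8 : 8 ≤ T ^ 3 := by nlinarith
          have : T ^ 3 * T ^ 6 = T ^ 2 * (T * T ^ 6) := by ring
          nlinarith [pow_pos hT0 6, pow_pos hT0 3, mul_le_mul_of_nonneg_right hT4 (by positivity : (0:ℝ) ≤ T * T ^ 6),
            mul_le_mul_of_nonneg_right h8 (by positivity : (0:ℝ) ≤ T * T ^ 3)]
        calc (ℓ : ℝ) / T ^ 3 + ℓ * (8 / T ^ 6) = ℓ * (1 / T ^ 3 + 8 / T ^ 6) := by ring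
          _ ≤ ℓ * (1 / (2 * T)) := by gcongr
          _ = _ := by ring
      linarith
    obtain ⟨q', hq'1, hq'T, hq'⟩ := hC1 _ _ (IsT_comp e _ _ n₀ q (IsT_pe c e)) ℓ hℓ1 (T ^ 3) (by nlinarith) hbig
    rw [← pow_mul] at hq'T hq'
    have he : e + 1 ≤ d := by omega
    have hqe : ∀ f ≤ d, (q' * q ^ f : ℝ) ≤ T ^ (3 * C1 + C0 * d) := by
      intro f hf
      calc (q' * q ^ f : ℝ) ≤ T ^ (3 * C1) * (T ^ C0) ^ f := by gcongr
        _ = T ^ (3 * C1 + C0 * f) := by rw [pow_add, ← pow_mul]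
        _ ≤ _ := by
          apply pw hT; gcongr
    refine ⟨q' * q ^ (e + 1), Nat.one_le_iff_ne_zero.2 (by positivity), ?_, fun j h1 h2 => ?_⟩
    · push_cast
      refine (hqe (e + 1) he).trans (pw hT ?_)
      rw [hC]; nlinarith
    · rcases Nat.eq_or_lt_of_le h1 with h1 | h1
      · rw [← h1, Nat.cast_mul, mul_assoc, Nat.cast_pow]
        refine hq'.trans ?_
        have hlow : (N : ℝ) / T ^ (E + 1) ≤ ℓ := by
          rw [pow_succ, ← div_div, div_le_iff₀ hT0]
          nlinarith
        rw [div_le_div_iff₀ (by positivity) (by positivity)]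
        have : (N : ℝ) ≤ ℓ * T ^ (E + 1) := by rwa [div_le_iff₀ (by positivity)] at hlow
        calc T ^ (3 * C1) * (N : ℝ) ^ (e + 1) ≤ T ^ (3 * C1) * (ℓ * T ^ (E + 1)) ^ (e + 1) := by gcongr
          _ = T ^ (3 * C1 + (E + 1) * (e + 1)) * ℓ ^ (e + 1) := by
            rw [mul_pow, ← pow_mul, pow_add]; ring
          _ ≤ T ^ C * ℓ ^ (e + 1) := by
            have h5 : (E + 1) * (e + 1) ≤ (E + 1) * d := by gcongr
            have := pw hT (show 3 * C1 + (E + 1) * (e + 1) ≤ C by rw [hC]; omega)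
            gcongr
      · have h3 := hq j h1 h2
        have h4 : ((q' * q ^ (e + 1) : ℕ) : ℝ) * c j = (q' * q ^ e : ℕ) * (q * c j) := by
          push_cast; ring
        rw [h4]
        refine (nn_nat_mul _ _).trans ?_
        push_cast
        calc (q' * q ^ e : ℝ) * nn (q * c j) ≤ T ^ (3 * C1 + C0 * d) * (T ^ C0 / N ^ j) := by
              gcongr
              · exact nn_nonneg _
              · exact hqe e (by omega)
          _ = T ^ (3 * C1 + C0 * (d + 1)) / N ^ j := by
              rw [show 3 * C1 + C0 * (d + 1) = 3 * C1 + C0 * d + C0 by ring, pow_add _ _ C0]; ring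
          _ ≤ _ := by
            have := pw hT (show 3 * C1 + C0 * (d + 1) ≤ C by rw [hC]; omega)
            gcongr

theorem weyl_inv (d : ℕ) : ∃ C : ℕ, ∀ c : ℕ → ℝ, ∀ N : ℕ, 1 ≤ N → ∀ T : ℝ, 2 ≤ T →
      N / T ≤ ‖∑ n ∈ range N, ee (pe c d n)‖ →
      ∃ q : ℕ, 1 ≤ q ∧ (q : ℝ) ≤ T ^ C ∧ ∀ j, 1 ≤ j → j ≤ d → nn (q * c j) ≤ T ^ C / (N : ℝ) ^ j := by
  have key : ∀ g ≤ d, ∃ C : ℕ, ∀ c : ℕ → ℝ, ∀ N : ℕ, 1 ≤ N → ∀ T : ℝ, 2 ≤ T →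
      N / T ≤ ‖∑ n ∈ range N, ee (pe c d n)‖ →
      ∃ q : ℕ, 1 ≤ q ∧ (q : ℝ) ≤ T ^ C ∧ ∀ j, d - g < j → j ≤ d → nn (q * c j) ≤ T ^ C / (N : ℝ) ^ j := by
    intro g
    induction g with
    | zero =>
      intro _
      exact ⟨0, fun c N hN T hT h => ⟨1, le_rfl, by simp, fun j h1 h2 => by omega⟩⟩
    | succ g ih =>
      intro hg
      obtain ⟨C0, h⟩ := ih (by omega)
      obtain ⟨e, rfl⟩ : ∃ e, d = e + 1 + g := ⟨d - g - 1, by omega⟩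
      rw [show e + 1 + g - g = e + 1 by omega] at h
      rw [show e + 1 + g - (g + 1) = e by omega]
      exact weyl_step e g C0 h
  obtain ⟨C, h⟩ := key d le_rfl
  refine ⟨C, fun c N hN T hT hh => ?_⟩
  obtain ⟨q, h1, h2, h3⟩ := h c N hN T hT hh
  exact ⟨q, h1, h2, fun j hj => h3 j (by omega)⟩

end VMV
end

noncomputable section
open Finset
namespace VMV

def PP (R : ℕ) : Finset ℕ := (range (R + 1)).filter Nat.Prime
def UU (R : ℕ) : Finset (Finset ℕ) := (PP R).powerset.filter (fun U => ∏ p ∈ U, p ≤ R)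
def sphi (U : Finset ℕ) : ℝ := ∏ p ∈ U, ((p : ℝ) - 1)
def spsi (U C : Finset ℕ) : ℝ := ∏ p ∈ U, (if p ∈ C then 1 - (p : ℝ) else 1)
def GG (R : ℕ) : ℝ := ∑ U ∈ UU R, 1 / sphi U
def rho (R : ℕ) (A : Finset ℕ) : ℝ := ∑ U ∈ UU R, if A ⊆ U then (∏ p ∈ A, (-(p : ℝ))) / sphi U else 0
def SF (R : ℕ) (C : Finset ℕ) : ℝ := ∑ U ∈ UU R, spsi U C / sphi U

theorem mem_PP {R p : ℕ} : p ∈ PP R ↔ p ≤ R ∧ p.Prime := by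
  unfold PP; rw [mem_filter, mem_range, Nat.lt_succ_iff]

theorem mem_UU {R : ℕ} {U : Finset ℕ} : U ∈ UU R ↔ U ⊆ PP R ∧ ∏ p ∈ U, p ≤ R := by
  unfold UU; rw [mem_filter, mem_powerset]

theorem UU_sub {R : ℕ} {U V : Finset ℕ} (hU : U ∈ UU R) (h : V ⊆ U) : V ∈ UU R := by
  rw [mem_UU] at hU ⊢
  refine ⟨h.trans hU.1, (prod_le_prod_of_subset_of_one_le' h fun p hp _ => ?_).trans hU.2⟩
  exact (mem_PP.1 (hU.1 hp)).2.one_lt.le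

theorem PP_two {R p : ℕ} (h : p ∈ PP R) : (2 : ℝ) ≤ p := by
  exact_mod_cast (mem_PP.1 h).2.two_le

theorem one_le_sphi {R : ℕ} {U : Finset ℕ} (hU : U ⊆ PP R) : 1 ≤ sphi U := by
  unfold sphi
  have : ∀ p ∈ U, (1 : ℝ) ≤ (p : ℝ) - 1 := fun p hp => by linarith [PP_two (hU hp)]
  calc (1 : ℝ) = ∏ p ∈ U, 1 := by simp
    _ ≤ _ := prod_le_prod (fun _ _ => zero_le_one) this

theorem empty_mem_UU {R : ℕ} (hR : 1 ≤ R) : ∅ ∈ UU R := by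
  rw [mem_UU]; simpa using hR

theorem one_le_GG {R : ℕ} (hR : 1 ≤ R) : 1 ≤ GG R := by
  unfold GG
  have := single_le_sum (s := UU R) (f := fun U => 1 / sphi U) (fun U hU => by
    have := one_le_sphi (mem_UU.1 hU).1
    positivity) (empty_mem_UU hR)
  simpa [sphi] using this

theorem prod_inj {R : ℕ} : Set.InjOn (fun U : Finset ℕ => ∏ p ∈ U, p) {U | U ⊆ PP R} := by
  intro U hU V hV h
  have h1 := Nat.primeFactors_prod (s := U) fun p hp => (mem_PP.1 (hU hp)).2
  have h2 := Nat.primeFactors_prod (s := V) fun p hp => (mem_PP.1 (hV hp)).2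
  dsimp only at h
  rw [← h1, ← h2, h]

theorem card_UU (R : ℕ) : (UU R).card ≤ R := by
  have := card_le_card_of_injOn (s := UU R) (t := Icc 1 R) (fun U : Finset ℕ => ∏ p ∈ U, p) (fun U hU => by
    have := mem_UU.1 hU
    simp only [coe_Icc, Set.mem_Icc]
    refine ⟨Nat.one_le_iff_ne_zero.2 (prod_ne_zero_iff.2 fun p hp => ?_), this.2⟩
    exact (mem_PP.1 (this.1 hp)).2.ne_zero)
    (prod_inj.mono fun U hU => (mem_UU.1 hU).1)
  simpa using this

theorem GG_le (R : ℕ) : GG R ≤ R := by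
  unfold GG
  calc ∑ U ∈ UU R, 1 / sphi U ≤ ∑ U ∈ UU R, (1 : ℝ) := sum_le_sum fun U hU => by
        have := one_le_sphi (mem_UU.1 hU).1
        rw [div_le_one (by linarith)]; exact this
    _ = (UU R).card := by simp
    _ ≤ R := by exact_mod_cast card_UU R

theorem spsi_expand (U C : Finset ℕ) : spsi U C =
    ∑ A ∈ U.powerset, (∏ p ∈ A, (-(p : ℝ))) * if A ⊆ C then 1 else 0 := by
  have h1 : spsi U C = ∏ p ∈ U, (1 + if p ∈ C then -(p : ℝ) else 0) := by
    unfold spsi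
    refine prod_congr rfl fun p _ => ?_
    split_ifs <;> ring
  rw [h1, prod_one_add]
  refine sum_congr rfl fun A _ => ?_
  split_ifs with h
  · rw [mul_one]
    exact prod_congr rfl fun p hp => by rw [if_pos (h hp)]
  · rw [mul_zero]
    obtain ⟨p, hp, hp2⟩ := not_subset.1 h
    exact prod_eq_zero hp (by rw [if_neg hp2])

theorem SF_expand (R : ℕ) (C : Finset ℕ) : SF R C = ∑ A ∈ UU R, rho R A * if A ⊆ C then 1 else 0 := by
  unfold SF rho
  have : ∀ U ∈ UU R, spsi U C / sphi U = ∑ A ∈ UU R,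
      (if A ⊆ U then (∏ p ∈ A, (-(p : ℝ))) / sphi U else 0) * if A ⊆ C then 1 else 0 := by
    intro U hU
    rw [spsi_expand, sum_div]
    have hs : U.powerset = (UU R).filter (fun A => A ⊆ U) := by
      ext A; rw [mem_powerset, mem_filter]
      exact ⟨fun h => ⟨UU_sub hU h, h⟩, fun h => h.2⟩
    rw [hs, sum_filter]
    refine sum_congr rfl fun A _ => ?_
    by_cases h : A ⊆ U
    · rw [if_pos h, if_pos h]; ring
    · rw [if_neg h, if_neg h]; ring
  rw [sum_congr rfl this, sum_comm]
  refine sum_congr rfl fun A _ => ?_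
  rw [sum_mul]

theorem rho_le {R : ℕ} {A : Finset ℕ} (hA : A ∈ UU R) : |rho R A| ≤ (R : ℝ) ^ 2 := by
  unfold rho
  have h0 : |∏ p ∈ A, (-(p : ℝ))| ≤ R := by
    rw [abs_prod]
    simp only [abs_neg, Nat.abs_cast]
    have := (mem_UU.1 hA).2
    rw [← Nat.cast_prod]
    exact_mod_cast this
  calc |∑ U ∈ UU R, if A ⊆ U then (∏ p ∈ A, (-(p : ℝ))) / sphi U else 0|
      ≤ ∑ U ∈ UU R, (R : ℝ) := (abs_sum_le_sum_abs _ _).trans (sum_le_sum fun U hU => by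
        have := one_le_sphi (mem_UU.1 hU).1
        split_ifs
        · rw [abs_div, abs_of_pos (a := sphi U) (by linarith)]
          exact (div_le_self (abs_nonneg _) this).trans h0
        · simp)
    _ = (UU R).card * R := by simp
    _ ≤ (R : ℝ) * R := by
        gcongr; exact card_UU R
    _ = _ := by ring

/-- weight of a random set -/
def prb (R : ℕ) (e : ℕ → ℝ) (C : Finset ℕ) : ℝ := (∏ p ∈ C, e p) * ∏ p ∈ PP R \ C, (1 - e p)

theorem prb_sub (R : ℕ) (e : ℕ → ℝ) (A : Finset ℕ) (hA : A ⊆ PP R) :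
    ∑ C ∈ (PP R).powerset, prb R e C * (if A ⊆ C then 1 else 0) = ∏ p ∈ A, e p := by
  have h := prod_add (fun p => e p) (fun p => (1 - e p) * if p ∈ A then 0 else 1) (PP R)
  have h1 : ∏ p ∈ PP R, (e p + (1 - e p) * if p ∈ A then 0 else 1) = ∏ p ∈ A, e p := by
    rw [← prod_subset hA (f := fun p => (e p + (1 - e p) * if p ∈ A then 0 else 1))]
    · exact prod_congr rfl fun p hp => by simp [hp]
    · intro p _ hp; simp [hp]
  rw [← h1, h]
  refine sum_congr rfl fun C hC => ?_
  rw [mem_powerset] at hC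
  unfold prb
  rw [mul_assoc]
  congr 1
  rw [prod_mul_distrib]
  congr 1
  split_ifs with hs
  · symm
    refine prod_eq_one fun p hp => ?_
    rw [mem_sdiff] at hp
    rw [if_neg fun h => hp.2 (hs h)]
  · obtain ⟨p, hp, hp2⟩ := not_subset.1 hs
    symm
    exact prod_eq_zero (mem_sdiff.2 ⟨hA hp, hp2⟩) (by rw [if_pos hp])

theorem spsi_swap (R : ℕ) {U C : Finset ℕ} : spsi U C = ∏ p ∈ C, (if p ∈ U then 1 - (p : ℝ) else 1) := by
  unfold spsi
  rw [prod_ite_mem, prod_ite_mem, inter_comm]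

theorem prb_psi (R : ℕ) (e : ℕ → ℝ) (U V : Finset ℕ) :
    ∑ C ∈ (PP R).powerset, prb R e C * (spsi U C * spsi V C) = ∏ p ∈ PP R,
      (e p * ((if p ∈ U then 1 - (p : ℝ) else 1) * (if p ∈ V then 1 - (p : ℝ) else 1)) + (1 - e p)) := by
  rw [prod_add]
  refine sum_congr rfl fun C hC => ?_
  rw [spsi_swap R, spsi_swap R (U := V), prod_mul_distrib, prod_mul_distrib]
  unfold prb
  ring

theorem sum_rho (R : ℕ) (e : ℕ → ℝ) :
    ∑ A ∈ UU R, ∑ B ∈ UU R, rho R A * rho R B * ∏ p ∈ A ∪ B, e p =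
    ∑ U ∈ UU R, ∑ V ∈ UU R, (1 / (sphi U * sphi V)) * ∏ p ∈ PP R,
      (e p * ((if p ∈ U then 1 - (p : ℝ) else 1) * (if p ∈ V then 1 - (p : ℝ) else 1)) + (1 - e p)) := by
  have h1 : ∑ C ∈ (PP R).powerset, prb R e C * (SF R C * SF R C) =
      ∑ A ∈ UU R, ∑ B ∈ UU R, rho R A * rho R B * ∏ p ∈ A ∪ B, e p := by
    simp_rw [SF_expand, sum_mul_sum, mul_sum]
    rw [sum_comm]
    refine sum_congr rfl fun A hA => ?_
    rw [sum_comm]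
    refine sum_congr rfl fun B hB => ?_
    rw [← prb_sub R e (A ∪ B) (union_subset (mem_UU.1 hA).1 (mem_UU.1 hB).1), mul_sum]
    refine sum_congr rfl fun C _ => ?_
    by_cases h1 : A ⊆ C <;> by_cases h2 : B ⊆ C <;> simp [h1, h2, union_subset_iff] ; ring
  rw [← h1]
  simp_rw [SF, sum_mul_sum, mul_sum]
  rw [sum_comm]
  refine sum_congr rfl fun U _ => ?_
  rw [sum_comm]
  refine sum_congr rfl fun V _ => ?_
  rw [← prb_psi, mul_sum]
  refine sum_congr rfl fun C _ => ?_
  rw [div_mul_div_comm]; ring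

end VMV
end

noncomputable section
open Finset
namespace VMV

theorem sphi_split {R : ℕ} {V : Finset ℕ} (hV : V ⊆ PP R) (Q : Finset ℕ) :
    sphi (V ∩ Q) / sphi V = 1 / sphi (V \ Q) := by
  have h : sphi V = sphi (V ∩ Q) * sphi (V \ Q) := by
    unfold sphi; rw [prod_inter_mul_prod_sdiff]
  have h1 := one_le_sphi (inter_subset_left.trans hV : V ∩ Q ⊆ PP R)
  have h2 := one_le_sphi (sdiff_subset.trans hV : V \ Q ⊆ PP R)
  rw [h]
  field_simp

theorem loc_bound {R : ℕ} {e : ℕ → ℝ} {Q : Finset ℕ} (h1 : ∀ p ∈ PP R, p ∉ Q → e p = 1 / p)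
    (h2 : ∀ p ∈ Q, e p = 0 ∨ e p = 1) {U V : Finset ℕ} (hU : U ⊆ PP R) (hV : V ⊆ PP R) :
    |(1 / (sphi U * sphi V)) * ∏ p ∈ PP R,
      (e p * ((if p ∈ U then 1 - (p : ℝ) else 1) * (if p ∈ V then 1 - (p : ℝ) else 1)) + (1 - e p))| ≤
    if U \ Q = V \ Q then 1 / sphi (U \ Q) else 0 := by
  have hU1 := one_le_sphi hU
  have hV1 := one_le_sphi hV
  by_cases h : U \ Q = V \ Q
  · rw [if_pos h, abs_mul, abs_prod, h, ← sphi_split hV]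
    have hle : ∏ p ∈ PP R, |(e p * ((if p ∈ U then 1 - (p : ℝ) else 1) * (if p ∈ V then 1 - (p : ℝ) else 1)) + (1 - e p))|
        ≤ ∏ p ∈ PP R, ((if p ∈ U then (p : ℝ) - 1 else 1) * (if p ∈ V ∩ Q then (p : ℝ) - 1 else 1)) := by
      refine prod_le_prod (fun _ _ => abs_nonneg _) fun p hp => ?_
      have hp2 := PP_two hp
      by_cases hpQ : p ∈ Q
      · rcases h2 p hpQ with he | he <;> rw [he] <;> by_cases hu : p ∈ U <;> by_cases hv : p ∈ V <;>
          simp only [hu, hv, mem_inter, hpQ, if_true, if_false, and_true, and_false, true_and, false_and]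
        all_goals rw [abs_le]; constructor <;> nlinarith
      · have huv : p ∈ U ↔ p ∈ V := by
          have := congrArg (p ∈ ·) h
          simpa [hpQ] using this
        rw [h1 p hp hpQ]
        by_cases hv : p ∈ V
        · simp only [huv, hv, mem_inter, hpQ, if_true, if_false, and_false]
          have : 1 / (p : ℝ) * ((1 - p) * (1 - p)) + (1 - 1 / p) = p - 1 := by field_simp; ring
          rw [this, abs_of_nonneg (by linarith), mul_one]
        · simp only [huv, hv, mem_inter, if_false, false_and]
          rw [abs_of_nonneg] <;> ring_nf <;> norm_num
    have heq : ∏ p ∈ PP R, ((if p ∈ U then (p : ℝ) - 1 else 1) * (if p ∈ V ∩ Q then (p : ℝ) - 1 else 1)) =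
        sphi U * sphi (V ∩ Q) := by
      rw [prod_mul_distrib, prod_ite_mem, prod_ite_mem, inter_eq_right.2 hU,
        inter_eq_right.2 (inter_subset_left.trans hV)]
      rfl
    rw [heq] at hle
    rw [abs_of_pos (by positivity)]
    calc _ ≤ 1 / (sphi U * sphi V) * (sphi U * sphi (V ∩ Q)) := by gcongr
      _ = _ := by field_simp
  · rw [if_neg h]
    have : ∃ p ∈ PP R, p ∉ Q ∧ ¬ (p ∈ U ↔ p ∈ V) := by
      by_contra hc
      push Not at hc
      apply h
      ext p
      rw [mem_sdiff, mem_sdiff]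
      refine and_congr_left fun hpQ => ?_
      by_cases hp : p ∈ PP R
      · exact hc p hp hpQ
      · exact ⟨fun h => (hp (hU h)).elim, fun h => (hp (hV h)).elim⟩
    obtain ⟨p, hp, hpQ, huv⟩ := this
    rw [prod_eq_zero hp, mul_zero, abs_zero]
    have hp2 := PP_two hp
    rw [h1 p hp hpQ]
    by_cases hv : p ∈ V
    · have hu : p ∉ U := by tauto
      simp only [hu, hv, if_true, if_false]
      field_simp; ring
    · have hu : p ∈ U := by tauto
      simp only [hu, hv, if_true, if_false]
      field_simp; ring

theorem A_bound {R : ℕ} {e : ℕ → ℝ} {Q : Finset ℕ} (h1 : ∀ p ∈ PP R, p ∉ Q → e p = 1 / p)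
    (h2 : ∀ p ∈ Q, e p = 0 ∨ e p = 1) :
    |∑ A ∈ UU R, ∑ B ∈ UU R, rho R A * rho R B * ∏ p ∈ A ∪ B, e p| ≤ 4 ^ Q.card * GG R := by
  rw [sum_rho]
  refine (abs_sum_le_sum_abs _ _).trans ((sum_le_sum fun U hU => (abs_sum_le_sum_abs _ _).trans
    (sum_le_sum fun V hV => loc_bound h1 h2 (mem_UU.1 hU).1 (mem_UU.1 hV).1)).trans ?_)
  rw [← sum_product', ← sum_filter]
  set s := (UU R ×ˢ UU R).filter (fun x => x.1 \ Q = x.2 \ Q) with hs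
  set φ : Finset ℕ × Finset ℕ → Finset ℕ × (Finset ℕ × Finset ℕ) :=
    fun x => (x.1 \ Q, (x.1 ∩ Q, x.2 ∩ Q)) with hφ
  have hinj : Set.InjOn φ s := by
    rintro ⟨U, V⟩ hx ⟨U', V'⟩ hy hxy
    rw [hs] at hx hy
    simp only [coe_filter, mem_product, Set.mem_ofPred_eq] at hx hy
    simp only [hφ, Prod.mk.injEq] at hxy
    obtain ⟨e1, e2, e3⟩ := hxy
    have eV : V \ Q = V' \ Q := by rw [← hx.2, ← hy.2, e1]
    rw [Prod.mk.injEq]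
    constructor
    · rw [← sdiff_union_inter U Q, e1, e2, sdiff_union_inter]
    · rw [← sdiff_union_inter V Q, eV, e3, sdiff_union_inter]
  have h3 : ∑ x ∈ s, 1 / sphi (x.1 \ Q) = ∑ y ∈ s.image φ, 1 / sphi y.1 := by
    rw [sum_image hinj]
  rw [h3]
  have hsub : s.image φ ⊆ UU R ×ˢ (Q.powerset ×ˢ Q.powerset) := by
    intro y hy
    rw [mem_image] at hy
    obtain ⟨⟨U, V⟩, hx, rfl⟩ := hy
    rw [hs, mem_filter, mem_product] at hx
    simp only [hφ, mem_product, mem_powerset]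
    exact ⟨UU_sub hx.1.1 sdiff_subset, inter_subset_right, inter_subset_right⟩
  refine (sum_le_sum_of_subset_of_nonneg hsub fun y hy _ => ?_).trans (le_of_eq ?_)
  · rw [mem_product] at hy
    have := one_le_sphi (mem_UU.1 hy.1).1
    positivity
  · rw [sum_product]
    simp only [sum_const, card_product, card_powerset, nsmul_eq_mul]
    rw [← mul_sum]
    unfold GG
    congr 1
    push_cast
    rw [← mul_pow]; norm_num

theorem moebius_bound (D : Finset ℕ) : ∀ (κ : Finset ℕ → ℝ) (Q : Finset ℕ) (M : ℝ), D ⊆ Q →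
    (∀ H ⊆ Q, |∑ D' ∈ H.powerset, κ D'| ≤ M) → |κ D| ≤ 2 ^ D.card * M := by
  induction D using Finset.induction_on with
  | empty =>
    intro κ Q M _ h
    simpa using h ∅ (empty_subset _)
  | insert p D hp ih =>
    intro κ Q M hD h
    have hpQ : p ∈ Q := hD (mem_insert_self _ _)
    have := ih (fun D' => κ (insert p D')) (Q.erase p) (2 * M) (fun x hx => by
      rw [mem_erase]
      exact ⟨fun h => hp (h ▸ hx), hD (mem_insert_of_mem hx)⟩) (fun H hH => by
      have hpH : p ∉ H := fun h => by simpa using hH h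
      have e := sum_powerset_insert hpH κ
      have h1 := h (insert p H) (insert_subset hpQ (hH.trans (erase_subset _ _)))
      have h2 := h H (hH.trans (erase_subset _ _))
      rw [e] at h1
      rw [abs_le] at *
      constructor <;> linarith)
    rw [card_insert_of_notMem hp, pow_succ]
    linarith

theorem kap_bound {R : ℕ} (hR : 1 ≤ R) (Q D : Finset ℕ) (hD : D ⊆ Q) :
    |∑ A ∈ UU R, ∑ B ∈ UU R, if (A ∪ B) ∩ Q = D then rho R A * rho R B * ∏ p ∈ (A ∪ B) \ Q, (1 / (p : ℝ)) else 0|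
      ≤ 8 ^ Q.card * GG R := by
  have hG := one_le_GG hR
  have := moebius_bound D (fun D => ∑ A ∈ UU R, ∑ B ∈ UU R,
    if (A ∪ B) ∩ Q = D then rho R A * rho R B * ∏ p ∈ (A ∪ B) \ Q, (1 / (p : ℝ)) else 0) Q (4 ^ Q.card * GG R) hD
    (fun H hH => by
      have h := A_bound (R := R) (Q := Q) (e := fun p => if p ∈ Q then (if p ∈ H then 1 else 0) else 1 / p)
        (fun p _ hp => by simp [hp]) (fun p hp => by by_cases h : p ∈ H <;> simp [hp, h])
      refine le_trans (le_of_eq ?_) h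
      congr 1
      rw [sum_comm]
      refine sum_congr rfl fun A _ => ?_
      rw [sum_comm]
      refine sum_congr rfl fun B _ => ?_
      rw [sum_ite_eq]
      simp only [mem_powerset]
      rw [← prod_inter_mul_prod_sdiff (A ∪ B) Q]
      have e1 : ∏ p ∈ (A ∪ B) \ Q, (if p ∈ Q then (if p ∈ H then 1 else 0) else 1 / (p : ℝ)) =
          ∏ p ∈ (A ∪ B) \ Q, (1 / (p : ℝ)) :=
        prod_congr rfl fun p hp => if_neg (mem_sdiff.1 hp).2
      rw [e1]
      split_ifs with hs
      · rw [prod_eq_one (s := (A ∪ B) ∩ Q), one_mul]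
        intro p hp
        rw [if_pos (mem_inter.1 hp).2, if_pos (hs hp)]
      · obtain ⟨p, hp, hp2⟩ := not_subset.1 hs
        rw [prod_eq_zero hp, zero_mul, mul_zero]
        rw [if_pos (mem_inter.1 hp).2, if_neg hp2])
  refine this.trans ?_
  have h1 : (2 : ℝ) ^ D.card ≤ 2 ^ Q.card := pow_le_pow_right₀ (by norm_num) (card_le_card hD)
  calc (2 : ℝ) ^ D.card * (4 ^ Q.card * GG R) ≤ 2 ^ Q.card * (4 ^ Q.card * GG R) := by gcongr
    _ = _ := by rw [← mul_assoc, ← mul_pow]; norm_num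

theorem gcd_prod {R : ℕ} {U : Finset ℕ} (hU : U ⊆ PP R) (q : ℕ) (hq : 1 ≤ q) :
    Nat.gcd (∏ p ∈ U, p) q = ∏ p ∈ U ∩ q.primeFactors, p := by
  rw [← prod_inter_mul_prod_sdiff U q.primeFactors, Nat.Coprime.gcd_mul_right_cancel]
  · apply Nat.gcd_eq_left
    refine prod_primes_dvd _ (fun p hp => ?_) (fun p hp => ?_)
    · exact (mem_PP.1 (hU (mem_inter.1 hp).1)).2.prime
    · exact Nat.dvd_of_mem_primeFactors (mem_inter.1 hp).2
  · rw [Nat.coprime_prod_left_iff]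
    intro p hp
    rw [mem_sdiff] at hp
    have hpp := (mem_PP.1 (hU hp.1)).2
    rw [hpp.coprime_iff_not_dvd]
    exact fun h => hp.2 (Nat.mem_primeFactors.2 ⟨hpp, h, by omega⟩)

theorem sum_inv_sq (n : ℕ) : ∑ k ∈ Icc 1 n, 1 / (k : ℝ) ^ 2 ≤ 2 := by
  rcases n with _ | n
  · simp
  have : ∑ k ∈ Icc 1 (n + 1), 1 / (k : ℝ) ^ 2 ≤ 2 - 1 / ((n : ℝ) + 1) := by
    induction n with
    | zero => norm_num
    | succ n ih =>
      rw [sum_Icc_succ_top (by omega)]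
      have h : 1 / (((n + 1 + 1 : ℕ) : ℝ)) ^ 2 ≤ 1 / ((n : ℝ) + 1) - 1 / ((n + 1 : ℕ) + 1) := by
        push_cast
        rw [div_sub_div _ _ (by positivity) (by positivity), div_le_div_iff₀ (by positivity) (by positivity)]
        nlinarith [(Nat.cast_nonneg n : (0 : ℝ) ≤ n)]
      linarith
  have h2 : (0 : ℝ) ≤ 1 / ((n : ℝ) + 1) := by positivity
  linarith

theorem GG_log (R : ℕ) : Real.log R / 2 ≤ GG R := by
  have h0 : ∀ n ∈ Icc 1 R, ∃ U : Finset ℕ, ∃ b : ℕ, U ∈ UU R ∧ b ∈ Icc 1 R ∧ b ^ 2 * ∏ p ∈ U, p = n := by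
    intro n hn
    rw [mem_Icc] at hn
    obtain ⟨a, b, h, ha⟩ := Nat.sq_mul_squarefree n
    have ha0 : a ≠ 0 := ha.ne_zero
    have hb0 : b ≠ 0 := by rintro rfl; simp at h; omega
    have hab : a ≤ R := by
      have : 1 ≤ b ^ 2 := Nat.one_le_pow _ _ (by omega)
      nlinarith
    refine ⟨a.primeFactors, b, ?_, ?_, ?_⟩
    · rw [mem_UU, Nat.prod_primeFactors_of_squarefree ha]
      refine ⟨fun p hp => ?_, hab⟩
      exact mem_PP.2 ⟨(Nat.le_of_mem_primeFactors hp).trans hab, Nat.prime_of_mem_primeFactors hp⟩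
    · rw [mem_Icc]
      have : 1 ≤ a := by omega
      exact ⟨by omega, by nlinarith⟩
    · rw [Nat.prod_primeFactors_of_squarefree ha, h]
  choose! U b hU hb hn using h0
  have h1 : ∑ n ∈ Icc 1 R, 1 / (n : ℝ) ≤
      ∑ y ∈ UU R ×ˢ Icc 1 R, (1 / sphi y.1) * (1 / (y.2 : ℝ) ^ 2) := by
    have hinj : Set.InjOn (fun n => (U n, b n)) (Icc 1 R : Finset ℕ) := by
      intro x hx y hy hxy
      simp only [Prod.mk.injEq] at hxy
      rw [← hn x hx, ← hn y hy, hxy.1, hxy.2]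
    calc ∑ n ∈ Icc 1 R, 1 / (n : ℝ) ≤ ∑ n ∈ Icc 1 R, (1 / sphi (U n)) * (1 / (b n : ℝ) ^ 2) := by
          refine sum_le_sum fun n hn' => ?_
          have hUn := mem_UU.1 (hU n hn')
          have h1 := one_le_sphi hUn.1
          have hb1 : (1 : ℝ) ≤ b n := by exact_mod_cast (mem_Icc.1 (hb n hn')).1
          have h2 : sphi (U n) ≤ ((∏ p ∈ U n, p : ℕ) : ℝ) := by
            unfold sphi
            push_cast
            refine prod_le_prod (fun p hp => ?_) fun p hp => by linarith
            linarith [PP_two (hUn.1 hp)]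
          have h3 : (n : ℝ) = (b n : ℝ) ^ 2 * ((∏ p ∈ U n, p : ℕ) : ℝ) := by
            exact_mod_cast (hn n hn').symm
          rw [div_mul_div_comm, one_mul, h3, mul_comm]
          gcongr
      _ = ∑ y ∈ (Icc 1 R).image (fun n => (U n, b n)), (1 / sphi y.1) * (1 / (y.2 : ℝ) ^ 2) := by
          rw [sum_image hinj]
      _ ≤ _ := by
          refine sum_le_sum_of_subset_of_nonneg (fun y hy => ?_) fun y hy _ => ?_
          · rw [mem_image] at hy
            obtain ⟨n, hn', rfl⟩ := hy
            exact mem_product.2 ⟨hU n hn', hb n hn'⟩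
          · have := one_le_sphi (mem_UU.1 (mem_product.1 hy).1).1
            positivity
  rw [sum_product] at h1
  dsimp only at h1
  rw [← sum_mul_sum] at h1
  have h2 := sum_inv_sq R
  have h3 : Real.log R ≤ ∑ n ∈ Icc 1 R, 1 / (n : ℝ) := by
    have := log_add_one_le_harmonic R
    rw [harmonic_eq_sum_Icc] at this
    push_cast at this
    simp only [one_div]
    refine le_trans ?_ this
    rcases Nat.eq_zero_or_pos R with rfl | hR
    · simp
    · exact Real.log_le_log (by exact_mod_cast hR) (by linarith)
  have hG : 0 ≤ GG R := by
    unfold GG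
    refine sum_nonneg fun U hU => ?_
    have := one_le_sphi (mem_UU.1 hU).1
    positivity
  have h4 : (∑ U ∈ UU R, 1 / sphi U) * ∑ k ∈ Icc 1 R, 1 / (k : ℝ) ^ 2 ≤ GG R * 2 := by
    unfold GG at hG ⊢; gcongr
  linarith

/-- the sieve majorant -/
theorem sieve (R : ℕ) (hR : 1 ≤ R) : ∃ (G : ℝ) (I : Finset (Finset ℕ × Finset ℕ))
    (w : Finset ℕ × Finset ℕ → ℝ) (m : Finset ℕ × Finset ℕ → ℕ),
    Real.log R / 2 ≤ G ∧ 1 ≤ G ∧ G ≤ R ∧ ∑ i ∈ I, |w i| ≤ (R : ℝ) ^ 6 ∧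
    (∀ i ∈ I, 1 ≤ m i ∧ m i ≤ R ^ 2) ∧
    (∀ x : ℤ, 0 ≤ ∑ i ∈ I, w i * (if (m i : ℤ) ∣ x then 1 else 0)) ∧
    (∀ x : ℤ, (∀ p : ℕ, p.Prime → p ≤ R → ¬ (p : ℤ) ∣ x) →
      ∑ i ∈ I, w i * (if (m i : ℤ) ∣ x then 1 else 0) = 1) ∧
    (∀ q : ℕ, 1 ≤ q → ∀ g : ℕ, |∑ i ∈ I with Nat.gcd (m i) q = g, w i * (g / m i)| ≤ 8 ^ q.primeFactors.card / G) ∧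
    (∀ q : ℕ, 1 ≤ q → ∃ Dq : Finset ℕ, Dq.card ≤ 2 ^ q.primeFactors.card ∧ (∀ g ∈ Dq, g ∣ q) ∧
      ∀ i ∈ I, Nat.gcd (m i) q ∈ Dq) := by
  have hG1 := one_le_GG hR
  have hmul : ∀ (f : ℤ → ℝ) (x : ℤ), ∑ i ∈ UU R ×ˢ UU R, rho R i.1 * rho R i.2 / GG R ^ 2 *
      (if ((∏ p ∈ i.1 ∪ i.2, p : ℕ) : ℤ) ∣ x then (1 : ℝ) else 0) =
      (SF R ((PP R).filter (fun p => (p : ℤ) ∣ x)) / GG R) ^ 2 := by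
    intro f x
    rw [div_pow, sq (SF _ _), SF_expand, sum_mul_sum, ← sum_product', sum_div]
    refine sum_congr rfl fun i hi => ?_
    have key : ∀ A ∈ (PP R).powerset, ((∏ p ∈ A, p : ℕ) : ℤ) ∣ x ↔ A ⊆ (PP R).filter (fun p => (p : ℤ) ∣ x) := by
      intro A hA
      rw [mem_powerset] at hA
      constructor
      · intro h p hp
        refine mem_filter.2 ⟨hA hp, dvd_trans ?_ h⟩
        exact_mod_cast dvd_prod_of_mem _ hp
      · intro h
        rw [Int.natCast_dvd]
        refine prod_primes_dvd _ (fun p hp => (mem_PP.1 (hA hp)).2.prime) fun p hp => ?_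
        rw [← Int.natCast_dvd]
        exact (mem_filter.1 (h hp)).2
    rw [mem_product] at hi
    have hA := (mem_UU.1 hi.1).1
    have hB := (mem_UU.1 hi.2).1
    have k := key (i.1 ∪ i.2) (mem_powerset.2 (union_subset hA hB))
    rw [union_subset_iff] at k
    by_cases h1 : i.1 ⊆ (PP R).filter (fun p => (p : ℤ) ∣ x) <;>
      by_cases h2 : i.2 ⊆ (PP R).filter (fun p => (p : ℤ) ∣ x) <;>
      simp only [k, h1, h2, and_self, and_true, and_false, if_true, if_false, mul_one, mul_zero, zero_mul, zero_div]
  refine ⟨GG R, UU R ×ˢ UU R, fun i => rho R i.1 * rho R i.2 / GG R ^ 2, fun i => ∏ p ∈ i.1 ∪ i.2, p,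
    GG_log R, hG1, GG_le R, ?_, ?_, ?_, ?_, ?_, ?_⟩
  · have hc : ((UU R).card : ℝ) ≤ R := by exact_mod_cast card_UU R
    calc _ ≤ ∑ i ∈ UU R ×ˢ UU R, (R : ℝ) ^ 4 := by
          refine sum_le_sum fun i hi => ?_
          rw [mem_product] at hi
          rw [abs_div, abs_mul, abs_of_pos (a := GG R ^ 2) (by positivity)]
          refine (div_le_self (by positivity) (one_le_pow₀ hG1)).trans ?_
          calc _ ≤ (R : ℝ) ^ 2 * (R : ℝ) ^ 2 := by
                gcongr
                · exact rho_le hi.1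
                · exact rho_le hi.2
            _ = _ := by ring
      _ = ((UU R).card * (UU R).card : ℝ) * (R : ℝ) ^ 4 := by simp
      _ ≤ (R * R : ℝ) * (R : ℝ) ^ 4 := by gcongr
      _ = _ := by ring
  · intro i hi
    rw [mem_product] at hi
    have hA := mem_UU.1 hi.1
    have hB := mem_UU.1 hi.2
    have hpos : ∀ A ⊆ PP R, 1 ≤ ∏ p ∈ A, p := fun A hA =>
      Nat.one_le_iff_ne_zero.2 (prod_ne_zero_iff.2 fun p hp => (mem_PP.1 (hA hp)).2.ne_zero)
    refine ⟨hpos _ (union_subset hA.1 hB.1), ?_⟩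
    have := prod_union_inter (s₁ := i.1) (s₂ := i.2) (f := fun p : ℕ => p)
    have h2 := hpos _ (inter_subset_left.trans hA.1 : i.1 ∩ i.2 ⊆ PP R)
    calc ∏ p ∈ i.1 ∪ i.2, p ≤ (∏ p ∈ i.1 ∪ i.2, p) * ∏ p ∈ i.1 ∩ i.2, p := Nat.le_mul_of_pos_right _ h2
      _ = (∏ p ∈ i.1, p) * ∏ p ∈ i.2, p := this
      _ ≤ R * R := Nat.mul_le_mul hA.2 hB.2
      _ = _ := by ring
  · intro x
    rw [hmul (fun _ => 0)]
    positivity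
  · intro x hx
    rw [hmul (fun _ => 0)]
    have : (PP R).filter (fun p : ℕ => (p : ℤ) ∣ x) = ∅ := by
      rw [filter_eq_empty_iff]
      intro p hp
      exact hx p (mem_PP.1 hp).2 (mem_PP.1 hp).1
    rw [this]
    have h2 : SF R ∅ = GG R := by
      unfold SF GG
      refine sum_congr rfl fun U _ => ?_
      simp [spsi]
    rw [h2, div_self (by linarith)]; norm_num
  · intro q hq g
    by_cases hex : ∃ i ∈ UU R ×ˢ UU R, Nat.gcd (∏ p ∈ i.1 ∪ i.2, p) q = g
    · obtain ⟨i₀, hi₀, hg₀⟩ := hex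
      have hsub : ∀ i ∈ UU R ×ˢ UU R, i.1 ∪ i.2 ⊆ PP R := fun i hi =>
        union_subset (mem_UU.1 (mem_product.1 hi).1).1 (mem_UU.1 (mem_product.1 hi).2).1
      set D := (i₀.1 ∪ i₀.2) ∩ q.primeFactors with hD
      rw [gcd_prod (hsub _ hi₀) q hq, ← hD] at hg₀
      have hk := kap_bound hR q.primeFactors D inter_subset_right
      have e : ∑ i ∈ UU R ×ˢ UU R with Nat.gcd (∏ p ∈ i.1 ∪ i.2, p) q = g,
          rho R i.1 * rho R i.2 / GG R ^ 2 * (g / (∏ p ∈ i.1 ∪ i.2, p : ℕ)) =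
          (∑ A ∈ UU R, ∑ B ∈ UU R, if (A ∪ B) ∩ q.primeFactors = D then
            rho R A * rho R B * ∏ p ∈ (A ∪ B) \ q.primeFactors, (1 / (p : ℝ)) else 0) / GG R ^ 2 := by
        rw [← sum_product', sum_filter, sum_div]
        refine sum_congr rfl fun i hi => ?_
        rw [gcd_prod (hsub i hi) q hq]
        have hiff : (∏ p ∈ (i.1 ∪ i.2) ∩ q.primeFactors, p = g) ↔ (i.1 ∪ i.2) ∩ q.primeFactors = D := by
          constructor
          · intro h
            exact prod_inj (R := R) (inter_subset_left.trans (hsub i hi))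
              (inter_subset_left.trans (hsub i₀ hi₀)) (by dsimp only; rw [h, hg₀])
          · intro h; rw [h, hg₀]
        by_cases h : (i.1 ∪ i.2) ∩ q.primeFactors = D
        · rw [if_pos (hiff.2 h), if_pos h]
          have hm : ((∏ p ∈ i.1 ∪ i.2, p : ℕ) : ℝ) = g * ∏ p ∈ (i.1 ∪ i.2) \ q.primeFactors, (p : ℝ) := by
            rw [← prod_inter_mul_prod_sdiff (i.1 ∪ i.2) q.primeFactors, h, hg₀]; push_cast; rfl
          have hg0 : (g : ℝ) ≠ 0 := by
            rw [← hg₀]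
            have : ∏ p ∈ D, p ≠ 0 := prod_ne_zero_iff.2 fun p hp => (mem_PP.1 (hsub i₀ hi₀ (mem_inter.1 hp).1)).2.ne_zero
            exact_mod_cast this
          rw [hm, prod_div_distrib, prod_const_one, ← div_div, div_self hg0]
          ring
        · rw [if_neg (fun h' => h (hiff.1 h')), if_neg h, zero_div]
      dsimp only
      rw [e, abs_div, abs_of_pos (a := GG R ^ 2) (by positivity), div_le_iff₀ (by positivity)]
      refine hk.trans (le_of_eq ?_)
      field_simp
    · push Not at hex
      rw [filter_false_of_mem hex, sum_empty, abs_zero]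
      positivity
  · intro q hq
    refine ⟨q.primeFactors.powerset.image fun S => ∏ p ∈ S, p, ?_, ?_, ?_⟩
    · exact card_image_le.trans (le_of_eq (card_powerset _))
    · intro g hg
      obtain ⟨S, hS, rfl⟩ := mem_image.1 hg
      rw [mem_powerset] at hS
      exact prod_primes_dvd _ (fun p hp => (Nat.prime_of_mem_primeFactors (hS hp)).prime)
        (fun p hp => Nat.dvd_of_mem_primeFactors (hS hp))
    · intro i hi
      dsimp only
      rw [gcd_prod (union_subset (mem_UU.1 (mem_product.1 hi).1).1 (mem_UU.1 (mem_product.1 hi).2).1) q hq]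
      exact mem_image.2 ⟨_, mem_powerset.2 inter_subset_right, rfl⟩

end VMV
end

noncomputable section
open Finset
namespace VMV

theorem abel (c φ : ℕ → ℂ) (N : ℕ) (B τ : ℝ) (hB : ∀ k ≤ N, ‖∑ n ∈ range k, c n‖ ≤ B)
    (hφ : ∀ n, ‖φ n‖ ≤ 1) (hτ : ∀ n < N, ‖φ (n + 1) - φ n‖ ≤ τ) :
    ‖∑ n ∈ range N, c n * φ n‖ ≤ B * (1 + N * τ) := by
  have hB0 : 0 ≤ B := (norm_nonneg _).trans (hB 0 (Nat.zero_le _))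
  have key : ∀ k ≤ N, ‖∑ n ∈ range k, c n * φ n - (∑ n ∈ range k, c n) * φ k‖ ≤ B * (k * τ) := by
    intro k
    induction k with
    | zero => intro _; simp
    | succ k ih =>
      intro hk
      have e : ∑ n ∈ range (k + 1), c n * φ n - (∑ n ∈ range (k + 1), c n) * φ (k + 1) =
          (∑ n ∈ range k, c n * φ n - (∑ n ∈ range k, c n) * φ k) -
          (∑ n ∈ range (k + 1), c n) * (φ (k + 1) - φ k) := by
        rw [sum_range_succ, sum_range_succ]; ring
      rw [e]
      refine (norm_sub_le _ _).trans ?_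
      rw [norm_mul]
      have h1 := ih (by omega)
      have h2 : ‖∑ n ∈ range (k + 1), c n‖ * ‖φ (k + 1) - φ k‖ ≤ B * τ := by
        gcongr
        · exact hB _ hk
        · exact hτ k (by omega)
      push_cast
      linarith
  have h1 := key N le_rfl
  have h2 := norm_sub_norm_le (∑ n ∈ range N, c n * φ n) ((∑ n ∈ range N, c n) * φ N)
  have h3 : ‖(∑ n ∈ range N, c n) * φ N‖ ≤ B * 1 := by
    rw [norm_mul]
    gcongr
    · exact hB N le_rfl
    · exact hφ N
  linarith

theorem cnt (M : ℕ) (hM : 1 ≤ M) (z : ℤ) (k : ℕ) :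
    |∑ n ∈ range k, (if (M : ℤ) ∣ (n : ℤ) - z then (1 : ℝ) else 0) - k / M| ≤ 1 := by
  have hM' : (0 : ℝ) < M := by exact_mod_cast hM
  have hM0 : (M : ℤ) ≠ 0 := by omega
  have hnn := Int.emod_nonneg z hM0
  have hlt := Int.emod_lt_of_pos z (show (0 : ℤ) < M by omega)
  obtain ⟨v, hv⟩ := Int.eq_ofNat_of_zero_le hnn
  have h1 : ∑ n ∈ range k, (if (M : ℤ) ∣ (n : ℤ) - z then (1 : ℝ) else 0) = (k.count (· ≡ v [MOD M]) : ℕ) := by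
    rw [sum_boole, Nat.count_eq_card_filter_range]
    refine congrArg _ (congrArg _ (filter_congr fun n _ => ?_))
    rw [← Int.natCast_modEq_iff, ← hv, Int.modEq_comm, Int.modEq_iff_dvd]
    have e : (n : ℤ) - z % M = ((n : ℤ) - z) + M * (z / M) := by
      have := Int.emod_add_mul_ediv z M
      linarith
    rw [e, dvd_add_left (Dvd.intro (z / M) rfl : (M : ℤ) ∣ M * (z / M))]
  have hvM : v < M := by omega
  rw [h1, Nat.count_modEq_card k hM v, Nat.mod_eq_of_lt hvM]
  have h2 : (k : ℝ) / M = (k / M : ℕ) + ((k % M : ℕ) : ℝ) / M := by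
    have h5 : (M : ℝ) * ((k / M : ℕ) : ℝ) + ((k % M : ℕ) : ℝ) = k := by exact_mod_cast Nat.div_add_mod k M
    rw [← h5]
    rw [add_div, mul_div_cancel_left₀ _ hM'.ne']
  have h3 : ((k % M : ℕ) : ℝ) / M ≤ 1 := by
    rw [div_le_one hM']; exact_mod_cast (Nat.mod_lt _ hM).le
  have h4 : 0 ≤ ((k % M : ℕ) : ℝ) / M := by positivity
  rw [h2]
  push_cast
  rw [abs_le]
  split_ifs <;> push_cast <;> constructor <;> linarith

theorem per_sum (c u : ℕ → ℂ) (q : ℕ) (hq : 1 ≤ q) (hc : ∀ n, c n = c (n % q)) (k : ℕ) :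
    ∑ n ∈ range k, c n * u n = ∑ x ∈ range q, c x * ∑ n ∈ range k, (if n % q = x then u n else 0) := by
  simp_rw [mul_sum]
  rw [sum_comm]
  refine sum_congr rfl fun n _ => ?_
  simp_rw [mul_ite, mul_zero]
  rw [sum_ite_eq, if_pos (mem_range.2 (Nat.mod_lt _ hq)), ← hc]

theorem mod_iff (q n x : ℕ) (hx : x < q) : n % q = x ↔ (q : ℤ) ∣ (n : ℤ) - x := by
  constructor
  · intro h
    rw [← h]
    have := Int.dvd_self_sub_emod (x := (n : ℤ)) (m := (q : ℤ))
    push_cast; exact this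
  · intro h
    have h2 : (x : ℤ) ≡ n [ZMOD q] := Int.modEq_iff_dvd.2 h
    rw [Int.natCast_modEq_iff] at h2
    have h3 : x % q = n % q := h2
    rw [← h3, Nat.mod_eq_of_lt hx]

theorem per_partial (c : ℕ → ℂ) (q : ℕ) (hq : 1 ≤ q) (hc : ∀ n, c n = c (n % q)) (hc1 : ∀ n, ‖c n‖ ≤ 1) (k : ℕ) :
    ‖∑ n ∈ range k, (c n - (∑ x ∈ range q, c x) / q)‖ ≤ q := by
  have h1 : ∑ n ∈ range k, (c n - (∑ x ∈ range q, c x) / q) =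
      ∑ x ∈ range q, c x * ((∑ n ∈ range k, (if n % q = x then (1 : ℂ) else 0)) - k / q) := by
    rw [sum_sub_distrib]
    have := per_sum c (fun _ => 1) q hq hc k
    simp only [mul_one] at this
    simp_rw [mul_sub]
    rw [this, sum_sub_distrib, ← sum_mul]
    simp
    ring
  rw [h1]
  refine (norm_sum_le _ _).trans ?_
  have : ∀ x ∈ range q, ‖c x * ((∑ n ∈ range k, (if n % q = x then (1 : ℂ) else 0)) - k / q)‖ ≤ 1 := by
    intro x hx
    rw [mem_range] at hx
    rw [norm_mul]
    have h2 := cnt q hq x k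
    have h3 : ‖((∑ n ∈ range k, (if n % q = x then (1 : ℂ) else 0)) - k / q)‖ ≤ 1 := by
      have e : ((∑ n ∈ range k, (if n % q = x then (1 : ℂ) else 0)) - k / q) =
          ((∑ n ∈ range k, (if (q : ℤ) ∣ (n : ℤ) - (x : ℤ) then (1 : ℝ) else 0) - k / q : ℝ) : ℂ) := by
        push_cast
        simp_rw [mod_iff q _ x hx]
        refine congrArg₂ _ (sum_congr rfl fun n _ => by split_ifs <;> simp) rfl
      rw [e, Complex.norm_real]; exact h2
    calc _ ≤ (1 : ℝ) * 1 := by gcongr; exact hc1 x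
      _ = 1 := by ring
  refine (sum_le_sum this).trans ?_
  simp

theorem gcd_class (q m : ℕ) (h x : ℤ) (hx : ((Nat.gcd m q : ℕ) : ℤ) ∣ x + h) :
    ∃ z : ℤ, ∀ n : ℤ, ((q : ℤ) ∣ n - x ∧ (m : ℤ) ∣ n + h) ↔ ((Nat.lcm m q : ℕ) : ℤ) ∣ n - z := by
  obtain ⟨y, hy⟩ := hx
  have hb := Nat.gcd_eq_gcd_ab m q
  refine ⟨x - q * (Nat.gcdB m q * y), fun n => ?_⟩
  have e1 : n - (x - q * (Nat.gcdB m q * y)) = (n - x) + q * (Nat.gcdB m q * y) := by ring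
  have e2 : n - (x - q * (Nat.gcdB m q * y)) = (n + h) - m * (Nat.gcdA m q * y) := by
    linear_combination (-1 : ℤ) * hy - y * hb
  have k1 : (q : ℤ) ∣ n - (x - q * (Nat.gcdB m q * y)) ↔ (q : ℤ) ∣ n - x := by
    rw [e1]; exact dvd_add_left (Dvd.intro _ rfl)
  have k2 : (m : ℤ) ∣ n - (x - q * (Nat.gcdB m q * y)) ↔ (m : ℤ) ∣ n + h := by
    rw [e2]; exact dvd_sub_left (Dvd.intro _ rfl)
  rw [← k1, ← k2, Int.natCast_dvd, Int.natCast_dvd, Int.natCast_dvd, Nat.lcm_dvd_iff]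
  tauto

end VMV
end

noncomputable section
open Finset
namespace VMV

def Sg {d : ℕ} (N : ℕ) (h : ℤ) (m : ℕ) (α : Fin d → ℝ) : ℂ :=
  ∑ n ∈ range N, if (m : ℤ) ∣ (n : ℤ) + h then ee (ph α n) else 0

theorem ph_add {d : ℕ} (α β : Fin d → ℝ) (x : ℤ) : ph (fun j => α j + β j) x = ph α x + ph β x := by
  unfold ph; rw [← sum_add_distrib]; exact sum_congr rfl fun j _ => by ring

theorem ph_scale {d : ℕ} (P : ℕ) (β : Fin d → ℝ) (x : ℕ) :
    ph (fun j => (P : ℝ) ^ ((j : ℕ) + 1) * β j) x = ph β ((P * x : ℕ) : ℤ) := by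
  unfold ph; refine sum_congr rfl fun j _ => ?_
  push_cast; ring

theorem pow_diff (k : ℕ) (x : ℝ) (hx : 0 ≤ x) : (x + 1) ^ (k + 1) - x ^ (k + 1) ≤ (k + 1) * (x + 1) ^ k := by
  induction k with
  | zero => simp
  | succ k ih =>
    have e : (x + 1) ^ (k + 1 + 1) - x ^ (k + 1 + 1) = (x + 1) ^ (k + 1) + x * ((x + 1) ^ (k + 1) - x ^ (k + 1)) := by ring
    rw [e]
    have h1 : x * ((x + 1) ^ (k + 1) - x ^ (k + 1)) ≤ x * ((k + 1) * (x + 1) ^ k) := by gcongr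
    have h2 : x * ((k + 1) * (x + 1) ^ k) ≤ (x + 1) * ((k + 1) * (x + 1) ^ k) := by gcongr; linarith
    push_cast
    have e2 : (x + 1) * ((k + 1) * (x + 1) ^ k) = (k + 1) * (x + 1) ^ (k + 1) := by ring
    nlinarith

theorem var {d : ℕ} (N : ℕ) (hN : 1 ≤ N) (β : Fin d → ℝ) (B : ℝ)
    (hβ : ∀ j : Fin d, |β j| ≤ B / (N : ℝ) ^ ((j : ℕ) + 1)) (n : ℕ) (hn : n < N) :
    ‖ee (ph β ((n + 1 : ℕ) : ℤ)) - ee (ph β n)‖ ≤ 7 * d ^ 2 * B / N := by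
  have hN0 : (0 : ℝ) < N := by exact_mod_cast hN
  have hnN : (n : ℝ) + 1 ≤ N := by exact_mod_cast hn
  refine (ee_sub_le _ _).trans ?_
  have h1 : |ph β ((n + 1 : ℕ) : ℤ) - ph β n| ≤ ∑ j : Fin d, d * B / N := by
    unfold ph
    rw [← sum_sub_distrib]
    refine (abs_sum_le_sum_abs _ _).trans (sum_le_sum fun j _ => ?_)
    have hj : ((j : ℕ) : ℝ) + 1 ≤ d := by exact_mod_cast j.2
    have hB : 0 ≤ B := by
      have := (abs_nonneg _).trans (hβ j)
      by_contra hB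
      push Not at hB
      exact absurd this (not_le.2 (div_neg_of_neg_of_pos hB (by positivity)))
    rw [← mul_sub, abs_mul]
    push_cast
    have h0 : 0 ≤ ((n : ℝ) + 1) ^ ((j : ℕ) + 1) - (n : ℝ) ^ ((j : ℕ) + 1) := by
      rw [sub_nonneg]; gcongr; linarith
    rw [abs_of_nonneg h0]
    calc _ ≤ B / (N : ℝ) ^ ((j : ℕ) + 1) * ((((j : ℕ) : ℝ) + 1) * ((n : ℝ) + 1) ^ (j : ℕ)) := by
          exact mul_le_mul (hβ j) (pow_diff _ _ (by positivity)) h0 (by positivity)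
      _ ≤ B / (N : ℝ) ^ ((j : ℕ) + 1) * (d * (N : ℝ) ^ (j : ℕ)) := by
          gcongr
      _ = _ := by rw [pow_succ]; field_simp
  have h2 : ∑ j : Fin d, (d * B / N : ℝ) = d ^ 2 * B / N := by simp; ring
  rw [h2] at h1
  have hpi : 2 * Real.pi ≤ 7 := by linarith [Real.pi_lt_d2]
  have h3 : 0 ≤ d ^ 2 * B / N := (abs_nonneg _).trans h1
  calc 2 * Real.pi * |ph β ((n + 1 : ℕ) : ℤ) - ph β n| ≤ 7 * (d ^ 2 * B / N) := by
        exact mul_le_mul hpi h1 (abs_nonneg _) (by norm_num)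
    _ = _ := by ring

theorem ee_per {d : ℕ} (q : ℕ) (hq : 1 ≤ q) (a : Fin d → ℤ) (n : ℕ) :
    ee (ph (fun j => (a j : ℝ) / q) n) = ee (ph (fun j => (a j : ℝ) / q) ((n % q : ℕ) : ℤ)) := by
  have hq0 : (q : ℝ) ≠ 0 := by positivity
  have e : ∀ x : ℤ, ph (fun j => (a j : ℝ) / q) x = ((∑ j, a j * x ^ ((j : ℕ) + 1) : ℤ) : ℝ) / q := by
    intro x; unfold ph; push_cast; rw [sum_div]; exact sum_congr rfl fun j _ => by ring
  have hd : (q : ℤ) ∣ (∑ j, a j * (n : ℤ) ^ ((j : ℕ) + 1)) - ∑ j, a j * ((n % q : ℕ) : ℤ) ^ ((j : ℕ) + 1) := by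
    rw [← sum_sub_distrib]
    refine dvd_sum fun j _ => ?_
    rw [← mul_sub]
    refine dvd_mul_of_dvd_right (dvd_trans ?_ (sub_dvd_pow_sub_pow _ _ _)) _
    exact (mod_iff q n (n % q) (Nat.mod_lt _ hq)).1 rfl
  obtain ⟨z, hz⟩ := hd
  have e2 : ph (fun j => (a j : ℝ) / q) n = ph (fun j => (a j : ℝ) / q) ((n % q : ℕ) : ℤ) + z := by
    rw [e, e, sub_eq_iff_eq_add.1 hz]
    push_cast
    field_simp
    ring
  rw [e2, ee_add_int]

theorem arc_m_partial (E : ℕ → ℂ) (q m : ℕ) (h : ℤ) (hq : 1 ≤ q) (hm : 1 ≤ m)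
    (hper : ∀ n, E n = E (n % q)) (hE1 : ∀ n, ‖E n‖ ≤ 1) (k : ℕ) :
    ‖∑ n ∈ range k, E n * (((if (m : ℤ) ∣ (n : ℤ) + h then (1 : ℝ) else 0) -
      ((Nat.gcd m q : ℕ) : ℝ) / m * (if ((Nat.gcd m q : ℕ) : ℤ) ∣ (n : ℤ) + h then (1 : ℝ) else 0) : ℝ) : ℂ)‖ ≤ 2 * q := by
  obtain ⟨g, hg⟩ : ∃ g, g = Nat.gcd m q := ⟨_, rfl⟩
  rw [← hg]
  have hgq : g ∣ q := hg ▸ Nat.gcd_dvd_right _ _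
  have hgm : g ∣ m := hg ▸ Nat.gcd_dvd_left _ _
  have hm0 : (0 : ℝ) < m := by positivity
  have hg1 : (g : ℝ) / m ≤ 1 := by
    rw [div_le_one hm0]; exact_mod_cast Nat.le_of_dvd hm hgm
  rw [per_sum E _ q hq hper k]
  refine (norm_sum_le _ _).trans ?_
  have key : ∀ x ∈ range q, ‖E x * ∑ n ∈ range k, (if n % q = x then (((if (m : ℤ) ∣ (n : ℤ) + h then (1 : ℝ) else 0) -
      (g : ℝ) / m * (if (g : ℤ) ∣ (n : ℤ) + h then (1 : ℝ) else 0) : ℝ) : ℂ) else 0)‖ ≤ 2 := by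
    intro x hx
    rw [mem_range] at hx
    rw [norm_mul]
    have h3 : ‖∑ n ∈ range k, (if n % q = x then (((if (m : ℤ) ∣ (n : ℤ) + h then (1 : ℝ) else 0) -
      (g : ℝ) / m * (if (g : ℤ) ∣ (n : ℤ) + h then (1 : ℝ) else 0) : ℝ) : ℂ) else 0)‖ ≤ 2 := by
      have e : ∑ n ∈ range k, (if n % q = x then (((if (m : ℤ) ∣ (n : ℤ) + h then (1 : ℝ) else 0) -
          (g : ℝ) / m * (if (g : ℤ) ∣ (n : ℤ) + h then (1 : ℝ) else 0) : ℝ) : ℂ) else 0) =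
          ((∑ n ∈ range k, (if (q : ℤ) ∣ (n : ℤ) - (x : ℤ) then ((if (m : ℤ) ∣ (n : ℤ) + h then (1 : ℝ) else 0) -
          (g : ℝ) / m * (if (g : ℤ) ∣ (n : ℤ) + h then (1 : ℝ) else 0) : ℝ) else 0) : ℝ) : ℂ) := by
        rw [Complex.ofReal_sum]
        refine sum_congr rfl fun n _ => ?_
        simp only [mod_iff q n x hx]
        split_ifs <;> simp
      rw [e, Complex.norm_real, Real.norm_eq_abs]
      have hgn : ∀ n : ℤ, (q : ℤ) ∣ n - x → ((g : ℤ) ∣ n + h ↔ (g : ℤ) ∣ x + h) := by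
        intro n hn
        have h1 : (g : ℤ) ∣ n - x := dvd_trans (by exact_mod_cast hgq) hn
        have : n + h = (x + h) + (n - x) := by ring
        rw [this, dvd_add_left h1]
      have hmg : ∀ n : ℤ, (m : ℤ) ∣ n → (g : ℤ) ∣ n := fun n hn => dvd_trans (by exact_mod_cast hgm) hn
      by_cases hxh : (g : ℤ) ∣ x + h
      · obtain ⟨z, hz⟩ := gcd_class q m h x (hg ▸ hxh)
        have e2 : ∑ n ∈ range k, (if (q : ℤ) ∣ (n : ℤ) - (x : ℤ) then ((if (m : ℤ) ∣ (n : ℤ) + h then (1 : ℝ) else 0) -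
          (g : ℝ) / m * (if (g : ℤ) ∣ (n : ℤ) + h then (1 : ℝ) else 0) : ℝ) else 0) =
          (∑ n ∈ range k, (if ((Nat.lcm m q : ℕ) : ℤ) ∣ (n : ℤ) - z then (1 : ℝ) else 0)) -
          (g : ℝ) / m * ∑ n ∈ range k, (if (q : ℤ) ∣ (n : ℤ) - (x : ℤ) then (1 : ℝ) else 0) := by
          rw [mul_sum, ← sum_sub_distrib]
          refine sum_congr rfl fun n _ => ?_
          by_cases c1 : (q : ℤ) ∣ (n : ℤ) - (x : ℤ)
          · have c2 := (hgn n c1).2 hxh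
            rw [if_pos c1, if_pos c1, if_pos c2]
            simp only [← hz, c1, true_and]
          · rw [if_neg c1, if_neg c1, if_neg (fun h' => c1 ((hz n).2 h').1)]; ring
        rw [e2]
        have hl : 1 ≤ Nat.lcm m q := Nat.lcm_pos hm hq
        have k1 := cnt (Nat.lcm m q) hl z k
        have k2 := cnt q hq x k
        have e3 : (k : ℝ) / (Nat.lcm m q : ℕ) = (g : ℝ) / m * (k / q) := by
          have : (g : ℝ) * (Nat.lcm m q : ℕ) = m * q := by rw [hg]; exact_mod_cast Nat.gcd_mul_lcm m q
          have hl0 : ((Nat.lcm m q : ℕ) : ℝ) ≠ 0 := by positivity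
          have hq0 : (q : ℝ) ≠ 0 := by positivity
          rw [div_mul_div_comm, ← this, mul_comm (g : ℝ) k, mul_comm (g : ℝ)]
          rw [mul_div_mul_right]
          intro h0
          rw [h0, zero_mul] at this
          have : (m : ℝ) * q > 0 := by positivity
          linarith
        have hgn0 : 0 ≤ (g : ℝ) / m := by positivity
        have k3 : |(g : ℝ) / m * ∑ n ∈ range k, (if (q : ℤ) ∣ (n : ℤ) - (x : ℤ) then (1 : ℝ) else 0) - (g : ℝ) / m * (k / q)| ≤ 1 := by
          rw [← mul_sub, abs_mul, abs_of_nonneg hgn0]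
          calc _ ≤ (1 : ℝ) * 1 := by gcongr
            _ = 1 := by ring
        rw [e3] at k1
        rw [abs_le] at *
        constructor <;> linarith [k1.1, k1.2, k3.1, k3.2]
      · have : ∀ n ∈ range k, (if (q : ℤ) ∣ (n : ℤ) - (x : ℤ) then ((if (m : ℤ) ∣ (n : ℤ) + h then (1 : ℝ) else 0) -
          (g : ℝ) / m * (if (g : ℤ) ∣ (n : ℤ) + h then (1 : ℝ) else 0) : ℝ) else 0) = 0 := by
          intro n _
          by_cases c1 : (q : ℤ) ∣ (n : ℤ) - (x : ℤ)
          · have c2 : ¬ (g : ℤ) ∣ (n : ℤ) + h := fun h' => hxh ((hgn n c1).1 h')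
            rw [if_pos c1, if_neg c2, if_neg (fun h' => c2 (hmg _ h'))]; ring
          · rw [if_neg c1]
        rw [sum_eq_zero this, abs_zero]; norm_num
    calc _ ≤ (1 : ℝ) * 2 := by gcongr; exact hE1 x
      _ = 2 := by ring
  refine (sum_le_sum key).trans ?_
  simp [mul_comm]

theorem block (φ : ℕ → ℂ) (P N' : ℕ) (τ : ℝ) (hτ : ∀ n < P * N', ‖φ (n + 1) - φ n‖ ≤ τ) :
    ‖∑ n ∈ range (P * N'), φ n - P * ∑ n ∈ range N', φ (P * n)‖ ≤ N' * (P * (P * τ)) := by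
  have step : ∀ n s, P * n + s ≤ P * N' → ‖φ (P * n + s) - φ (P * n)‖ ≤ s * τ := by
    intro n s
    induction s with
    | zero => intro _; simp
    | succ s ih =>
      intro hs
      have h1 := ih (by omega)
      have h2 := hτ (P * n + s) (by omega)
      have e : φ (P * n + (s + 1)) - φ (P * n) = (φ (P * n + s + 1) - φ (P * n + s)) + (φ (P * n + s) - φ (P * n)) := by
        rw [← add_assoc]; ring
      rw [e]
      refine (norm_add_le _ _).trans ?_
      push_cast; linarith
  have key : ∀ k ≤ N', ‖∑ n ∈ range (P * k), φ n - P * ∑ n ∈ range k, φ (P * n)‖ ≤ k * (P * (P * τ)) := by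
    intro k
    induction k with
    | zero => intro _; simp
    | succ k ih =>
      intro hk
      have h1 := ih (by omega)
      have hk2 : P * k + P ≤ P * N' := by
        calc P * k + P = P * (k + 1) := by ring
          _ ≤ _ := Nat.mul_le_mul_left _ hk
      rw [mul_add, mul_one, sum_range_add, sum_range_succ]
      have e : ∑ n ∈ range (P * k), φ n + ∑ x ∈ range P, φ (P * k + x) - P * (∑ n ∈ range k, φ (P * n) + φ (P * k)) =
         (∑ n ∈ range (P * k), φ n - P * ∑ n ∈ range k, φ (P * n)) + ∑ x ∈ range P, (φ (P * k + x) - φ (P * k)) := by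
        rw [sum_sub_distrib]; simp; ring
      rw [e]
      refine (norm_add_le _ _).trans ?_
      have h2 : ‖∑ x ∈ range P, (φ (P * k + x) - φ (P * k))‖ ≤ ∑ x ∈ range P, P * τ := by
        refine (norm_sum_le _ _).trans (sum_le_sum fun s hs => ?_)
        rw [mem_range] at hs
        refine (step k s (by omega)).trans ?_
        have : 0 ≤ τ := (norm_nonneg _).trans (hτ (P * k) (by omega))
        gcongr
      rw [sum_const, card_range, nsmul_eq_mul] at h2
      push_cast; linarith
  exact key N' le_rfl

section arcs

theorem Sg_split {d : ℕ} (N : ℕ) (h : ℤ) (q : ℕ) (a : Fin d → ℤ) (β : Fin d → ℝ) (g : ℕ) : Sg N h g (fun j => (a j : ℝ) / q + β j) =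
    ∑ n ∈ range N, (ee (ph (fun j => (a j : ℝ) / q) n) * ((if (g : ℤ) ∣ (n : ℤ) + h then (1 : ℝ) else 0 : ℝ) : ℂ)) * ee (ph β n) := by
  unfold Sg
  refine sum_congr rfl fun n _ => ?_
  rw [ph_add, ee_add]
  split_ifs <;> simp

theorem arc_m {d : ℕ} (N : ℕ) (hN : 1 ≤ N) (h : ℤ) (q : ℕ) (hq : 1 ≤ q) (a : Fin d → ℤ) (β : Fin d → ℝ) (B : ℝ)
    (hβ : ∀ j : Fin d, |β j| ≤ B / (N : ℝ) ^ ((j : ℕ) + 1)) (m : ℕ) (hm : 1 ≤ m) :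
    ‖Sg N h m (fun j => (a j : ℝ) / q + β j) -
      (((Nat.gcd m q : ℕ) : ℝ) / m : ℝ) * Sg N h (Nat.gcd m q) (fun j => (a j : ℝ) / q + β j)‖ ≤
      2 * q * (1 + 7 * d ^ 2 * B) := by
  have hN0 : (0 : ℝ) < N := by positivity
  rw [Sg_split, Sg_split, mul_sum, ← sum_sub_distrib]
  have hp := arc_m_partial (fun n => ee (ph (fun j => (a j : ℝ) / q) n)) q m h hq hm (fun n => ee_per q hq a n)
    (fun n => (norm_ee _).le)
  have := abel _ (fun n => ee (ph β n)) N (2 * q) (7 * d ^ 2 * B / N) (fun k _ => hp k) (fun n => (norm_ee _).le)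
    (fun n hn => by have := var N hN β B hβ n hn; exact_mod_cast this)
  have e : (N : ℝ) * (7 * d ^ 2 * B / N) = 7 * d ^ 2 * B := by field_simp
  rw [e] at this
  refine le_trans (le_of_eq ?_) this
  congr 1
  refine sum_congr rfl fun n _ => ?_
  push_cast
  ring

theorem arc_scale {d : ℕ} (N : ℕ) (h : ℤ) (q : ℕ) (hq : 1 ≤ q) (a : Fin d → ℤ) (β : Fin d → ℝ) (B : ℝ)
    (P N' : ℕ) (hP : 1 ≤ P) (hN' : 1 ≤ N') (hNP : N = P * N') (hB : 0 ≤ B)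
    (hβ : ∀ j : Fin d, |β j| ≤ B / (N : ℝ) ^ ((j : ℕ) + 1)) (g : ℕ) (hg : g ∣ q) :
    ‖Sg N h g (fun j => (a j : ℝ) / q + β j) -
      P * Sg N' h g (fun j => (a j : ℝ) / q + (P : ℝ) ^ ((j : ℕ) + 1) * β j)‖ ≤
      3 * P * q * (1 + 7 * d ^ 2 * B) := by
  have hN : 1 ≤ N := by rw [hNP]; exact Nat.mul_pos hP hN'
  have hN0 : (0 : ℝ) < N := by positivity
  have hN'0 : (0 : ℝ) < N' := by positivity
  have hP0 : (1 : ℝ) ≤ P := by exact_mod_cast hP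
  have hq0 : (1 : ℝ) ≤ q := by exact_mod_cast hq
  have hV : 0 ≤ 7 * d ^ 2 * B := by positivity
  rw [Sg_split, Sg_split]
  obtain ⟨c, hc⟩ : ∃ c : ℕ → ℂ, c = fun n : ℕ => ee (ph (fun j => (a j : ℝ) / q) n) * ((if (g : ℤ) ∣ (n : ℤ) + h then (1 : ℝ) else 0 : ℝ) : ℂ) := ⟨_, rfl⟩
  have hc' : ∀ n : ℕ, ee (ph (fun j => (a j : ℝ) / q) n) * ((if (g : ℤ) ∣ (n : ℤ) + h then (1 : ℝ) else 0 : ℝ) : ℂ) = c n := fun n => by rw [hc]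
  simp_rw [hc', ph_scale]
  have hper : ∀ n, c n = c (n % q) := by
    intro n
    rw [hc]
    dsimp only
    rw [ee_per q hq a n]
    congr 2
    have h1 : (g : ℤ) ∣ (n : ℤ) - ((n % q : ℕ) : ℤ) :=
      dvd_trans (by exact_mod_cast hg) ((mod_iff q n (n % q) (Nat.mod_lt _ hq)).1 rfl)
    have h2 : (n : ℤ) + h = (((n % q : ℕ) : ℤ) + h) + ((n : ℤ) - ((n % q : ℕ) : ℤ)) := by ring
    have h3 : (g : ℤ) ∣ (n : ℤ) + h ↔ (g : ℤ) ∣ ((n % q : ℕ) : ℤ) + h := by rw [h2, dvd_add_left h1]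
    simp only [h3]
  have hc1 : ∀ n, ‖c n‖ ≤ 1 := by
    intro n
    rw [hc]
    dsimp only
    rw [norm_mul, norm_ee, one_mul]
    split_ifs <;> simp
  have hcm : ‖(∑ x ∈ range q, c x) / q‖ ≤ 1 := by
    rw [norm_div, Complex.norm_natCast, div_le_one (by linarith)]
    refine (norm_sum_le _ _).trans ((sum_le_sum fun x _ => hc1 x).trans ?_)
    simp
  obtain ⟨cm, hcmd⟩ : ∃ cm, cm = (∑ x ∈ range q, c x) / q := ⟨_, rfl⟩
  have hpp := per_partial c q hq hper hc1
  rw [← hcmd] at hcm hpp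
  have hvar := var N hN β B hβ
  have a1 := abel _ (fun n => ee (ph β n)) N q (7 * d ^ 2 * B / N) (fun k _ => hpp k) (fun n => (norm_ee _).le)
    (fun n hn => by have := hvar n hn; exact_mod_cast this)
  have hβ' : ∀ j : Fin d, |(P : ℝ) ^ ((j : ℕ) + 1) * β j| ≤ B / (N' : ℝ) ^ ((j : ℕ) + 1) := by
    intro j
    rw [abs_mul, abs_of_nonneg (by positivity)]
    calc _ ≤ (P : ℝ) ^ ((j : ℕ) + 1) * (B / (N : ℝ) ^ ((j : ℕ) + 1)) := by gcongr; exact hβ j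
      _ = _ := by rw [hNP]; push_cast; rw [mul_pow]; field_simp
  have a2 := abel _ (fun n : ℕ => ee (ph β ((P * n : ℕ) : ℤ))) N' q (7 * d ^ 2 * B / N') (fun k _ => hpp k) (fun n => (norm_ee _).le)
    (fun n hn => by have := var N' hN' _ B hβ' n hn; rw [ph_scale, ph_scale] at this; exact_mod_cast this)
  have a3 := block (fun n => ee (ph β n)) P N' (7 * d ^ 2 * B / N) (fun n hn => by
    have := hvar n (hNP ▸ hn); exact_mod_cast this)
  have e1 : (N : ℝ) * (7 * d ^ 2 * B / N) = 7 * d ^ 2 * B := by field_simp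
  have e2 : (N' : ℝ) * (7 * d ^ 2 * B / N') = 7 * d ^ 2 * B := by field_simp
  have e3 : (N' : ℝ) * (P * (P * (7 * d ^ 2 * B / N))) = P * (7 * d ^ 2 * B) := by
    rw [hNP]; push_cast; field_simp
  rw [e1] at a1
  rw [e2] at a2
  rw [e3, ← hNP] at a3
  have e : ∑ n ∈ range N, c n * ee (ph β n) - P * ∑ n ∈ range N', c n * ee (ph β ((P * n : ℕ) : ℤ)) =
     ∑ n ∈ range N, (c n - cm) * ee (ph β n) - P * ∑ n ∈ range N', (c n - cm) * ee (ph β ((P * n : ℕ) : ℤ)) +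
      cm * (∑ n ∈ range N, ee (ph β n) - P * ∑ n ∈ range N', ee (ph β ((P * n : ℕ) : ℤ))) := by
    simp_rw [sub_mul, sum_sub_distrib, ← mul_sum]
    ring
  rw [e]
  have b1 : ‖(P : ℂ) * ∑ n ∈ range N', (c n - cm) * ee (ph β ((P * n : ℕ) : ℤ))‖ ≤ P * (q * (1 + 7 * d ^ 2 * B)) := by
    rw [norm_mul, Complex.norm_natCast]; gcongr
  have b2 : ‖cm * (∑ n ∈ range N, ee (ph β n) - P * ∑ n ∈ range N', ee (ph β ((P * n : ℕ) : ℤ)))‖ ≤ 1 * (P * (7 * d ^ 2 * B)) := by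
    rw [norm_mul]; gcongr
  refine (norm_add_le _ _).trans ((add_le_add_left (norm_sub_le _ _) _).trans ?_)
  obtain ⟨V, hVd⟩ : ∃ V, V = 7 * d ^ 2 * B := ⟨_, rfl⟩
  rw [← hVd] at a1 b1 b2 hV ⊢
  have c1 : q * (1 + V) ≤ P * (q * (1 + V)) := le_mul_of_one_le_left (by positivity) hP0
  have c2 : 1 * (P * V) ≤ P * (q * (1 + V)) := by
    rw [one_mul]
    gcongr
    nlinarith
  linarith
end arcs

end VMV
end

noncomputable section
open Finset
namespace VMV

theorem om_bound (c : ℕ) : ∃ C1 : ℕ, 1 ≤ C1 ∧ ∀ q : ℕ, 1 ≤ q → c ^ q.primeFactors.card ≤ C1 * q := by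
  refine ⟨(c + 1) ^ (c + 1), Nat.one_le_pow _ _ (by omega), fun q hq => ?_⟩
  have h1 : ∏ p ∈ q.primeFactors, p ≤ q := Nat.le_of_dvd hq (Nat.prod_primeFactors_dvd q)
  have h2 : (c + 1) ^ q.primeFactors.card = (c + 1) ^ (q.primeFactors.filter (fun p => p ≤ c)).card *
      (c + 1) ^ (q.primeFactors.filter (fun p => ¬ p ≤ c)).card := by
    rw [← pow_add, card_filter_add_card_filter_not]
  have h3 : (q.primeFactors.filter (fun p => p ≤ c)).card ≤ c + 1 := by
    refine (card_le_card (t := range (c + 1)) fun p hp => ?_).trans (by simp)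
    rw [mem_filter] at hp
    rw [mem_range]; omega
  have h4 : (c + 1) ^ (q.primeFactors.filter (fun p => ¬ p ≤ c)).card ≤ q := by
    refine le_trans ?_ h1
    calc _ = ∏ p ∈ q.primeFactors.filter (fun p => ¬ p ≤ c), (c + 1) := by rw [prod_const]
      _ ≤ ∏ p ∈ q.primeFactors.filter (fun p => ¬ p ≤ c), p := by
          refine prod_le_prod' fun p hp => ?_
          rw [mem_filter] at hp; omega
      _ ≤ _ := by
          refine prod_le_prod_of_subset_of_one_le' (filter_subset _ _) fun p hp _ => ?_
          exact (Nat.prime_of_mem_primeFactors hp).one_le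
  calc c ^ q.primeFactors.card ≤ (c + 1) ^ q.primeFactors.card := Nat.pow_le_pow_left (by omega) _
    _ ≤ _ := by
      rw [h2]
      exact Nat.mul_le_mul (Nat.pow_le_pow_right (by omega) h3) h4

theorem reduce_frac {d : ℕ} (q1 : ℕ) (hq1 : 1 ≤ q1) (a : Fin d → ℤ) : ∃ q : ℕ, 1 ≤ q ∧ q ≤ q1 ∧
    (∃ a' : Fin d → ℤ, ∀ j, (a j : ℝ) / q1 = a' j / q) ∧
    ∀ (q3 : ℕ) (a3 : Fin d → ℤ), 1 ≤ q3 → (∀ j, (a j : ℝ) / q1 = a3 j / q3) → q ∣ q3 := by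
  classical
  have hex : ∃ n : ℕ, 1 ≤ n ∧ ∀ j, (q1 : ℤ) ∣ n * a j := ⟨q1, hq1, fun j => Dvd.intro _ rfl⟩
  have hq10 : (q1 : ℝ) ≠ 0 := by positivity
  refine ⟨Nat.find hex, (Nat.find_spec hex).1, Nat.find_min' hex ⟨hq1, fun j => Dvd.intro _ rfl⟩, ?_, ?_⟩
  · have h := (Nat.find_spec hex).2
    choose z hz using h
    refine ⟨z, fun j => ?_⟩
    have h1 : ((Nat.find hex : ℕ) : ℝ) ≠ 0 := by have := (Nat.find_spec hex).1; positivity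
    rw [div_eq_div_iff hq10 h1]
    have := hz j
    have h2 : ((Nat.find hex : ℕ) : ℝ) * a j = q1 * z j := by exact_mod_cast this
    linarith
  · intro q3 a3 hq3 h
    obtain ⟨q, hq⟩ : ∃ q, q = Nat.find hex := ⟨_, rfl⟩
    rw [← hq]
    have hs := Nat.find_spec hex
    rw [← hq] at hs
    by_contra hnd
    have hlt : q3 % q < q := Nat.mod_lt _ hs.1
    have hpos : 1 ≤ q3 % q := Nat.pos_of_ne_zero fun h0 => hnd (Nat.dvd_of_mod_eq_zero h0)
    have := Nat.find_min hex (m := q3 % q) (lt_of_lt_of_eq hlt hq)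
    refine this ⟨hpos, fun j => ?_⟩
    have hq30 : (q3 : ℝ) ≠ 0 := by positivity
    have h1 := h j
    rw [div_eq_div_iff hq10 hq30] at h1
    have h2 : a j * q3 = a3 j * q1 := by exact_mod_cast h1
    have h3 : ((q3 % q : ℕ) : ℤ) = q3 - q * (q3 / q : ℕ) := by
      have := Nat.mod_add_div q3 q
      have : ((q3 % q : ℕ) : ℤ) + q * (q3 / q : ℕ) = q3 := by exact_mod_cast this
      linarith
    rw [h3, sub_mul]
    refine dvd_sub ⟨a3 j, by linarith⟩ ?_
    have := hs.2 j
    have e : (q : ℤ) * (q3 / q : ℕ) * a j = (q3 / q : ℕ) * (q * a j) := by ring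
    rw [e]
    exact dvd_mul_of_dvd_right this _

theorem ind_eq (m : ℕ) (hm : 1 ≤ m) (u : ℤ) :
    (if (m : ℤ) ∣ u then (1 : ℂ) else 0) = (m : ℂ)⁻¹ * ∑ b ∈ range m, ee (b / m * u) := by
  have := sum_ee_div m hm u
  rw [this]
  have : (m : ℂ) ≠ 0 := by exact_mod_cast (by omega : m ≠ 0)
  split_ifs
  · field_simp
  · simp

theorem Sg_cross (d : ℕ) (hd : 1 ≤ d) : ∃ C : ℕ, ∀ (α : Fin d → ℝ) (N : ℕ) (h : ℤ) (m : ℕ) (T : ℝ), 1 ≤ N → 1 ≤ m →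
    2 ≤ T → (N : ℝ) / T ≤ ‖Sg N h m α‖ →
    ∃ q : ℕ, 1 ≤ q ∧ (q : ℝ) ≤ T ^ C * m ∧ ∃ a : Fin d → ℤ, ∀ j : Fin d,
      |α j - a j / q| ≤ T ^ C / (N : ℝ) ^ ((j : ℕ) + 1) := by
  obtain ⟨C, hC⟩ := weyl_inv d
  refine ⟨C, fun α N h m T hN hm hT hS => ?_⟩
  have hm0 : (0 : ℝ) < m := by positivity
  let cf : ℕ → ℕ → ℝ := fun b j => (if hj : 1 ≤ j ∧ j ≤ d then α ⟨j - 1, by omega⟩ else 0) + if j = 1 then (b : ℝ) / m else 0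
  have hcf : ∀ b n : ℕ, pe (cf b) d n = ph α n + b / m * n := by
    intro b n
    unfold pe ph
    rw [sum_range_succ', ← Fin.sum_univ_eq_sum_range (fun j => cf b (j + 1) * (n : ℝ) ^ (j + 1))]
    have e0 : cf b 0 = 0 := by simp [cf]
    rw [e0, zero_mul, add_zero]
    have : ∀ j : Fin d, cf b ((j : ℕ) + 1) * (n : ℝ) ^ ((j : ℕ) + 1) =
        α j * (((n : ℕ) : ℤ) : ℝ) ^ ((j : ℕ) + 1) + if j = ⟨0, by omega⟩ then (b : ℝ) / m * n else 0 := by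
      intro j
      have hj := j.2
      simp only [cf]
      rw [dif_pos ⟨by omega, by omega⟩]
      by_cases h0 : (j : ℕ) = 0
      · have : j = ⟨0, by omega⟩ := Fin.ext h0
        rw [if_pos (by omega), if_pos this]
        have e3 : (⟨(j : ℕ) + 1 - 1, by omega⟩ : Fin d) = j := Fin.ext (by simp)
        rw [e3, h0]; push_cast; ring
      · have : j ≠ ⟨0, by omega⟩ := fun h' => h0 (by rw [h'])
        simp [this, h0]
    rw [sum_congr rfl fun j _ => this j, sum_add_distrib, sum_ite_eq' univ]
    simp
  have e : Sg N h m α = (m : ℂ)⁻¹ * ∑ b ∈ range m, ee (b / m * h) * ∑ n ∈ range N, ee (pe (cf b) d n) := by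
    unfold Sg
    simp_rw [mul_sum]
    rw [sum_comm]
    refine sum_congr rfl fun n _ => ?_
    have h1 := ind_eq m hm ((n : ℤ) + h)
    have h2 : (if (m : ℤ) ∣ (n : ℤ) + h then ee (ph α n) else 0) = (if (m : ℤ) ∣ (n : ℤ) + h then (1 : ℂ) else 0) * ee (ph α n) := by
      split_ifs <;> simp
    rw [h2, h1, mul_assoc, sum_mul, mul_sum]
    refine sum_congr rfl fun b _ => ?_
    rw [← ee_add, ← ee_add, hcf]
    congr 2
    push_cast; ring
  have hb : ∃ b ∈ range m, (N : ℝ) / T ≤ ‖∑ n ∈ range N, ee (pe (cf b) d n)‖ := by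
    by_contra hcon
    push Not at hcon
    have h1 : ‖Sg N h m α‖ < N / T := by
      rw [e, norm_mul, norm_inv, Complex.norm_natCast, inv_mul_lt_iff₀ hm0]
      calc _ ≤ ∑ b ∈ range m, ‖∑ n ∈ range N, ee (pe (cf b) d n)‖ := by
            refine (norm_sum_le _ _).trans (sum_le_sum fun b _ => ?_)
            rw [norm_mul, norm_ee, one_mul]
        _ < ∑ b ∈ range m, (N : ℝ) / T := sum_lt_sum_of_nonempty ⟨0, mem_range.2 hm⟩ hcon
        _ = _ := by simp
    linarith
  obtain ⟨b, -, hb⟩ := hb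
  obtain ⟨q, hq, hqT, hq2⟩ := hC (cf b) N hN T hT hb
  have hq0 : (0 : ℝ) < q := by positivity
  have hq1 : (1 : ℝ) ≤ q := by exact_mod_cast hq
  refine ⟨q * m, Nat.mul_pos hq hm, by push_cast; gcongr, fun j => round (q * cf b ((j : ℕ) + 1)) * m - if (j : ℕ) = 0 then (q : ℤ) * b else 0, fun j => ?_⟩
  have h1 := hq2 ((j : ℕ) + 1) (by omega) j.2
  unfold nn at h1
  have hj := j.2
  have e1 : α j = cf b ((j : ℕ) + 1) - if (j : ℕ) = 0 then (b : ℝ) / m else 0 := by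
    simp only [cf]
    rw [dif_pos ⟨by omega, by omega⟩]
    simp
  have e2 : α j - (((round (q * cf b ((j : ℕ) + 1)) * m - if (j : ℕ) = 0 then (q : ℤ) * b else 0 : ℤ) : ℝ)) / ((q * m : ℕ) : ℝ) =
      (q * cf b ((j : ℕ) + 1) - round (q * cf b ((j : ℕ) + 1))) / q := by
    rw [e1]
    push_cast
    split_ifs <;> field_simp <;> push_cast <;> ring
  dsimp only
  rw [e2, abs_div, abs_of_pos hq0]
  refine (div_le_self (abs_nonneg _) hq1).trans ?_
  exact h1

theorem Sg_triv {d : ℕ} (N : ℕ) (h : ℤ) (g : ℕ) (hg : 1 ≤ g) (α : Fin d → ℝ) : ‖Sg N h g α‖ ≤ N / g + 1 := by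
  unfold Sg
  refine (norm_sum_le _ _).trans ?_
  have h1 := cnt g hg (-h) N
  have h2 : ∀ n ∈ range N, ‖if (g : ℤ) ∣ (n : ℤ) + h then ee (ph α n) else 0‖ = if (g : ℤ) ∣ (n : ℤ) - (-h) then (1 : ℝ) else 0 := by
    intro n _
    rw [sub_neg_eq_add]
    split_ifs
    · exact norm_ee _
    · simp
  rw [sum_congr rfl h2]
  linarith [(abs_le.1 h1).2]

structure SD (R : ℕ) where
  G : ℝ
  I : Finset (Finset ℕ × Finset ℕ)
  w : Finset ℕ × Finset ℕ → ℝ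
  m : Finset ℕ × Finset ℕ → ℕ
  hlog : Real.log R / 2 ≤ G
  hG1 : 1 ≤ G
  hGR : G ≤ R
  hw : ∑ i ∈ I, |w i| ≤ (R : ℝ) ^ 6
  hm : ∀ i ∈ I, 1 ≤ m i ∧ m i ≤ R ^ 2
  hnn : ∀ x : ℤ, 0 ≤ ∑ i ∈ I, w i * (if (m i : ℤ) ∣ x then 1 else 0)
  hone : ∀ x : ℤ, (∀ p : ℕ, p.Prime → p ≤ R → ¬ (p : ℤ) ∣ x) →
      ∑ i ∈ I, w i * (if (m i : ℤ) ∣ x then 1 else 0) = 1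
  hk : ∀ q : ℕ, 1 ≤ q → ∀ g : ℕ, |∑ i ∈ I with Nat.gcd (m i) q = g, w i * (g / m i)| ≤ 8 ^ q.primeFactors.card / G
  hD : ∀ q : ℕ, 1 ≤ q → ∃ Dq : Finset ℕ, Dq.card ≤ 2 ^ q.primeFactors.card ∧ (∀ g ∈ Dq, g ∣ q) ∧
      ∀ i ∈ I, Nat.gcd (m i) q ∈ Dq

theorem exists_SD (R : ℕ) (hR : 1 ≤ R) : Nonempty (SD R) := by
  obtain ⟨G, I, w, m, a1, a2, a3, a4, a5, a6, a7, a8, a9⟩ := sieve R hR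
  exact ⟨⟨G, I, w, m, a1, a2, a3, a4, a5, a6, a7, a8, a9⟩⟩

namespace SD
variable {R : ℕ} (S : SD R) {d : ℕ}

def nu (x : ℤ) : ℝ := ∑ i ∈ S.I, S.w i * (if (S.m i : ℤ) ∣ x then 1 else 0)

def K (N : ℕ) (h : ℤ) (α : Fin d → ℝ) : ℂ := ∑ n ∈ range N, (S.nu ((n : ℤ) + h) : ℂ) * ee (ph α n)

theorem K_eq (N : ℕ) (h : ℤ) (α : Fin d → ℝ) : S.K N h α = ∑ i ∈ S.I, (S.w i : ℂ) * Sg N h (S.m i) α := by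
  unfold K nu Sg
  simp_rw [mul_sum]
  rw [sum_comm]
  refine sum_congr rfl fun n _ => ?_
  push_cast
  rw [sum_mul]
  refine sum_congr rfl fun i _ => ?_
  split_ifs <;> simp

theorem K_le (N : ℕ) (hN : R ^ 7 ≤ N) (hR : 1 ≤ R) (h : ℤ) (α : Fin d → ℝ) : ‖S.K N h α‖ ≤ 2 * N / S.G := by
  have hG := S.hG1
  have hR0 : (0 : ℝ) < R := by positivity
  have hN7 : (R : ℝ) ^ 7 ≤ N := by exact_mod_cast hN
  have h1 : ‖S.K N h α‖ ≤ ∑ n ∈ range N, S.nu ((n : ℤ) + h) := by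
    refine (norm_sum_le _ _).trans (sum_le_sum fun n _ => ?_)
    rw [norm_mul, norm_ee, mul_one, Complex.norm_real, Real.norm_of_nonneg (show 0 ≤ S.nu ((n : ℤ) + h) from S.hnn _)]
  have h2 : ∑ n ∈ range N, S.nu ((n : ℤ) + h) = ∑ i ∈ S.I, S.w i * ∑ n ∈ range N, (if (S.m i : ℤ) ∣ (n : ℤ) - (-h) then (1 : ℝ) else 0) := by
    unfold nu
    simp_rw [mul_sum, sub_neg_eq_add]
    rw [sum_comm]
  have h3 : ∑ i ∈ S.I, S.w i * ∑ n ∈ range N, (if (S.m i : ℤ) ∣ (n : ℤ) - (-h) then (1 : ℝ) else 0) ≤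
      ∑ i ∈ S.I, (S.w i * (1 / S.m i) * N + |S.w i|) := by
    refine sum_le_sum fun i hi => ?_
    have hc := cnt (S.m i) (S.hm i hi).1 (-h) N
    obtain ⟨s, hs⟩ : ∃ s, s = ∑ n ∈ range N, (if (S.m i : ℤ) ∣ (n : ℤ) - (-h) then (1 : ℝ) else 0) := ⟨_, rfl⟩
    rw [← hs] at hc ⊢
    have : S.w i * s = S.w i * (1 / S.m i) * N + S.w i * (s - N / S.m i) := by ring
    rw [this]
    have h5 : S.w i * (s - N / S.m i) ≤ |S.w i| * 1 := by
      refine (le_abs_self _).trans ?_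
      rw [abs_mul]; gcongr
    linarith
  have h4 := S.hk 1 le_rfl 1
  simp only [Nat.gcd_one_right, filter_true, Nat.primeFactors_one, card_empty, pow_zero] at h4
  rw [sum_add_distrib, ← sum_mul] at h3
  have h5 : (∑ i ∈ S.I, S.w i * (1 / (S.m i : ℝ))) * N ≤ 1 / S.G * N := by
    gcongr
    refine (le_abs_self _).trans (le_trans (le_of_eq ?_) h4)
    push_cast; rfl
  have h6 : (R : ℝ) ^ 6 ≤ N / S.G := by
    rw [le_div_iff₀ (by linarith)]
    calc (R : ℝ) ^ 6 * S.G ≤ (R : ℝ) ^ 6 * R := by gcongr; exact S.hGR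
      _ = (R : ℝ) ^ 7 := by ring
      _ ≤ N := hN7
  have h7 := S.hw
  have e : 2 * (N : ℝ) / S.G = 1 / S.G * N + N / S.G := by ring
  rw [e]
  linarith

theorem K_arc (N : ℕ) (hN : 1 ≤ N) (h : ℤ) (q : ℕ) (hq : 1 ≤ q) (a : Fin d → ℤ) (β : Fin d → ℝ) (B : ℝ) (hB : 0 ≤ B)
    (hβ : ∀ j : Fin d, |β j| ≤ B / (N : ℝ) ^ ((j : ℕ) + 1)) :
    ∃ (Dq : Finset ℕ) (κ : ℕ → ℝ), Dq.card ≤ 2 ^ q.primeFactors.card ∧ (∀ g ∈ Dq, g ∣ q) ∧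
    (∀ g, |κ g| ≤ 8 ^ q.primeFactors.card / S.G) ∧
    ‖S.K N h (fun j => (a j : ℝ) / q + β j) - ∑ g ∈ Dq, (κ g : ℂ) * Sg N h g (fun j => (a j : ℝ) / q + β j)‖ ≤
      (R : ℝ) ^ 6 * (2 * q * (1 + 7 * d ^ 2 * B)) := by
  obtain ⟨Dq, h1, h2, h3⟩ := S.hD q hq
  refine ⟨Dq, fun g => ∑ i ∈ S.I with Nat.gcd (S.m i) q = g, S.w i * (g / S.m i), h1, h2, S.hk q hq, ?_⟩
  obtain ⟨α, hα⟩ : ∃ α : Fin d → ℝ, α = fun j => (a j : ℝ) / q + β j := ⟨_, rfl⟩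
  have e : ∑ g ∈ Dq, ((∑ i ∈ S.I with Nat.gcd (S.m i) q = g, S.w i * (g / S.m i) : ℝ) : ℂ) * Sg N h g α =
      ∑ i ∈ S.I, (S.w i : ℂ) * ((((Nat.gcd (S.m i) q : ℕ) : ℝ) / S.m i : ℝ) * Sg N h (Nat.gcd (S.m i) q) α) := by
    rw [← sum_fiberwise_of_maps_to h3]
    refine sum_congr rfl fun g _ => ?_
    push_cast
    rw [sum_mul]
    refine sum_congr rfl fun i hi => ?_
    rw [(mem_filter.1 hi).2]; ring
  rw [← hα]
  rw [e, K_eq, ← sum_sub_distrib]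
  have hV : 0 ≤ 2 * q * (1 + 7 * d ^ 2 * B) := by positivity
  calc _ ≤ ∑ i ∈ S.I, |S.w i| * (2 * q * (1 + 7 * d ^ 2 * B)) := by
        refine (norm_sum_le _ _).trans (sum_le_sum fun i hi => ?_)
        rw [← mul_sub, norm_mul, Complex.norm_real, Real.norm_eq_abs]
        gcongr
        have := arc_m N hN h q hq a β B hβ (S.m i) (S.hm i hi).1
        rw [← hα] at this
        exact this
    _ ≤ _ := by
        rw [← sum_mul]
        gcongr
        exact S.hw

end SD
end VMV
end

noncomputable section
open Finset
namespace VMV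

def Maj {d : ℕ} (N : ℕ) (Q : ℝ) (α : Fin d → ℝ) : Prop :=
  ∃ q : ℕ, 1 ≤ q ∧ (q : ℝ) ≤ Q ∧ ∃ a : Fin d → ℤ, ∀ j : Fin d, |α j - a j / q| ≤ Q / (N : ℝ) ^ ((j : ℕ) + 1)

theorem frac_eq (a b : ℤ) (q r : ℕ) (hq : 1 ≤ q) (hr : 1 ≤ r) (h : |(a : ℝ) / q - b / r| * (q * r) < 1) :
    (a : ℝ) / q = b / r := by
  have hq0 : (0 : ℝ) < q := by positivity
  have hr0 : (0 : ℝ) < r := by positivity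
  rw [div_eq_div_iff hq0.ne' hr0.ne']
  have e : |(a : ℝ) / q - b / r| * (q * r) = |((a * r - b * q : ℤ) : ℝ)| := by
    rw [← abs_of_pos (mul_pos hq0 hr0), ← abs_mul]
    congr 1
    push_cast
    field_simp
  rw [e, ← Int.cast_abs] at h
  have h2 : |a * r - b * q| < 1 := by exact_mod_cast h
  have h3 := Int.abs_lt_one_iff.1 h2
  have h4 : a * r = b * q := by linarith
  exact_mod_cast h4

set_option maxHeartbeats 2000000 in
theorem INV (d : ℕ) (hd : 1 ≤ d) (e : ℕ) : ∃ c0 C : ℕ, ∀ (R : ℕ), 2 ≤ R → ∀ (S : SD R) (N : ℕ), R ^ c0 ≤ N →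
    ∀ (h : ℤ) (α : Fin d → ℝ) (T : ℝ), 2 ≤ T → T ≤ (R : ℝ) ^ e → N / (S.G * T) ≤ ‖S.K N h α‖ → Maj N (T ^ C) α := by
  obtain ⟨C, hC⟩ := Sg_cross d hd
  obtain ⟨C1, hC11, hC1⟩ := om_bound (16 ^ (2 * (C + 2)))
  obtain ⟨C2, hC21, hC2⟩ := om_bound 16
  obtain ⟨E1, hE1⟩ : ∃ E1, E1 = (e + 7) * C + 2 := ⟨_, rfl⟩
  obtain ⟨E2, hE2⟩ : ∃ E2, E2 = 1 + e + C2 + E1 := ⟨_, rfl⟩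
  obtain ⟨c0, hc0⟩ : ∃ c0, c0 = (11 + e + 2 * E1 + 7 * d ^ 2) + (3 + 2 * E1 + 2 * (E2 * (C + 2))) := ⟨_, rfl⟩
  refine ⟨c0, 4 * (C + 2) + C1, fun R hR S N hN h α T hT hTe hK => ?_⟩
  obtain ⟨ρ, hρ⟩ : ∃ ρ : ℝ, ρ = R := ⟨_, rfl⟩
  have hρ2 : 2 ≤ ρ := by rw [hρ]; exact_mod_cast hR
  have hN1 : 1 ≤ N := le_trans (Nat.one_le_pow _ _ (by omega)) hN
  have hN0 : (0 : ℝ) < N := by positivity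
  have hNρ : ρ ^ c0 ≤ N := by rw [hρ]; exact_mod_cast hN
  have hG := S.hG1
  have hGR := S.hGR
  have hw := S.hw
  rw [← hρ] at hTe hGR hw
  have hG0 : 0 < S.G := by linarith
  -- step 1
  have s1 : ∃ i ∈ S.I, N / (T * ρ ^ 7) ≤ ‖Sg N h (S.m i) α‖ := by
    by_contra hcon
    push Not at hcon
    have h1 : ‖S.K N h α‖ ≤ ∑ i ∈ S.I, |S.w i| * (N / (T * ρ ^ 7)) := by
      rw [S.K_eq]
      refine (norm_sum_le _ _).trans (sum_le_sum fun i hi => ?_)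
      rw [norm_mul, Complex.norm_real, Real.norm_eq_abs]
      gcongr
      exact (hcon i hi).le
    rcases S.I.eq_empty_or_nonempty with hI | hI
    · rw [hI, sum_empty] at h1
      have : 0 < N / (S.G * T) := by positivity
      linarith
    · have hone := S.hone 1 (fun p hp _ hdvd => by
        have : p ∣ 1 := by exact_mod_cast hdvd
        exact hp.one_lt.ne' (Nat.dvd_one.1 this))
      have hex : ∃ i ∈ S.I, S.w i ≠ 0 := by
        by_contra hall
        push Not at hall
        rw [sum_eq_zero fun i hi => by rw [hall i hi, zero_mul]] at hone
        norm_num at hone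
      have h1' : ‖S.K N h α‖ < ∑ i ∈ S.I, |S.w i| * (N / (T * ρ ^ 7)) := by
        rw [S.K_eq]
        refine (norm_sum_le _ _).trans_lt (sum_lt_sum (fun i hi => ?_) ?_)
        · rw [norm_mul, Complex.norm_real, Real.norm_eq_abs]
          gcongr
          exact (hcon i hi).le
        · obtain ⟨i, hi, hwi⟩ := hex
          refine ⟨i, hi, ?_⟩
          rw [norm_mul, Complex.norm_real, Real.norm_eq_abs]
          exact mul_lt_mul_of_pos_left (hcon i hi) (abs_pos.2 hwi)
      rw [← sum_mul] at h1'
      have h2 : (∑ i ∈ S.I, |S.w i|) * (N / (T * ρ ^ 7)) ≤ ρ ^ 6 * (N / (T * ρ ^ 7)) := by gcongr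
      have h3 : ρ ^ 6 * (N / (T * ρ ^ 7)) = N / (ρ * T) := by field_simp
      have h4 : N / (ρ * T) ≤ N / (S.G * T) := by gcongr
      linarith
  obtain ⟨i, hi, hSi⟩ := s1
  have hT1 : 2 ≤ T * ρ ^ 7 := by
    have : 1 ≤ ρ ^ 7 := one_le_pow₀ (by linarith)
    calc (2 : ℝ) = 2 * 1 := by norm_num
      _ ≤ _ := by gcongr
  obtain ⟨q1, hq1, hq1b, a1, ha1⟩ := hC α N h (S.m i) (T * ρ ^ 7) hN1 (S.hm i hi).1 hT1 hSi
  have hT1C : (T * ρ ^ 7) ^ C ≤ ρ ^ ((e + 7) * C) := by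
    rw [pow_mul]
    gcongr
    rw [pow_add]; gcongr
  have hmi : (S.m i : ℝ) ≤ ρ ^ 2 := by rw [hρ]; exact_mod_cast (S.hm i hi).2
  have hq1B : (q1 : ℝ) ≤ ρ ^ E1 := by
    refine hq1b.trans ?_
    rw [hE1, pow_add]; gcongr
  have hT1B : (T * ρ ^ 7) ^ C ≤ ρ ^ E1 := hT1C.trans (pw hρ2 (by omega))
  obtain ⟨B, hB⟩ : ∃ B, B = ρ ^ E1 := ⟨_, rfl⟩
  have hB1 : 1 ≤ B := by rw [hB]; exact one_le_pow₀ (by linarith)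
  rw [← hB] at hq1B hT1B
  obtain ⟨q, hq, hqq1, ⟨a, ha⟩, hmin⟩ := reduce_frac q1 hq1 a1
  have hqB : (q : ℝ) ≤ B := le_trans (by exact_mod_cast hqq1) hq1B
  have hq0 : (1 : ℝ) ≤ q := by exact_mod_cast hq
  have hβ : ∀ j : Fin d, |α j - (a j : ℝ) / q| ≤ B / (N : ℝ) ^ ((j : ℕ) + 1) := by
    intro j
    rw [← ha j]
    refine (ha1 j).trans ?_
    gcongr
  have hα : (fun j => (a j : ℝ) / q + (α j - (a j : ℝ) / q)) = α := by funext j; ring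
  -- step 2
  obtain ⟨Dq, κ, hD1, hD2, hκ, herr⟩ := S.K_arc N hN1 h q hq a (fun j => α j - (a j : ℝ) / q) B (by linarith) hβ
  rw [hα, ← hρ] at herr
  have herr2 : ρ ^ 6 * (2 * q * (1 + 7 * d ^ 2 * B)) ≤ N / (4 * (S.G * T)) := by
    rw [le_div_iff₀ (by positivity)]
    have h7 : 1 + 7 * (d : ℝ) ^ 2 * B ≤ ρ ^ (1 + 7 * d ^ 2) * B := by
      have h8 := nat_le_pow hρ2 (1 + 7 * d ^ 2)
      push_cast at h8
      have h9 := mul_le_mul_of_nonneg_right h8 (by linarith : 0 ≤ B)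
      rw [add_mul] at h9
      linarith
    have h4 : (8 : ℝ) ≤ ρ ^ 3 := by
      have : (2 : ℝ) ^ 3 ≤ ρ ^ 3 := by gcongr
      linarith
    calc ρ ^ 6 * (2 * q * (1 + 7 * d ^ 2 * B)) * (4 * (S.G * T)) ≤
          ρ ^ 6 * (2 * B * (ρ ^ (1 + 7 * d ^ 2) * B)) * (4 * (ρ * ρ ^ e)) := by
          gcongr
      _ = 8 * (ρ ^ 7 * ρ ^ e * ρ ^ (1 + 7 * d ^ 2) * (B * B)) := by ring
      _ ≤ ρ ^ 3 * (ρ ^ 7 * ρ ^ e * ρ ^ (1 + 7 * d ^ 2) * (B * B)) := by gcongr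
      _ = ρ ^ (11 + e + 2 * E1 + 7 * d ^ 2) := by rw [hB]; ring
      _ ≤ ρ ^ c0 := pw hρ2 (by omega)
      _ ≤ N := hNρ
  obtain ⟨W, hW⟩ : ∃ W : ℕ, W = q.primeFactors.card := ⟨_, rfl⟩
  rw [← hW] at hD1 hκ
  have hT0 : 0 < T := by linarith
  -- step 3
  obtain ⟨T2, hT2⟩ : ∃ T2 : ℝ, T2 = 2 * T * 16 ^ W := ⟨_, rfl⟩
  have h16 : (1 : ℝ) ≤ 16 ^ W := one_le_pow₀ (by norm_num)
  have hT22 : 2 ≤ T2 := by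
    rw [hT2]
    calc (2 : ℝ) ≤ 2 * 2 * 1 := by norm_num
      _ ≤ _ := by gcongr
  have s3 : ∃ g ∈ Dq, N / T2 ≤ ‖Sg N h g α‖ := by
    by_contra hcon
    push Not at hcon
    have h1 : ‖∑ g ∈ Dq, (κ g : ℂ) * Sg N h g α‖ ≤ ∑ g ∈ Dq, 8 ^ W / S.G * (N / T2) := by
      refine (norm_sum_le _ _).trans (sum_le_sum fun g hg => ?_)
      rw [norm_mul, Complex.norm_real, Real.norm_eq_abs]
      gcongr
      · exact hκ g
      · exact (hcon g hg).le
    rw [sum_const, nsmul_eq_mul] at h1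
    have h2 : (Dq.card : ℝ) * (8 ^ W / S.G * (N / T2)) ≤ 2 ^ W * (8 ^ W / S.G * (N / T2)) := by
      gcongr
      exact_mod_cast hD1
    have h3 : (2 : ℝ) ^ W * (8 ^ W / S.G * (N / T2)) = N / (2 * (S.G * T)) := by
      rw [hT2]
      have : (16 : ℝ) ^ W = 2 ^ W * 8 ^ W := by rw [← mul_pow]; norm_num
      rw [this]
      field_simp
    have h4 := norm_sub_norm_le (S.K N h α) (∑ g ∈ Dq, (κ g : ℂ) * Sg N h g α)
    have h5 : 0 < N / (S.G * T) := by positivity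
    have h6 : N / (2 * (S.G * T)) = (N / (S.G * T)) / 2 := by field_simp
    have h7 : N / (4 * (S.G * T)) = (N / (S.G * T)) / 4 := by field_simp
    linarith
  obtain ⟨g, hg, hSg⟩ := s3
  have hgq : g ∣ q := hD2 g hg
  have hg1 : 1 ≤ g := Nat.pos_of_dvd_of_pos hgq hq
  have hg0 : (0 : ℝ) < g := by positivity
  have hgB : (g : ℝ) ≤ B := le_trans (by exact_mod_cast Nat.le_of_dvd hq hgq) hqB
  have hBN : B ≤ N := by rw [hB]; exact (pw hρ2 (by omega)).trans hNρ
  have hgT : (g : ℝ) ≤ T2 ^ 2 := by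
    have h1 := Sg_triv N h g hg1 α
    have h2 : (1 : ℝ) ≤ N / g := by rw [le_div_iff₀ hg0]; linarith
    have h3 : N / T2 ≤ 2 * (N / g) := by linarith
    rw [← mul_div_assoc, div_le_div_iff₀ (by linarith) hg0] at h3
    have h4 : (N : ℝ) * g ≤ N * (2 * T2) := by linarith
    have h5 := le_of_mul_le_mul_left h4 hN0
    calc (g : ℝ) ≤ 2 * T2 := h5
      _ ≤ T2 * T2 := by gcongr
      _ = T2 ^ 2 := by ring
  -- step 4
  obtain ⟨q3, hq3, hq3b, a3, ha3⟩ := hC α N h g T2 hN1 hg1 hT22 hSg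
  have hq3x : (q3 : ℝ) ≤ T2 ^ (C + 2) := by
    refine hq3b.trans ?_
    rw [pow_add]; gcongr
  have hT2C : T2 ^ C ≤ T2 ^ (C + 2) := pw hT22 (by omega)
  -- step 5
  have hT2E : T2 ≤ ρ ^ E2 := by
    have h1 : (16 : ℝ) ^ W ≤ C2 * q := by rw [hW]; exact_mod_cast hC2 q hq
    have h2 := nat_le_pow hρ2 C2
    calc T2 ≤ ρ * ρ ^ e * (ρ ^ C2 * ρ ^ E1) := by
          rw [hT2]
          have : (16 : ℝ) ^ W ≤ ρ ^ C2 * ρ ^ E1 := h1.trans (by rw [← hB]; gcongr)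
          gcongr
      _ = ρ ^ E2 := by rw [hE2]; ring
  have hT2X : T2 ^ (C + 2) ≤ ρ ^ (E2 * (C + 2)) := by rw [pow_mul]; gcongr
  have hX1 : 1 ≤ ρ ^ (E2 * (C + 2)) := one_le_pow₀ (by linarith)
  have hfr : ∀ j, (a1 j : ℝ) / q1 = a3 j / q3 := by
    intro j
    rw [ha j]
    apply frac_eq _ _ _ _ hq hq3
    have h1 : |(a j : ℝ) / q - a3 j / q3| ≤ (B + T2 ^ (C + 2)) / N := by
      have e1 : (a j : ℝ) / q - a3 j / q3 = (α j - a3 j / q3) - (α j - a j / q) := by ring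
      rw [e1]
      refine (abs_sub _ _).trans ?_
      have h2 := hβ j
      have h3 := (ha3 j).trans (div_le_div_of_nonneg_right hT2C (by positivity))
      have h4 : (N : ℝ) ≤ (N : ℝ) ^ ((j : ℕ) + 1) := le_self_pow₀ (by exact_mod_cast hN1) (by omega)
      have h5 : B / (N : ℝ) ^ ((j : ℕ) + 1) ≤ B / N := by gcongr
      have h6 : T2 ^ (C + 2) / (N : ℝ) ^ ((j : ℕ) + 1) ≤ T2 ^ (C + 2) / N := by gcongr
      rw [add_div]; linarith
    have hlt : (B + T2 ^ (C + 2)) * (B * T2 ^ (C + 2)) < N := by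
      obtain ⟨Z, hZ⟩ : ∃ Z, Z = ρ ^ (E2 * (C + 2)) := ⟨_, rfl⟩
      rw [← hZ] at hT2X hX1
      have hT20 : 0 ≤ T2 ^ (C + 2) := by positivity
      calc (B + T2 ^ (C + 2)) * (B * T2 ^ (C + 2)) ≤ (B + Z) * (B * Z) := by gcongr
        _ ≤ (2 * (B * Z)) * (B * Z) := by
            have z1 : B ≤ B * Z := le_mul_of_one_le_right (by linarith) hX1
            have z2 : Z ≤ B * Z := le_mul_of_one_le_left (by linarith) hB1
            have z3 : B + Z ≤ 2 * (B * Z) := by linarith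
            gcongr
        _ < ρ * ρ * (B * Z) * (B * Z) := by
            have : 0 < B * Z := by positivity
            have z4 : 2 < ρ * ρ := by
              calc (2 : ℝ) < 2 * 2 := by norm_num
                _ ≤ ρ * ρ := by gcongr
            gcongr
        _ ≤ ρ ^ (3 + 2 * E1 + 2 * (E2 * (C + 2))) := by
            have e1 : ρ * ρ * (B * Z) * (B * Z) = ρ ^ (2 + 2 * E1 + 2 * (E2 * (C + 2))) := by rw [hB, hZ]; ring
            rw [e1]; exact pw hρ2 (by omega)
        _ ≤ ρ ^ c0 := pw hρ2 (by omega)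
        _ ≤ N := hNρ
    calc _ ≤ (B + T2 ^ (C + 2)) / N * (B * T2 ^ (C + 2)) := by gcongr
      _ < 1 := by rw [div_mul_eq_mul_div, div_lt_one hN0]; exact hlt
  have hqd := hmin q3 a3 hq3 hfr
  have hqq3 : (q : ℝ) ≤ q3 := by exact_mod_cast Nat.le_of_dvd hq3 hqd
  -- step 6
  obtain ⟨x, hx⟩ : ∃ x, x = T2 ^ (C + 2) := ⟨_, rfl⟩
  have hx0 : 0 < x := by rw [hx]; positivity
  have hfin : x ≤ T ^ (4 * (C + 2) + C1) := by
    have h1 : ((16 : ℝ) ^ (2 * (C + 2))) ^ W ≤ C1 * q := by rw [hW]; exact_mod_cast hC1 q hq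
    have h2 : x * x ≤ (2 * T) ^ (2 * (C + 2)) * C1 * x := by
      calc x * x = (2 * T) ^ (2 * (C + 2)) * ((16 : ℝ) ^ (2 * (C + 2))) ^ W := by
            rw [hx, hT2, ← pow_add, mul_pow, ← pow_mul, ← pow_mul]
            ring_nf
        _ ≤ (2 * T) ^ (2 * (C + 2)) * (C1 * x) := by
            gcongr
            refine h1.trans ?_
            gcongr
            rw [hx]; linarith
        _ = _ := by ring
    have h3 := le_of_mul_le_mul_right h2 hx0
    have h4 := nat_le_pow hT C1
    calc x ≤ (2 * T) ^ (2 * (C + 2)) * C1 := h3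
      _ ≤ (T * T) ^ (2 * (C + 2)) * T ^ C1 := by gcongr
      _ = _ := by ring
  refine ⟨q3, hq3, hq3x.trans (hx ▸ hfin), a3, fun j => (ha3 j).trans ?_⟩
  have : T2 ^ C ≤ T ^ (4 * (C + 2) + C1) := hT2C.trans (hx ▸ hfin)
  gcongr

end VMV
end

noncomputable section
open Finset
namespace VMV

def DD (d : ℕ) : ℕ := ∑ j : Fin d, ((j : ℕ) + 1)

theorem two_DD (d : ℕ) : 2 * DD d = d * (d + 1) := by
  unfold DD
  rw [Fin.sum_univ_eq_sum_range (fun j => j + 1) d]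
  induction d with
  | zero => simp
  | succ n ih => rw [sum_range_succ, mul_add, ih]; ring

open Classical in
theorem transfer {d : ℕ} (L L' : Fin d → ℕ) (N P N' Q : ℕ) (hP : 1 ≤ P) (hQ : 1 ≤ Q) (hN' : 2 * Q ^ 3 < N') (hN : N = P * N')
    (hL : ∀ j : Fin d, L j = P ^ ((j : ℕ) + 1) * L' j) (hL0 : ∀ j, 0 < L' j)
    (hdiv : ∀ q : ℕ, 1 ≤ q → q ≤ Q → ∀ j, q ∣ L' j)
    (f F : (Fin d → ℝ) → ℝ) (hF : ∀ α, 0 ≤ F α) (hper : ∀ (α : Fin d → ℝ) (z : Fin d → ℤ), F (fun j => α j + z j) = F α)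
    (hfF : ∀ (q : ℕ) (a : Fin d → ℤ) (β : Fin d → ℝ), 1 ≤ q → q ≤ Q → (∀ j : Fin d, |β j| ≤ Q / (N : ℝ) ^ ((j : ℕ) + 1)) →
      f (fun j => (a j : ℝ) / q + β j) ≤ F (fun j => (a j : ℝ) / q + (P : ℝ) ^ ((j : ℕ) + 1) * β j)) :
    av L (fun α => if Maj N (Q : ℝ) α then f α else 0) ≤ ((P : ℝ) ^ DD d)⁻¹ * av L' F := by
  have hP0 : (0 : ℝ) < P := by positivity
  have hN'1 : 1 ≤ N' := by omega
  have hN'0 : (0 : ℝ) < N' := by positivity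
  have hN'1r : (1 : ℝ) ≤ N' := by exact_mod_cast hN'1
  have hQ0 : (1 : ℝ) ≤ Q := by exact_mod_cast hQ
  have hLpos : ∀ j, 0 < L j := fun j => by rw [hL]; exact Nat.mul_pos (Nat.pow_pos hP) (hL0 j)
  have hprod : (∏ j, (L j : ℝ)) = (P : ℝ) ^ DD d * ∏ j, (L' j : ℝ) := by
    unfold DD
    rw [← prod_pow_eq_pow_sum, ← prod_mul_distrib]
    exact prod_congr rfl fun j _ => by rw [hL]; push_cast; rfl
  -- choice
  have hch : ∀ l : Fin d → ℕ, Maj N (Q : ℝ) (pt L l) → ∃ (q : ℕ) (a : Fin d → ℤ), 1 ≤ q ∧ q ≤ Q ∧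
      ∀ j : Fin d, |pt L l j - (a j : ℝ) / q| ≤ Q / (N : ℝ) ^ ((j : ℕ) + 1) := by
    rintro l ⟨q, h1, h2, a, h3⟩
    exact ⟨q, a, h1, by exact_mod_cast h2, h3⟩
  choose! q a hq1 hqQ hqa using hch
  let s := (Grid L).filter fun l => Maj N (Q : ℝ) (pt L l)
  let al : (Fin d → ℕ) → Fin d → ℝ := fun l j => (a l j : ℝ) / q l + (P : ℝ) ^ ((j : ℕ) + 1) * (pt L l j - (a l j : ℝ) / q l)
  -- integer numerators
  have hb : ∀ l, Maj N (Q : ℝ) (pt L l) → ∃ b : Fin d → ℤ, ∀ j, al l j = b j / L' j := by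
    intro l hl
    have : ∀ j, ∃ b : ℤ, al l j = b / L' j := by
      intro j
      obtain ⟨u, hu⟩ := hdiv (q l) (hq1 l hl) (hqQ l hl) j
      have hq0 : ((q l : ℕ) : ℝ) ≠ 0 := by have := hq1 l hl; positivity
      have hu0 : (u : ℝ) ≠ 0 := by
        intro h0
        have h1 : u = 0 := by exact_mod_cast h0
        have := hL0 j
        rw [hu, h1] at this
        simp at this
      refine ⟨a l j * u + (l j - a l j * (P ^ ((j : ℕ) + 1) * u)), ?_⟩
      simp only [al, pt]
      rw [hL j, hu]
      push_cast
      field_simp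
    choose b hb using this
    exact ⟨b, hb⟩
  choose! b hb using hb
  let φ : (Fin d → ℕ) → Fin d → ℕ := fun l j => (b l j % (L' j : ℤ)).toNat
  have hφ : ∀ l, ∀ j, ((φ l j : ℕ) : ℤ) = b l j % (L' j : ℤ) := fun l j =>
    Int.toNat_of_nonneg (Int.emod_nonneg _ (by have := hL0 j; omega))
  have hφm : ∀ l, φ l ∈ Grid L' := by
    intro l
    unfold Grid
    rw [Fintype.mem_piFinset]
    intro j
    rw [mem_range]
    have h1 := Int.emod_lt_of_pos (b l j) (show (0 : ℤ) < L' j by have := hL0 j; omega)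
    have h2 := hφ l j
    omega
  have hφz : ∀ l, Maj N (Q : ℝ) (pt L l) → ∀ j, al l j = pt L' (φ l) j + ((b l j / (L' j : ℤ) : ℤ) : ℝ) := by
    intro l hl j
    have hL'0 : (L' j : ℝ) ≠ 0 := by have := hL0 j; positivity
    rw [hb l hl j]
    unfold pt
    have h1 := Int.emod_add_mul_ediv (b l j) (L' j)
    rw [← hφ] at h1
    have h2 : ((φ l j : ℕ) : ℝ) + L' j * ((b l j / (L' j : ℤ) : ℤ) : ℝ) = b l j := by exact_mod_cast h1
    rw [← h2]
    field_simp
  have hFeq : ∀ l, Maj N (Q : ℝ) (pt L l) → F (al l) = F (pt L' (φ l)) := by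
    intro l hl
    rw [← hper (pt L' (φ l)) (fun j => b l j / (L' j : ℤ))]
    congr 1
    funext j
    exact hφz l hl j
  have hff : ∀ l, Maj N (Q : ℝ) (pt L l) → f (pt L l) ≤ F (pt L' (φ l)) := by
    intro l hl
    rw [← hFeq l hl]
    have := hfF (q l) (a l) (fun j => pt L l j - (a l j : ℝ) / q l) (hq1 l hl) (hqQ l hl) (hqa l hl)
    refine le_trans (le_of_eq ?_) this
    congr 1
    funext j; ring
  have hinj : Set.InjOn φ (s : Set (Fin d → ℕ)) := by
    intro l hl m hm hlm
    have hl2 := (mem_filter.1 (mem_coe.1 hl))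
    have hm2 := (mem_filter.1 (mem_coe.1 hm))
    funext j
    have e1 := hφz l hl2.2 j
    have e2 := hφz m hm2.2 j
    rw [hlm] at e1
    obtain ⟨z, hz⟩ : ∃ z : ℤ, z = b l j / (L' j : ℤ) - b m j / (L' j : ℤ) := ⟨_, rfl⟩
    have e3 : al l j - al m j = z := by rw [e1, e2, hz]; push_cast; ring
    simp only [al] at e3
    have hbd : ∀ n, Maj N (Q : ℝ) (pt L n) → |(P : ℝ) ^ ((j : ℕ) + 1) * (pt L n j - (a n j : ℝ) / q n)| ≤ Q / N' := by
      intro n hn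
      rw [abs_mul, abs_of_pos (by positivity)]
      calc _ ≤ (P : ℝ) ^ ((j : ℕ) + 1) * (Q / (N : ℝ) ^ ((j : ℕ) + 1)) := by gcongr; exact hqa n hn j
        _ = Q / (N' : ℝ) ^ ((j : ℕ) + 1) := by rw [hN]; push_cast; rw [mul_pow]; field_simp
        _ ≤ Q / N' := by
          have : (N' : ℝ) ≤ (N' : ℝ) ^ ((j : ℕ) + 1) := le_self_pow₀ hN'1r (by omega)
          gcongr
    have b1 := hbd l hl2.2
    have b2 := hbd m hm2.2
    have hql := hq1 l hl2.2
    have hqm := hq1 m hm2.2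
    have hqm0 : ((q m : ℕ) : ℝ) ≠ 0 := by positivity
    have hqlQ : ((q l : ℕ) : ℝ) ≤ Q := by exact_mod_cast hqQ l hl2.2
    have hqmQ : ((q m : ℕ) : ℝ) ≤ Q := by exact_mod_cast hqQ m hm2.2
    have efr : (a l j : ℝ) / q l = ((a m j + z * q m : ℤ) : ℝ) / q m := by
      apply frac_eq _ _ _ _ hql hqm
      have e4 : (a l j : ℝ) / q l - ((a m j + z * q m : ℤ) : ℝ) / q m =
          (P : ℝ) ^ ((j : ℕ) + 1) * (pt L m j - (a m j : ℝ) / q m) - (P : ℝ) ^ ((j : ℕ) + 1) * (pt L l j - (a l j : ℝ) / q l) := by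
        push_cast
        rw [add_div, mul_div_assoc, div_self hqm0]
        linarith
      rw [e4]
      have h5 : |(P : ℝ) ^ ((j : ℕ) + 1) * (pt L m j - (a m j : ℝ) / q m) - (P : ℝ) ^ ((j : ℕ) + 1) * (pt L l j - (a l j : ℝ) / q l)| ≤ 2 * (Q / N') := by
        refine (abs_sub _ _).trans ?_
        linarith
      calc _ ≤ 2 * (Q / N') * ((Q : ℝ) * Q) := by gcongr
        _ = 2 * (Q : ℝ) ^ 3 / N' := by ring
        _ < 1 := by rw [div_lt_one hN'0]; exact_mod_cast hN'
    have e6 : pt L l j - pt L m j = z := by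
      push_cast at efr
      rw [add_div, mul_div_assoc, div_self hqm0, mul_one] at efr
      rw [efr] at e3
      have hPp : (P : ℝ) ^ ((j : ℕ) + 1) ≠ 0 := by positivity
      have e7 : (P : ℝ) ^ ((j : ℕ) + 1) * (pt L l j - pt L m j - z) = 0 := by linarith
      have := (mul_eq_zero.1 e7).resolve_left hPp
      linarith
    unfold pt at e6
    have hLj : (0 : ℝ) < L j := by have := hLpos j; positivity
    have hlr : l j < L j := by
      have := hl2.1; unfold Grid at this; exact mem_range.1 (Fintype.mem_piFinset.1 this j)
    have hmr : m j < L j := by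
      have := hm2.1; unfold Grid at this; exact mem_range.1 (Fintype.mem_piFinset.1 this j)
    rw [← sub_div, div_eq_iff hLj.ne'] at e6
    have e7 : (l j : ℤ) - m j = z * L j := by exact_mod_cast e6
    have e8 : z = 0 := by
      by_contra hz0
      rcases lt_or_gt_of_ne hz0 with h' | h'
      · have : z * L j ≤ -1 * L j := by
          apply mul_le_mul_of_nonneg_right <;> omega
        omega
      · have : 1 * (L j : ℤ) ≤ z * L j := by
          apply mul_le_mul_of_nonneg_right <;> omega
        omega
    rw [e8, zero_mul] at e7
    omega
  unfold av
  have hsum : ∑ l ∈ Grid L, (if Maj N (Q : ℝ) (pt L l) then f (pt L l) else 0) ≤ ∑ l' ∈ Grid L', F (pt L' l') := by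
    rw [← sum_filter]
    calc _ ≤ ∑ l ∈ s, F (pt L' (φ l)) := sum_le_sum fun l hl => hff l (mem_filter.1 hl).2
      _ = ∑ l' ∈ s.image φ, F (pt L' l') := by rw [sum_image hinj]
      _ ≤ _ := by
        refine sum_le_sum_of_subset_of_nonneg (fun l' hl' => ?_) fun l' _ _ => hF _
        obtain ⟨l, _, rfl⟩ := mem_image.1 hl'
        exact hφm l
  rw [hprod, mul_inv, mul_assoc]
  gcongr

end VMV
end

noncomputable section
open Finset
namespace VMV

theorem Sg_per {d : ℕ} (N : ℕ) (h : ℤ) (g : ℕ) (α : Fin d → ℝ) (z : Fin d → ℤ) :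
    Sg N h g (fun j => α j + z j) = Sg N h g α := by
  unfold Sg
  refine sum_congr rfl fun n _ => ?_
  have : ph (fun j => α j + z j) (n : ℤ) = ph α n + ((∑ j, z j * (n : ℤ) ^ ((j : ℕ) + 1) : ℤ) : ℝ) := by
    rw [ph_add]; congr 1; unfold ph; push_cast; rfl
  rw [this, ee_add_int]

theorem lam_pow {d : ℕ} (ε x : ℝ) (hx : 0 < x) :
    x ^ (lam d ε) = x ^ (2 * (d * (d + 1))) / x ^ DD d * x ^ ε := by
  have h2 : (2 : ℝ) * DD d = d * (d + 1) := by exact_mod_cast two_DD d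
  have e : lam d ε = ((2 * (d * (d + 1)) : ℕ) : ℝ) - ((DD d : ℕ) : ℝ) + ε := by
    unfold lam; push_cast; linarith
  rw [e, Real.rpow_add hx, Real.rpow_sub hx, Real.rpow_natCast, Real.rpow_natCast]

theorem Sg_moment {d : ℕ} (hd : 2 ≤ d) (A ε : ℝ) (hA1 : 1 ≤ A) (hε : 0 < ε)
    (hA : ∀ N : ℕ, 1 ≤ N → (Jc (d * (d + 1)) d (Ico 0 (N : ℤ)) : ℝ) ≤ A * (N : ℝ) ^ (lam d ε))
    (N' : ℕ) (h : ℤ) (g : ℕ) (hg : 1 ≤ g) (hgN : g ≤ N') (L' : Fin d → ℕ)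
    (hL : ∀ j : Fin d, (d * (d + 1)) * N' ^ ((j : ℕ) + 1) < L' j) :
    av L' (fun α => ‖Sg N' h g α‖ ^ (2 * (d * (d + 1)))) ≤ A * 2 ^ (lam d ε) * (N' : ℝ) ^ (lam d ε) * (1 / (g : ℝ) ^ 2) := by
  have hg0 : (0 : ℝ) < g := by positivity
  have hg1 : (1 : ℝ) ≤ g := by exact_mod_cast hg
  have hlam := lam_ge d hd ε hε.le
  let B : Finset ℤ := ((range N').filter fun n : ℕ => (g : ℤ) ∣ (n : ℤ) + h).image fun n : ℕ => (n : ℤ)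
  have e : ∀ α : Fin d → ℝ, Sg N' h g α = fs B α := by
    intro α
    unfold Sg fs
    rw [sum_image (fun x _ y _ hxy => by exact_mod_cast hxy), sum_filter]
  simp_rw [e]
  have hBm : ∀ x ∈ B, 0 ≤ x ∧ x ≤ N' := by
    intro x hx
    obtain ⟨n, hn, rfl⟩ := mem_image.1 hx
    have := mem_range.1 (mem_filter.1 hn).1
    constructor <;> omega
  rw [moment_fs L' _ N' B hBm hL]
  have hsub : B ⊆ (Ico (0 : ℤ) ((N' / g + 1 : ℕ) : ℤ)).image fun x => (g : ℤ) * x + (-h) % g := by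
    intro x hx
    obtain ⟨n, hn, rfl⟩ := mem_image.1 hx
    have hn2 := mem_filter.1 hn
    have hnN := mem_range.1 hn2.1
    have hc0 : 0 ≤ (-h) % (g : ℤ) := Int.emod_nonneg _ (by omega)
    have hc1 : (-h) % (g : ℤ) < g := Int.emod_lt_of_pos _ (by omega)
    have hdv : (g : ℤ) ∣ (n : ℤ) - (-h) % g := by
      have h1 : (g : ℤ) ∣ -h - (-h) % g := Int.dvd_self_sub_emod
      have h2 : (n : ℤ) - (-h) % g = ((n : ℤ) + h) + (-h - (-h) % g) := by ring
      rw [h2]; exact dvd_add hn2.2 h1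
    obtain ⟨x, hx⟩ := hdv
    refine mem_image.2 ⟨x, mem_Ico.2 ⟨?_, ?_⟩, by linarith⟩
    · by_contra hneg
      push Not at hneg
      have : (g : ℤ) * x ≤ g * (-1) := by
        apply mul_le_mul_of_nonneg_left <;> omega
      have : (g : ℤ) * x ≤ - g := by linarith
      omega
    · have h3 : (g : ℤ) * x < N' := by omega
      have h4 : x ≤ (N' / g : ℕ) := by
        push_cast
        apply Int.le_ediv_of_mul_le (by omega)
        linarith [mul_comm (g : ℤ) x]
      push_cast at h4 ⊢
      omega
  have h1 := Jc_mono (t := d * (d + 1)) (d := d) hsub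
  rw [Jc_affine _ _ _ (g : ℤ) _ (by omega)] at h1
  have h2 := hA (N' / g + 1) (Nat.le_add_left 1 _)
  have h3 : ((N' / g + 1 : ℕ) : ℝ) ≤ 2 * (N' : ℝ) / g := by
    have h4 : ((N' / g : ℕ) : ℝ) ≤ (N' : ℝ) / g := Nat.cast_div_le
    have h5 : 1 ≤ (N' : ℝ) / g := by rw [le_div_iff₀ hg0, one_mul]; exact_mod_cast hgN
    have : 2 * (N' : ℝ) / g = N' / g + N' / g := by ring
    push_cast; linarith
  calc (Jc (d * (d + 1)) d B : ℝ) ≤ (Jc (d * (d + 1)) d (Ico 0 ((N' / g + 1 : ℕ) : ℤ)) : ℝ) := by exact_mod_cast h1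
    _ ≤ A * ((N' / g + 1 : ℕ) : ℝ) ^ (lam d ε) := h2
    _ ≤ A * (2 * (N' : ℝ) / g) ^ (lam d ε) := by gcongr
    _ = A * 2 ^ (lam d ε) * (N' : ℝ) ^ (lam d ε) * (1 / (g : ℝ) ^ (lam d ε)) := by
      rw [Real.div_rpow (by positivity) hg0.le, Real.mul_rpow (by norm_num) (by positivity)]; ring
    _ ≤ _ := by
      have : (g : ℝ) ^ 2 ≤ (g : ℝ) ^ (lam d ε) := by
        rw [← Real.rpow_two]
        exact Real.rpow_le_rpow_of_exponent_le hg1 (by linarith)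
      gcongr

theorem pm {ι : Type*} (s : Finset ι) (f : ι → ℝ) (hf : ∀ i, 0 ≤ f i) (n : ℕ) (X : ℝ) (hX : (s.card : ℝ) ≤ X) (hX1 : 1 ≤ X) :
    (∑ i ∈ s, f i) ^ (n + 1) ≤ X ^ (n + 1) * ∑ i ∈ s, f i ^ (n + 1) := by
  have h := pow_sum_le_card_mul_sum_pow (s := s) (f := f) (fun i _ => hf i) n
  have h0 : 0 ≤ ∑ i ∈ s, f i ^ (n + 1) := sum_nonneg fun i _ => pow_nonneg (hf i) _
  calc _ ≤ _ := h
    _ ≤ X ^ n * ∑ i ∈ s, f i ^ (n + 1) := by gcongr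
    _ ≤ _ := mul_le_mul_of_nonneg_right (pow_le_pow_right₀ hX1 (by omega)) h0

end VMV
end

noncomputable section
open Finset
namespace VMV

theorem K_point {R : ℕ} (S : SD R) {d : ℕ} (hd : 1 ≤ d) (N P N' Q : ℕ) (hP : 1 ≤ P) (hN' : 1 ≤ N') (hN : N = P * N')
    (hQ : 1 ≤ Q) (hR : 2 * R ^ 7 ≤ P) (h : ℤ) (q : ℕ) (hq : 1 ≤ q) (hqQ : q ≤ Q) (a : Fin d → ℤ) (β : Fin d → ℝ)
    (hβ : ∀ j : Fin d, |β j| ≤ (Q : ℝ) / (N : ℝ) ^ ((j : ℕ) + 1)) (n : ℕ) (Λ : ℝ)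
    (hΛ : ((16 : ℝ) ^ q.primeFactors.card) ^ (n + 1) ≤ Λ) :
    ‖S.K N h (fun j => (a j : ℝ) / q + β j)‖ ^ (n + 1) ≤
      Λ * (2 * P / S.G) ^ (n + 1) * (∑ g ∈ Icc 1 Q, ‖Sg N' h g (fun j => (a j : ℝ) / q + (P : ℝ) ^ ((j : ℕ) + 1) * β j)‖ ^ (n + 1)
        + (32 * (d : ℝ) ^ 2 * Q ^ 2) ^ (n + 1)) := by
  have hN1 : 1 ≤ N := by rw [hN]; exact Nat.mul_pos hP hN'
  obtain ⟨Dq, κ, hDc, hDd, hκ, hK⟩ := S.K_arc N hN1 h q hq a β Q (by positivity) hβ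
  obtain ⟨α, hα⟩ : ∃ α : Fin d → ℝ, α = fun j => (a j : ℝ) / q + β j := ⟨_, rfl⟩
  obtain ⟨α', hα'⟩ : ∃ α' : Fin d → ℝ, α' = fun j => (a j : ℝ) / q + (P : ℝ) ^ ((j : ℕ) + 1) * β j := ⟨_, rfl⟩
  have hsc : ∀ g, g ∣ q → ‖Sg N h g α‖ ≤ P * ‖Sg N' h g α'‖ + 3 * P * q * (1 + 7 * (d : ℝ) ^ 2 * Q) := by
    intro g hg
    have h1 := arc_scale N h q hq a β Q P N' hP hN' hN (by positivity) hβ g hg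
    rw [← hα, ← hα'] at h1
    have h2 := norm_sub_norm_le (Sg N h g α) (P * Sg N' h g α')
    rw [norm_mul, Complex.norm_natCast] at h2
    linarith
  rw [← hα] at hK
  rw [← hα, ← hα']
  have hG := S.hG1
  have hGR := S.hGR
  have hG0 : 0 < S.G := by linarith
  have hd1 : (1 : ℝ) ≤ d := by exact_mod_cast hd
  have hQ1 : (1 : ℝ) ≤ Q := by exact_mod_cast hQ
  have hq1 : (1 : ℝ) ≤ q := by exact_mod_cast hq
  have hqQ1 : (q : ℝ) ≤ Q := by exact_mod_cast hqQ
  have hRP : 2 * (R : ℝ) ^ 7 ≤ P := by exact_mod_cast hR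
  have hP0 : (0 : ℝ) < P := by exact_mod_cast hP
  obtain ⟨b, hb⟩ : ∃ b : ℝ, b = q * (1 + 7 * (d : ℝ) ^ 2 * Q) := ⟨_, rfl⟩
  have hb0 : 0 ≤ b := by rw [hb]; positivity
  have hb8 : b ≤ 8 * (d : ℝ) ^ 2 * Q ^ 2 := by
    have h1 : 1 ≤ (d : ℝ) ^ 2 * Q := by
      have : 1 ≤ (d : ℝ) ^ 2 := one_le_pow₀ hd1
      calc (1 : ℝ) = 1 * 1 := by ring
        _ ≤ _ := by gcongr
    calc b ≤ Q * ((d : ℝ) ^ 2 * Q + 7 * (d : ℝ) ^ 2 * Q) := by rw [hb]; gcongr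
      _ = _ := by ring
  obtain ⟨W, hW⟩ : ∃ W : ℝ, W = 8 ^ q.primeFactors.card := ⟨_, rfl⟩
  obtain ⟨D, hD⟩ : ∃ D : ℝ, D = 2 ^ q.primeFactors.card := ⟨_, rfl⟩
  have hW1 : 1 ≤ W := by rw [hW]; exact one_le_pow₀ (by norm_num)
  have hD1 : 1 ≤ D := by rw [hD]; exact one_le_pow₀ (by norm_num)
  have hDc' : (Dq.card : ℝ) ≤ D := by rw [hD]; exact_mod_cast hDc
  have hWD : W * D = 16 ^ q.primeFactors.card := by rw [hW, hD, ← mul_pow]; norm_num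
  have hR0 : (0 : ℝ) ≤ R := by positivity
  have e3 : (R : ℝ) ^ 6 * (2 * q * (1 + 7 * (d : ℝ) ^ 2 * Q)) ≤ (W * P / S.G) * (D * b) := by
    have h1 : (R : ℝ) ^ 6 * (2 * q * (1 + 7 * (d : ℝ) ^ 2 * Q)) = 2 * R ^ 6 * b := by rw [hb]; ring
    rw [h1]
    have h2 : 2 * (R : ℝ) ^ 6 ≤ P / S.G := by
      rw [le_div_iff₀ hG0]
      calc 2 * (R : ℝ) ^ 6 * S.G ≤ 2 * (R : ℝ) ^ 6 * (R : ℝ) := by gcongr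
        _ = 2 * (R : ℝ) ^ 7 := by ring
        _ ≤ (P : ℝ) := hRP
    calc 2 * (R : ℝ) ^ 6 * b ≤ P / S.G * b := by gcongr
      _ = (1 * P / S.G) * (1 * b) := by ring
      _ ≤ _ := by gcongr
  have e1 : ‖∑ g ∈ Dq, (κ g : ℂ) * Sg N h g α‖ ≤ (W * P / S.G) * (∑ g ∈ Dq, ‖Sg N' h g α'‖ + 3 * (D * b)) := by
    calc ‖∑ g ∈ Dq, (κ g : ℂ) * Sg N h g α‖ ≤ ∑ g ∈ Dq, ‖(κ g : ℂ) * Sg N h g α‖ := norm_sum_le _ _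
      _ ≤ ∑ g ∈ Dq, (W / S.G) * (P * ‖Sg N' h g α'‖ + 3 * P * b) := by
        refine sum_le_sum fun g hg => ?_
        rw [norm_mul, Complex.norm_real, Real.norm_eq_abs]
        have h1 := hsc g (hDd g hg)
        have h2 := hκ g
        rw [← hW] at h2
        have h3 : 3 * (P : ℝ) * b = 3 * P * q * (1 + 7 * (d : ℝ) ^ 2 * Q) := by rw [hb]; ring
        rw [h3]
        gcongr
      _ = (W * P / S.G) * (∑ g ∈ Dq, ‖Sg N' h g α'‖ + 3 * (Dq.card * b)) := by
        rw [← mul_sum, sum_add_distrib, sum_const, nsmul_eq_mul, ← mul_sum]; ring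
      _ ≤ _ := by gcongr
  have e4 : ‖S.K N h α‖ ≤ (W * P / S.G) * (∑ g ∈ Dq, ‖Sg N' h g α'‖ + 4 * (D * b)) := by
    have h2 := norm_sub_norm_le (S.K N h α) (∑ g ∈ Dq, (κ g : ℂ) * Sg N h g α)
    have h3 : (W * P / S.G) * (∑ g ∈ Dq, ‖Sg N' h g α'‖ + 4 * (D * b))
      = (W * P / S.G) * (∑ g ∈ Dq, ‖Sg N' h g α'‖ + 3 * (D * b)) + (W * P / S.G) * (D * b) := by ring
    rw [h3]
    linarith
  have hs0 : 0 ≤ ∑ g ∈ Dq, ‖Sg N' h g α'‖ := sum_nonneg fun g _ => norm_nonneg _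
  have e5 : (∑ g ∈ Dq, ‖Sg N' h g α'‖ + 4 * (D * b)) ^ (n + 1) ≤
      2 ^ (n + 1) * (D ^ (n + 1) * (∑ g ∈ Icc 1 Q, ‖Sg N' h g α'‖ ^ (n + 1) + (32 * (d : ℝ) ^ 2 * Q ^ 2) ^ (n + 1))) := by
    have h1 := pm Dq (fun g => ‖Sg N' h g α'‖) (fun g => norm_nonneg _) n D hDc' hD1
    have h2 : (4 * (D * b)) ^ (n + 1) ≤ D ^ (n + 1) * (32 * (d : ℝ) ^ 2 * Q ^ 2) ^ (n + 1) := by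
      rw [← mul_pow]
      refine pow_le_pow_left₀ (by positivity) ?_ _
      calc 4 * (D * b) ≤ 4 * (D * (8 * (d : ℝ) ^ 2 * Q ^ 2)) := by gcongr
        _ = _ := by ring
    have h3 : ∑ g ∈ Dq, ‖Sg N' h g α'‖ ^ (n + 1) ≤ ∑ g ∈ Icc 1 Q, ‖Sg N' h g α'‖ ^ (n + 1) := by
      refine sum_le_sum_of_subset_of_nonneg (fun g hg => mem_Icc.2 ?_) fun g _ _ => by positivity
      have := hDd g hg
      exact ⟨Nat.pos_of_dvd_of_pos this hq, (Nat.le_of_dvd hq this).trans hqQ⟩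
    have h4 := add_pow_le hs0 (show 0 ≤ 4 * (D * b) by positivity) (n + 1)
    have h5 : (2 : ℝ) ^ (n + 1 - 1) ≤ 2 ^ (n + 1) := pow_le_pow_right₀ (by norm_num) (by omega)
    calc _ ≤ _ := h4
      _ ≤ 2 ^ (n + 1) * (D ^ (n + 1) * ∑ g ∈ Icc 1 Q, ‖Sg N' h g α'‖ ^ (n + 1) + D ^ (n + 1) * (32 * (d : ℝ) ^ 2 * Q ^ 2) ^ (n + 1)) := by
        refine mul_le_mul h5 (add_le_add (h1.trans ?_) h2) (by positivity) (by positivity)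
        gcongr
      _ = _ := by ring
  calc ‖S.K N h α‖ ^ (n + 1) ≤ ((W * P / S.G) * (∑ g ∈ Dq, ‖Sg N' h g α'‖ + 4 * (D * b))) ^ (n + 1) := by gcongr
    _ = (W * P / S.G) ^ (n + 1) * (∑ g ∈ Dq, ‖Sg N' h g α'‖ + 4 * (D * b)) ^ (n + 1) := mul_pow _ _ _
    _ ≤ (W * P / S.G) ^ (n + 1) * (2 ^ (n + 1) * (D ^ (n + 1) * (∑ g ∈ Icc 1 Q, ‖Sg N' h g α'‖ ^ (n + 1) + (32 * (d : ℝ) ^ 2 * Q ^ 2) ^ (n + 1)))) := by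
      gcongr
    _ = (W * D) ^ (n + 1) * (2 * P / S.G) ^ (n + 1) * (∑ g ∈ Icc 1 Q, ‖Sg N' h g α'‖ ^ (n + 1) + (32 * (d : ℝ) ^ 2 * Q ^ 2) ^ (n + 1)) := by
      have : W * P / S.G = W * (P / S.G) := by ring
      have h2 : 2 * P / S.G = 2 * (P / S.G) := by ring
      rw [this, h2, mul_pow W D, mul_pow W (P / S.G), mul_pow 2 (P / S.G)]; ring
    _ ≤ _ := by
      rw [hWD]
      gcongr

/-- Mean value over major arcs. -/
theorem MV0 {d : ℕ} (hd : 2 ≤ d) (A ε : ℝ) (hA1 : 1 ≤ A) (hε : 0 < ε)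
    (hA : ∀ N : ℕ, 1 ≤ N → (Jc (d * (d + 1)) d (Ico 0 (N : ℤ)) : ℝ) ≤ A * (N : ℝ) ^ (lam d ε))
    {R : ℕ} (S : SD R) (N P N' Q : ℕ) (hP : 1 ≤ P) (hN' : N' = 16 * Q ^ 4) (hN : N = P * N')
    (hQ : 1 ≤ Q) (hR : 2 * R ^ 7 ≤ P) (h : ℤ) (Λ : ℝ)
    (hΛ : ∀ q : ℕ, 1 ≤ q → q ≤ Q → ((16 : ℝ) ^ q.primeFactors.card) ^ (2 * (d * (d + 1))) ≤ Λ)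
    (L L' : Fin d → ℕ)
    (hL : ∀ j : Fin d, L j = P ^ ((j : ℕ) + 1) * L' j)
    (hdiv : ∀ q : ℕ, 1 ≤ q → q ≤ Q → ∀ j : Fin d, q ∣ L' j)
    (hL' : ∀ j : Fin d, (d * (d + 1)) * N' ^ ((j : ℕ) + 1) < L' j) :
    (open Classical in av L (fun α => if Maj N (Q : ℝ) α then ‖S.K N h α‖ ^ (2 * (d * (d + 1))) else 0)) ≤
      Λ * 2 ^ (2 * (d * (d + 1))) * (2 * A * 2 ^ (lam d ε) + (32 * (d : ℝ) ^ 2) ^ (2 * (d * (d + 1)))) * (N' : ℝ) ^ ε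
        * ((N / S.G) ^ (2 * (d * (d + 1))) / (N : ℝ) ^ DD d) := by
  have hQ4 : 1 ≤ Q ^ 4 := Nat.one_le_pow _ _ hQ
  have hQ34 : Q ^ 3 ≤ Q ^ 4 := Nat.pow_le_pow_right hQ (by norm_num)
  have hQ14 : Q ≤ Q ^ 4 := by simpa using Nat.pow_le_pow_right hQ (show 1 ≤ 4 by norm_num)
  have hN'1 : 1 ≤ N' := by omega
  have hlam := lam_ge d hd ε hε.le
  obtain ⟨n, hn⟩ : ∃ n, n + 1 = 2 * (d * (d + 1)) := ⟨2 * (d * (d + 1)) - 1, by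
    have : 0 < d * (d + 1) := by positivity
    omega⟩
  have hΛ0 : 0 ≤ Λ := le_trans (by positivity) (hΛ 1 le_rfl hQ)
  have hG0 : 0 < S.G := lt_of_lt_of_le one_pos S.hG1
  have hP0 : (0 : ℝ) < P := by exact_mod_cast hP
  have hN'0 : (0 : ℝ) < N' := by exact_mod_cast hN'1
  obtain ⟨F, hF⟩ : ∃ F : (Fin d → ℝ) → ℝ, F = fun α => Λ * (2 * P / S.G) ^ (n + 1) * (∑ g ∈ Icc 1 Q, ‖Sg N' h g α‖ ^ (n + 1)
        + (32 * (d : ℝ) ^ 2 * Q ^ 2) ^ (n + 1)) := ⟨_, rfl⟩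
  have hT := transfer L L' N P N' Q hP hQ (by omega) hN hL (fun j => by have := hL' j; omega) hdiv
    (fun α => ‖S.K N h α‖ ^ (n + 1)) F
    (fun α => by rw [hF]; positivity)
    (fun α z => by rw [hF]; simp only [Sg_per])
    (fun q a β hq hqQ hβ => by
      rw [hF]
      exact K_point S (by omega) N P N' Q hP hN'1 hN hQ hR h q hq hqQ a β hβ n Λ (by rw [hn]; exact hΛ q hq hqQ))
  have hav : av L' F ≤ Λ * (2 * P / S.G) ^ (n + 1) * ((2 * A * 2 ^ (lam d ε) + (32 * (d : ℝ) ^ 2) ^ (n + 1)) * (N' : ℝ) ^ (lam d ε)) := by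
    rw [hF, av_mul, av_add, av_sum]
    refine mul_le_mul_of_nonneg_left ?_ (by positivity)
    have h1 : ∑ g ∈ Icc 1 Q, av L' (fun α => ‖Sg N' h g α‖ ^ (n + 1)) ≤ A * 2 ^ (lam d ε) * (N' : ℝ) ^ (lam d ε) * 2 := by
      calc ∑ g ∈ Icc 1 Q, av L' (fun α => ‖Sg N' h g α‖ ^ (n + 1))
          ≤ ∑ g ∈ Icc 1 Q, A * 2 ^ (lam d ε) * (N' : ℝ) ^ (lam d ε) * (1 / (g : ℝ) ^ 2) := by
            refine sum_le_sum fun g hg => ?_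
            have := mem_Icc.1 hg
            rw [hn]
            exact Sg_moment hd A ε hA1 hε hA N' h g this.1 (by omega) L' hL'
        _ ≤ _ := by
            rw [← mul_sum]
            have := sum_inv_sq Q
            gcongr
    have h2 : av L' (fun _ => (32 * (d : ℝ) ^ 2 * Q ^ 2) ^ (n + 1)) ≤ (32 * (d : ℝ) ^ 2) ^ (n + 1) * (N' : ℝ) ^ (lam d ε) := by
      refine (av_const_le _ _ (by positivity)).trans ?_
      rw [mul_pow]
      refine mul_le_mul_of_nonneg_left ?_ (by positivity)
      have h3 : ((Q : ℝ) ^ 2) ^ (n + 1) = ((Q : ℝ) ^ 4) ^ (d * (d + 1)) := by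
        rw [hn, ← pow_mul, ← pow_mul]; congr 1; ring
      have h4 : (Q : ℝ) ^ 4 ≤ N' := by rw [hN']; push_cast; linarith [show (0 : ℝ) ≤ (Q : ℝ) ^ 4 by positivity]
      rw [h3]
      calc ((Q : ℝ) ^ 4) ^ (d * (d + 1)) ≤ (N' : ℝ) ^ (d * (d + 1)) := by gcongr
        _ = (N' : ℝ) ^ ((d * (d + 1) : ℕ) : ℝ) := (Real.rpow_natCast _ _).symm
        _ ≤ _ := by
          refine Real.rpow_le_rpow_of_exponent_le (by exact_mod_cast hN'1) ?_
          unfold lam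
          have : (0 : ℝ) ≤ (d : ℝ) * (d + 1) := by positivity
          push_cast; linarith
    calc _ ≤ _ := add_le_add h1 h2
      _ = _ := by ring
  rw [← hn]
  refine hT.trans ?_
  calc ((P : ℝ) ^ DD d)⁻¹ * av L' F ≤ ((P : ℝ) ^ DD d)⁻¹ * (Λ * (2 * P / S.G) ^ (n + 1) * ((2 * A * 2 ^ (lam d ε) + (32 * (d : ℝ) ^ 2) ^ (n + 1)) * (N' : ℝ) ^ (lam d ε))) := by
        gcongr
    _ = _ := by
      rw [lam_pow ε (N' : ℝ) hN'0, ← hn, hN]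
      push_cast
      have e1 : 2 * (P : ℝ) / S.G = 2 * (P / S.G) := by ring
      have e2 : (P : ℝ) * N' / S.G = (P / S.G) * N' := by ring
      rw [e1, e2, mul_pow 2, mul_pow _ (N' : ℝ) (n + 1), mul_pow _ (N' : ℝ) (DD d)]
      field_simp

end VMV
end

noncomputable section
open Finset
namespace VMV

theorem MV {d : ℕ} (hd : 2 ≤ d) (C : ℕ) : ∃ A : ℝ, 1 ≤ A ∧ ∀ (R : ℕ) (S : SD R) (μ i Y0 : ℕ),
    (32 * R ^ 7 * (4 ^ i) ^ (4 * C) ≤ 2 ^ μ) → 1 ≤ R → d * (d + 1) < Y0 → (∀ q, 1 ≤ q → q ≤ 2 ^ μ → q ∣ Y0) →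
    ∀ (h : ℤ) (L : Fin d → ℕ), (∀ j : Fin d, L j = (2 ^ μ * Y0) ^ ((j : ℕ) + 2)) →
    (open Classical in av L (fun α => if Maj (2 ^ μ) (((4 : ℝ) ^ i) ^ C) α then ‖S.K (2 ^ μ) h α‖ ^ (2 * (d * (d + 1))) else 0)) ≤
      A * 4 ^ i * ((2 ^ μ / S.G) ^ (2 * (d * (d + 1))) / ((2 : ℝ) ^ μ) ^ DD d) := by
  obtain ⟨ε, hεd⟩ : ∃ ε : ℝ, ε = 1 / (8 * (C + 1)) := ⟨_, rfl⟩
  have hε0 : 0 < ε := by rw [hεd]; positivity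
  have hε1 : ε ≤ 1 := by
    rw [hεd, div_le_one (by positivity)]
    have : (0 : ℝ) ≤ C := by positivity
    linarith
  obtain ⟨A, hA1, hA⟩ := vmvt d hd ε hε0 hε1
  obtain ⟨C1, hC1, hom⟩ := om_bound (16 ^ (2 * (d * (d + 1)) * (2 * C + 1)))
  have hC1' : (1 : ℝ) ≤ C1 := by exact_mod_cast hC1
  obtain ⟨A2, hA2⟩ : ∃ A2 : ℝ, A2 = 2 * A * 2 ^ (lam d ε) + (32 * (d : ℝ) ^ 2) ^ (2 * (d * (d + 1))) := ⟨_, rfl⟩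
  have hA20 : 1 ≤ A2 := by
    rw [hA2]
    have h1 : (1 : ℝ) ≤ 2 ^ (lam d ε) := Real.one_le_rpow (by norm_num) (by linarith [lam_ge d hd ε hε0.le])
    have h2 : (0 : ℝ) ≤ (32 * (d : ℝ) ^ 2) ^ (2 * (d * (d + 1))) := by positivity
    have h3 : (1 : ℝ) * 1 ≤ 2 * A * 2 ^ (lam d ε) := by gcongr; linarith
    linarith
  refine ⟨C1 * 2 ^ (2 * (d * (d + 1))) * A2 * 16, ?_, ?_⟩
  · have h2 : (1 : ℝ) ≤ 2 ^ (2 * (d * (d + 1))) := one_le_pow₀ (by norm_num)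
    calc (1 : ℝ) = 1 * 1 * 1 * 1 := by norm_num
      _ ≤ _ := by gcongr; norm_num
  intro R S μ i Y0 hμ hR1 hY0 hdiv h L hL
  obtain ⟨Q, hQ⟩ : ∃ Q : ℕ, Q = 4 ^ (i * C) := ⟨_, rfl⟩
  have hQ1 : 1 ≤ Q := by rw [hQ]; exact Nat.one_le_pow _ _ (by norm_num)
  have hQ2 : (Q : ℝ) = ((4 : ℝ) ^ i) ^ C := by rw [hQ]; push_cast; rw [pow_mul]
  have hQ4 : (4 ^ i) ^ (4 * C) = Q ^ 4 := by rw [hQ, ← pow_mul, ← pow_mul]; congr 1; ring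
  have hN'2 : 16 * Q ^ 4 = 2 ^ (4 + 8 * i * C) := by
    have e : (4 : ℕ) ^ (i * C) = 2 ^ (2 * (i * C)) := by rw [pow_mul 2 2]; norm_num
    rw [hQ, e, ← pow_mul, show (16 : ℕ) = 2 ^ 4 by norm_num, ← pow_add]
    congr 1; ring
  have hR7 : 1 ≤ R ^ 7 := Nat.one_le_pow _ _ hR1
  have hle : 4 + 8 * i * C ≤ μ := by
    by_contra hc
    push Not at hc
    have : 2 ^ μ < 2 ^ (4 + 8 * i * C) := Nat.pow_lt_pow_right (by norm_num) hc
    rw [← hN'2] at this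
    rw [hQ4] at hμ
    have : 32 * 1 * Q ^ 4 ≤ 32 * R ^ 7 * Q ^ 4 := by gcongr
    omega
  obtain ⟨P, hP⟩ : ∃ P : ℕ, P = 2 ^ (μ - (4 + 8 * i * C)) := ⟨_, rfl⟩
  have hNP : 2 ^ μ = P * (16 * Q ^ 4) := by
    rw [hP, hN'2, ← pow_add]; congr 1; omega
  have hQ40 : 0 < 16 * Q ^ 4 := by positivity
  have hP1 : 1 ≤ P := by rw [hP]; exact Nat.one_le_pow _ _ (by norm_num)
  have hPR : 2 * R ^ 7 ≤ P := by
    refine Nat.le_of_mul_le_mul_right ?_ hQ40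
    rw [← hNP]; rw [hQ4] at hμ
    calc 2 * R ^ 7 * (16 * Q ^ 4) = 32 * R ^ 7 * Q ^ 4 := by ring
      _ ≤ _ := hμ
  have hQN : Q ≤ 2 ^ μ := by
    rw [hNP]
    calc Q = 1 * (1 * Q ^ 1) := by ring
      _ ≤ P * (16 * Q ^ 4) := by gcongr <;> norm_num
  have hZ0 : 0 < 2 ^ μ * Y0 := by have : 0 < Y0 := by omega
                                  positivity
  have hΛ : ∀ q : ℕ, 1 ≤ q → q ≤ Q → ((16 : ℝ) ^ q.primeFactors.card) ^ (2 * (d * (d + 1))) ≤ C1 * 2 ^ i := by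
    intro q hq hqQ
    refine le_of_pow_le_pow_left₀ (n := 2 * C + 1) (by omega) (by positivity) ?_
    have h1 := hom q hq
    have h2 : (((16 : ℝ) ^ (2 * (d * (d + 1)) * (2 * C + 1))) ^ q.primeFactors.card) ≤ C1 * q := by exact_mod_cast h1
    have hqr : (q : ℝ) ≤ 2 ^ (2 * i * C) := by
      have : (q : ℝ) ≤ Q := by exact_mod_cast hqQ
      rw [hQ2] at this
      refine this.trans (le_of_eq ?_)
      rw [show (4 : ℝ) = 2 ^ 2 by norm_num, ← pow_mul, ← pow_mul]
      congr 1; ring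
    calc (((16 : ℝ) ^ q.primeFactors.card) ^ (2 * (d * (d + 1)))) ^ (2 * C + 1)
        = ((16 : ℝ) ^ (2 * (d * (d + 1)) * (2 * C + 1))) ^ q.primeFactors.card := by
          rw [← pow_mul, ← pow_mul, ← pow_mul]; congr 1; ring
      _ ≤ C1 * q := h2
      _ ≤ (C1 : ℝ) ^ (2 * C + 1) * 2 ^ (i * (2 * C + 1)) := by
        refine mul_le_mul (le_self_pow₀ hC1' (by omega)) (hqr.trans ?_) (by positivity) (by positivity)
        refine pow_le_pow_right₀ (by norm_num) ?_
        rw [mul_add, mul_one]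
        have : i * (2 * C) = 2 * i * C := by ring
        omega
      _ = _ := by rw [mul_pow, pow_mul]
  have main := MV0 hd A ε hA1 hε0 hA S (2 ^ μ) P (16 * Q ^ 4) Q hP1 rfl hNP hQ1 hPR h (C1 * 2 ^ i) hΛ L
    (fun j => ((16 * Q ^ 4) * Y0) ^ ((j : ℕ) + 1) * (2 ^ μ * Y0))
    (fun j => by
      rw [hL, show (j : ℕ) + 2 = (j : ℕ) + 1 + 1 from rfl, pow_succ]
      nth_rewrite 1 [hNP]
      rw [← mul_assoc (P ^ _), ← mul_pow, mul_assoc P])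
    (fun q hq hqQ j => by
      refine Dvd.dvd.mul_left ?_ _
      exact (hdiv q hq (hqQ.trans hQN)).mul_left _)
    (fun j => by
      rw [mul_pow (16 * Q ^ 4) Y0, mul_comm (d * (d + 1)), mul_assoc ((16 * Q ^ 4) ^ _)]
      refine (Nat.mul_lt_mul_left (by positivity)).2 ?_
      calc d * (d + 1) < Y0 := hY0
        _ = 1 * (1 * Y0) := by ring
        _ ≤ Y0 ^ ((j : ℕ) + 1) * (2 ^ μ * Y0) := by
          gcongr
          · exact Nat.one_le_pow _ _ (by omega)
          · exact Nat.one_le_pow _ _ (by norm_num))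
  rw [hQ2] at main
  push_cast at main
  refine main.trans ?_
  rw [← hA2]
  have hN'ε : ((16 : ℝ) * Q ^ 4) ^ ε ≤ 16 * 2 ^ i := by
    have h1 : (16 : ℝ) * Q ^ 4 ≤ (16 * 2 ^ i) ^ (8 * (C + 1)) := by
      have h2 : (16 : ℝ) * Q ^ 4 = 16 * 2 ^ (8 * i * C) := by
        rw [hQ2, show (4 : ℝ) = 2 ^ 2 by norm_num, ← pow_mul, ← pow_mul, ← pow_mul]; congr 2; ring
      rw [h2, mul_pow, ← pow_mul]
      refine mul_le_mul (le_self_pow₀ (by norm_num) (by omega)) (pow_le_pow_right₀ (by norm_num) ?_) (by positivity) (by positivity)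
      have : i * (8 * (C + 1)) = 8 * i * C + 8 * i := by ring
      omega
    calc ((16 : ℝ) * Q ^ 4) ^ ε ≤ ((16 * 2 ^ i) ^ (8 * (C + 1))) ^ ε := by gcongr
      _ = 16 * 2 ^ i := by
        rw [← Real.rpow_natCast, ← Real.rpow_mul (by positivity), hεd]
        push_cast
        rw [mul_one_div_cancel (by positivity), Real.rpow_one]
  have hG0 : 0 < S.G := lt_of_lt_of_le one_pos S.hG1
  calc _ ≤ (C1 : ℝ) * 2 ^ i * 2 ^ (2 * (d * (d + 1))) * A2 * (16 * 2 ^ i) * ((2 ^ μ / S.G) ^ (2 * (d * (d + 1))) / (2 ^ μ) ^ DD d) := by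
        gcongr
    _ = _ := by
      rw [show (4 : ℝ) ^ i = 2 ^ i * 2 ^ i by rw [← mul_pow]; norm_num]; ring

end VMV
end

noncomputable section
open Finset
namespace VMV

theorem Ico_img (N : ℕ) : Ico (0 : ℤ) (N : ℤ) = (range N).image fun n : ℕ => (n : ℤ) := by
  ext x
  simp only [mem_Ico, mem_image, mem_range]
  constructor
  · intro hx
    exact ⟨x.toNat, by omega, by omega⟩
  · rintro ⟨n, hn, rfl⟩
    omega

theorem SD.K_fsw {R : ℕ} (S : SD R) {d : ℕ} (N : ℕ) (h : ℤ) (α : Fin d → ℝ) :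
    S.K N h α = fsw (fun x => S.nu (x + h)) (Ico 0 (N : ℤ)) α := by
  unfold SD.K fsw
  rw [Ico_img, sum_image (fun x _ y _ hxy => by exact_mod_cast hxy)]

theorem SD.nu_nonneg {R : ℕ} (S : SD R) (x : ℤ) : 0 ≤ S.nu x := S.hnn x

theorem SD.nu_le {R : ℕ} (S : SD R) (x : ℤ) : S.nu x ≤ (R : ℝ) ^ 6 := by
  refine le_trans ?_ S.hw
  unfold SD.nu
  refine sum_le_sum fun i _ => ?_
  split_ifs
  · rw [mul_one]; exact le_abs_self _
  · rw [mul_zero]; exact abs_nonneg _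

theorem SD.K_triv {R : ℕ} (S : SD R) {d : ℕ} (N t : ℕ) (h : ℤ) (L : Fin d → ℕ)
    (hL : ∀ j : Fin d, t * N ^ ((j : ℕ) + 1) < L j) :
    av L (fun α => ‖S.K N h α‖ ^ (2 * t)) ≤ ((R : ℝ) ^ 6) ^ (2 * t) * Jc t d (Ico 0 (N : ℤ)) := by
  have hA : ∀ x ∈ Ico (0 : ℤ) (N : ℤ), 0 ≤ x ∧ x ≤ N := by
    intro x hx
    have := mem_Ico.1 hx
    omega
  have h1 := moment_mono L t N (fun x => S.nu (x + h)) (fun _ => (R : ℝ) ^ 6) (Ico 0 (N : ℤ)) hA hL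
    (fun x _ => S.nu_nonneg _) (fun x _ => S.nu_le _)
  simp_rw [S.K_fsw]
  refine h1.trans (le_of_eq ?_)
  have h2 : ∀ α : Fin d → ℝ, ‖fsw (fun _ => (R : ℝ) ^ 6) (Ico 0 (N : ℤ)) α‖ ^ (2 * t) = ((R : ℝ) ^ 6) ^ (2 * t) * ‖fs (Ico 0 (N : ℤ)) α‖ ^ (2 * t) := by
    intro α
    have : fsw (fun _ => (R : ℝ) ^ 6) (Ico 0 (N : ℤ)) α = (((R : ℝ) ^ 6 : ℝ) : ℂ) * fs (Ico 0 (N : ℤ)) α := by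
      unfold fsw fs; rw [mul_sum]
    rw [this, norm_mul, Complex.norm_real, mul_pow, Real.norm_of_nonneg (by positivity)]
  simp_rw [h2]
  rw [av_mul, moment_fs L t N _ hA hL]

theorem dyadic (x : ℝ) (hx0 : 0 ≤ x) (hx2 : x ≤ 2) (I : ℕ) :
    x ^ 2 ≤ ∑ i ∈ Icc 1 I, 64 * (1 / 16 : ℝ) ^ i * (if (1 / 4 : ℝ) ^ i ≤ x then 1 else 0) + 4 * (1 / 16 : ℝ) ^ I := by
  induction I with
  | zero => simp; nlinarith
  | succ I ih =>
    rw [sum_Icc_succ_top (by omega)]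
    split_ifs with hc
    · have : 64 * (1 / 16 : ℝ) ^ (I + 1) = 4 * (1 / 16 : ℝ) ^ I := by ring
      have h0 : (0 : ℝ) ≤ 4 * (1 / 16 : ℝ) ^ (I + 1) := by positivity
      linarith
    · push Not at hc
      have h1 : x ^ 2 ≤ ((1 / 4 : ℝ) ^ (I + 1)) ^ 2 := by gcongr
      have h2 : ((1 / 4 : ℝ) ^ (I + 1)) ^ 2 = (1 / 16 : ℝ) ^ (I + 1) := by
        rw [← pow_mul, mul_comm, pow_mul]; norm_num
      have h3 : (0 : ℝ) ≤ ∑ i ∈ Icc 1 I, 64 * (1 / 16 : ℝ) ^ i * (if (1 / 4 : ℝ) ^ i ≤ x then 1 else 0) :=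
        sum_nonneg fun i _ => by positivity
      have h4 : (0 : ℝ) ≤ (1 / 16 : ℝ) ^ (I + 1) := by positivity
      linarith

theorem geo (I : ℕ) : ∑ i ∈ Icc 1 I, (1 / 4 : ℝ) ^ i ≤ 1 - (1 / 4 : ℝ) ^ I := by
  induction I with
  | zero => simp
  | succ I ih =>
    rw [sum_Icc_succ_top (by omega)]
    have : (1 / 4 : ℝ) ^ (I + 1) = 1 / 4 * (1 / 4 : ℝ) ^ I := by ring
    have h0 : (0 : ℝ) ≤ (1 / 4 : ℝ) ^ I := by positivity
    linarith

set_option maxHeartbeats 1000000 in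
theorem Kmom {d : ℕ} (hd : 2 ≤ d) (r : ℕ) (hr : d * (d + 1) < r) : ∃ (c1 : ℕ) (A : ℝ), 4 ≤ c1 ∧ 1 ≤ A ∧
    ∀ (s μ R : ℕ), R = 2 ^ s → 1 ≤ s → s * c1 ≤ μ → μ ≤ (s + 1) * c1 → ∀ (S : SD R) (Y0 : ℕ), r < Y0 →
    (∀ q, 1 ≤ q → q ≤ 2 ^ μ → q ∣ Y0) →
    ∀ (h : ℤ) (L : Fin d → ℕ), (∀ j : Fin d, L j = (2 ^ μ * Y0) ^ ((j : ℕ) + 2)) →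
    av L (fun α => ‖S.K (2 ^ μ) h α‖ ^ (2 * r)) ≤ A * ((2 ^ μ / S.G) ^ (2 * r) / ((2 : ℝ) ^ μ) ^ DD d) := by
  obtain ⟨t, ht⟩ : ∃ t, t = d * (d + 1) := ⟨_, rfl⟩
  have ht1 : 6 ≤ t := by rw [ht]; nlinarith
  obtain ⟨c0, C, hINV⟩ := INV d (by omega) (8 * t)
  obtain ⟨A1, hA11, hMV⟩ := MV hd C
  obtain ⟨c1, hc1⟩ : ∃ c1, c1 = c0 + 12 + 32 * t * C := ⟨_, rfl⟩
  have hc11 : 1 ≤ c1 := by omega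
  obtain ⟨ρ, hρ⟩ : ∃ ρ : ℝ, ρ = 1 / (c1 : ℝ) := ⟨_, rfl⟩
  have hρ0 : 0 < ρ := by rw [hρ]; positivity
  have hρ1 : ρ ≤ 1 := by
    rw [hρ, div_le_one (by positivity)]; exact_mod_cast hc11
  obtain ⟨A3, hA31, hvm⟩ := vmvt d hd ρ hρ0 hρ1
  refine ⟨c1, 4 ^ r * (64 * A1 + 8 * A3), by omega, ?_, ?_⟩
  · calc (1 : ℝ) = 1 * 1 := by norm_num
      _ ≤ _ := by
        refine mul_le_mul (one_le_pow₀ (by norm_num)) (by linarith) (by norm_num) (by positivity)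
  intro s μ R hR hs hsμ hμs S Y0 hY0 hdiv h L hL
  rw [← ht] at hr hMV
  have hR2 : 2 ≤ R := by
    rw [hR]; calc 2 = 2 ^ 1 := by norm_num
      _ ≤ _ := Nat.pow_le_pow_right (by norm_num) hs
  have hRr : (2 : ℝ) ≤ R := by exact_mod_cast hR2
  have hR0 : (0 : ℝ) < R := by linarith
  have hRp : ∀ c, c ≤ c1 → R ^ c ≤ 2 ^ μ := by
    intro c hc
    rw [hR, ← pow_mul]
    exact Nat.pow_le_pow_right (by norm_num) ((Nat.mul_le_mul_left s hc).trans hsμ)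
  obtain ⟨N, hN⟩ : ∃ N : ℝ, N = 2 ^ μ := ⟨_, rfl⟩
  have hN0 : 0 < N := by rw [hN]; positivity
  have hNc : ((2 ^ μ : ℕ) : ℝ) = N := by rw [hN]; push_cast; rfl
  have hG1 := S.hG1
  have hGR := S.hGR
  have hG0 : 0 < S.G := by linarith
  rw [← hN]
  obtain ⟨Y, hY⟩ : ∃ Y : ℝ, Y = N ^ DD d := ⟨_, rfl⟩
  have hY0' : 0 < Y := by rw [hY]; positivity
  -- normalized sum
  obtain ⟨x, hx⟩ : ∃ x : (Fin d → ℝ) → ℝ, x = fun α => ‖S.K (2 ^ μ) h α‖ * (S.G / N) := ⟨_, rfl⟩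
  have hxK : ∀ α, ‖S.K (2 ^ μ) h α‖ = (N / S.G) * x α := by
    intro α; rw [hx]; field_simp
  have hx0 : ∀ α, 0 ≤ x α := by intro α; rw [hx]; positivity
  have hx2 : ∀ α, x α ≤ 2 := by
    intro α
    have h1 := S.K_le (2 ^ μ) (hRp 7 (by omega)) (by omega) h α
    rw [hxK, hNc] at h1
    have h2 : 2 * N / S.G = (N / S.G) * 2 := by ring
    rw [h2] at h1
    exact le_of_mul_le_mul_left h1 (by positivity)
  obtain ⟨I, hI⟩ : ∃ I, I = 4 * t * s := ⟨_, rfl⟩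
  have h4I : (4 : ℝ) ^ I = (R : ℝ) ^ (8 * t) := by
    rw [hI, hR, show (4 : ℝ) = 2 ^ 2 by norm_num]
    push_cast
    rw [← pow_mul, ← pow_mul]; congr 1; ring
  -- level sets
  have hlev : ∀ i ∈ Icc 1 I, av L (fun α => x α ^ (2 * t) * (if (1 / 4 : ℝ) ^ i ≤ x α then 1 else 0)) ≤ A1 * 4 ^ i * (1 / Y) := by
    intro i hi
    have hi' := mem_Icc.1 hi
    have h4i : (4 : ℝ) ^ i ≤ (R : ℝ) ^ (8 * t) := by
      rw [← h4I]; exact pow_le_pow_right₀ (by norm_num) hi'.2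
    have h4n : 4 ^ i ≤ R ^ (8 * t) := by exact_mod_cast h4i
    have hcond : 32 * R ^ 7 * (4 ^ i) ^ (4 * C) ≤ 2 ^ μ := by
      refine le_trans ?_ (hRp (12 + 32 * t * C) (by omega))
      calc 32 * R ^ 7 * (4 ^ i) ^ (4 * C) ≤ R ^ 5 * R ^ 7 * (R ^ (8 * t)) ^ (4 * C) := by
            gcongr
            calc 32 = 2 ^ 5 := by norm_num
              _ ≤ R ^ 5 := by gcongr
        _ = R ^ (12 + 32 * t * C) := by rw [← pow_add, ← pow_mul, ← pow_add]; congr 1; ring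
    have hm := hMV R S μ i Y0 hcond (by omega) (by omega) hdiv h L hL
    rw [← hN, ← hY] at hm
    have h1 : av L (fun α => x α ^ (2 * t) * (if (1 / 4 : ℝ) ^ i ≤ x α then 1 else 0)) ≤
        av L (fun α => ((S.G / N) ^ (2 * t)) * (open Classical in if Maj (2 ^ μ) (((4 : ℝ) ^ i) ^ C) α then ‖S.K (2 ^ μ) h α‖ ^ (2 * t) else 0)) := by
      refine av_mono _ fun α => ?_
      by_cases hc : (1 / 4 : ℝ) ^ i ≤ x α
      · rw [if_pos hc, if_pos]
        · rw [← mul_pow, hx, mul_one]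
          apply le_of_eq; congr 1; ring
        · refine hINV R hR2 S (2 ^ μ) (hRp c0 (by omega)) h α (4 ^ i) ?_ h4i ?_
          · calc (2 : ℝ) ≤ 4 ^ 1 := by norm_num
              _ ≤ 4 ^ i := pow_le_pow_right₀ (by norm_num) hi'.1
          · rw [hxK, hNc]
            have : N / (S.G * 4 ^ i) = (N / S.G) * (1 / 4) ^ i := by
              rw [div_pow, one_pow]; field_simp
            rw [this]
            gcongr
      · rw [if_neg hc, mul_zero]
        split_ifs <;> positivity
    refine h1.trans ?_
    rw [av_mul]
    calc _ ≤ (S.G / N) ^ (2 * t) * (A1 * 4 ^ i * ((N / S.G) ^ (2 * t) / Y)) := by gcongr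
      _ = ((S.G / N) * (N / S.G)) ^ (2 * t) * (A1 * 4 ^ i * (1 / Y)) := by rw [mul_pow]; ring
      _ = _ := by
        have : (S.G / N) * (N / S.G) = 1 := by field_simp
        rw [this, one_pow, one_mul]
  -- tail
  have htail : av L (fun α => x α ^ (2 * t)) ≤ (R : ℝ) ^ (16 * t) * (2 * A3 * (1 / Y)) := by
    have hLt : ∀ j : Fin d, t * (2 ^ μ) ^ ((j : ℕ) + 1) < L j := by
      intro j
      rw [hL, mul_pow, mul_comm t]
      have hle : (2 ^ μ) ^ ((j : ℕ) + 1) ≤ (2 ^ μ) ^ ((j : ℕ) + 2) := Nat.pow_le_pow_right (Nat.one_le_pow _ _ (by norm_num)) (by omega)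
      have h0 : 0 < (2 ^ μ) ^ ((j : ℕ) + 1) := by positivity
      have h2 : Y0 ≤ Y0 ^ ((j : ℕ) + 2) := Nat.le_self_pow (by omega) _
      calc (2 ^ μ) ^ ((j : ℕ) + 1) * t < (2 ^ μ) ^ ((j : ℕ) + 1) * Y0 := (Nat.mul_lt_mul_left h0).2 (by omega)
        _ ≤ _ := Nat.mul_le_mul hle h2
    have h1 := S.K_triv (2 ^ μ) t h L hLt
    have h2 := hvm (2 ^ μ) (Nat.one_le_pow _ _ (by norm_num))
    rw [lam_pow ρ _ (by rw [hNc]; exact hN0), ← ht, hNc, ← hY] at h2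
    have h3 : N ^ ρ ≤ 2 * R := by
      have h4 : N ≤ (2 * (R : ℝ)) ^ c1 := by
        rw [hN, hR]; push_cast
        rw [← pow_succ', ← pow_mul]
        exact pow_le_pow_right₀ (by norm_num) hμs
      calc N ^ ρ ≤ ((2 * (R : ℝ)) ^ c1) ^ ρ := by gcongr
        _ = 2 * R := by
          rw [← Real.rpow_natCast, ← Real.rpow_mul (by positivity), hρ, mul_one_div_cancel (by positivity), Real.rpow_one]
    have h5 : av L (fun α => x α ^ (2 * t)) = (S.G / N) ^ (2 * t) * av L (fun α => ‖S.K (2 ^ μ) h α‖ ^ (2 * t)) := by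
      rw [← av_mul]
      congr 1
      funext α
      rw [hx, ← mul_pow]; congr 1; ring
    rw [h5]
    calc _ ≤ (S.G / N) ^ (2 * t) * (((R : ℝ) ^ 6) ^ (2 * t) * (A3 * (N ^ (2 * t) / Y * N ^ ρ))) := by
          refine mul_le_mul_of_nonneg_left (h1.trans ?_) (by positivity)
          exact mul_le_mul_of_nonneg_left h2 (by positivity)
      _ ≤ (R / N) ^ (2 * t) * (((R : ℝ) ^ 6) ^ (2 * t) * (A3 * (N ^ (2 * t) / Y * (2 * R)))) := by gcongr
      _ = (R : ℝ) ^ (14 * t + 1) * (2 * A3 * (1 / Y)) := by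
        rw [div_pow, ← pow_mul]
        have e : (R : ℝ) ^ (14 * t + 1) = R ^ (2 * t) * R ^ (6 * (2 * t)) * R := by
          rw [← pow_add, ← pow_succ]; congr 1; ring
        rw [e]
        field_simp
      _ ≤ _ := by
        refine mul_le_mul_of_nonneg_right ?_ (by positivity)
        exact pow_le_pow_right₀ (by linarith) (by omega)
  -- assemble
  have hpt : ∀ α, ‖S.K (2 ^ μ) h α‖ ^ (2 * r) ≤ ((N / S.G) ^ (2 * r) * 4 ^ r) *
      (∑ i ∈ Icc 1 I, (64 * (1 / 16 : ℝ) ^ i) * (x α ^ (2 * t) * (if (1 / 4 : ℝ) ^ i ≤ x α then 1 else 0)) + (4 * (1 / 16 : ℝ) ^ I) * x α ^ (2 * t)) := by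
    intro α
    have h1 := dyadic (x α) (hx0 α) (hx2 α) I
    rw [hxK, mul_pow, mul_assoc]
    refine mul_le_mul_of_nonneg_left ?_ (by positivity)
    obtain ⟨k, hk⟩ : ∃ k, r = t + 1 + k := ⟨r - (t + 1), by omega⟩
    have h2 : x α ^ (2 * r) ≤ 4 ^ r * (x α ^ (2 * t) * x α ^ 2) := by
      have e : x α ^ (2 * r) = (x α ^ (2 * t) * x α ^ 2) * (x α ^ 2) ^ k := by
        rw [← pow_mul, ← pow_add, ← pow_add]; congr 1; omega
      have h3 : (x α ^ 2) ^ k ≤ 4 ^ r := by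
        calc (x α ^ 2) ^ k ≤ ((2 : ℝ) ^ 2) ^ k := by
              have := hx0 α
              have := hx2 α
              gcongr
          _ = 4 ^ k := by norm_num
          _ ≤ 4 ^ r := pow_le_pow_right₀ (by norm_num) (by omega)
      rw [e, mul_comm]
      refine mul_le_mul_of_nonneg_right h3 ?_
      have := hx0 α
      positivity
    refine h2.trans (mul_le_mul_of_nonneg_left ?_ (by positivity))
    have h0 : 0 ≤ x α ^ (2 * t) := pow_nonneg (hx0 α) _
    refine (mul_le_mul_of_nonneg_left h1 h0).trans (le_of_eq ?_)
    rw [mul_add, mul_sum]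
    congr 1
    · refine sum_congr rfl fun i _ => by ring
    · ring
  refine (av_mono _ hpt).trans ?_
  rw [av_mul, av_add, av_sum]
  simp only [av_mul]
  rw [← hY]
  have s1 : ∑ i ∈ Icc 1 I, 64 * (1 / 16 : ℝ) ^ i * av L (fun α => x α ^ (2 * t) * (if (1 / 4 : ℝ) ^ i ≤ x α then 1 else 0)) ≤ 64 * A1 * (1 / Y) := by
    calc _ ≤ ∑ i ∈ Icc 1 I, 64 * (1 / 16 : ℝ) ^ i * (A1 * 4 ^ i * (1 / Y)) := by
          refine sum_le_sum fun i hi => mul_le_mul_of_nonneg_left (hlev i hi) (by positivity)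
      _ = (64 * A1 * (1 / Y)) * ∑ i ∈ Icc 1 I, (1 / 4 : ℝ) ^ i := by
          rw [mul_sum]
          refine sum_congr rfl fun i _ => ?_
          have : (1 / 4 : ℝ) ^ i = (1 / 16) ^ i * 4 ^ i := by rw [← mul_pow]; norm_num
          rw [this]; ring
      _ ≤ (64 * A1 * (1 / Y)) * 1 := by
          refine mul_le_mul_of_nonneg_left ?_ (by positivity)
          have := geo I
          have h0 : (0 : ℝ) ≤ (1 / 4) ^ I := by positivity
          linarith
      _ = _ := mul_one _
  have s2 : 4 * (1 / 16 : ℝ) ^ I * av L (fun α => x α ^ (2 * t)) ≤ 8 * A3 * (1 / Y) := by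
    have h16 : (1 / 16 : ℝ) ^ I * (R : ℝ) ^ (16 * t) = 1 := by
      have : (R : ℝ) ^ (16 * t) = 16 ^ I := by
        rw [show 16 * t = 8 * t * 2 by ring, pow_mul, ← h4I, ← pow_mul, mul_comm, pow_mul]; norm_num
      rw [this, ← mul_pow]; norm_num
    calc _ ≤ 4 * (1 / 16 : ℝ) ^ I * ((R : ℝ) ^ (16 * t) * (2 * A3 * (1 / Y))) := mul_le_mul_of_nonneg_left htail (by positivity)
      _ = ((1 / 16 : ℝ) ^ I * (R : ℝ) ^ (16 * t)) * (8 * A3 * (1 / Y)) := by ring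
      _ = _ := by rw [h16, one_mul]
  calc _ ≤ ((N / S.G) ^ (2 * r) * 4 ^ r) * (64 * A1 * (1 / Y) + 8 * A3 * (1 / Y)) := by
        refine mul_le_mul_of_nonneg_left (add_le_add s1 s2) (by positivity)
    _ = _ := by ring

end VMV
end

noncomputable section
open Finset
namespace VMV

theorem Jc_bound {d : ℕ} {R : ℕ} (S : SD R) (N r : ℕ) (hr : 1 ≤ r) (h : ℤ) (A : Finset ℤ) (L : Fin d → ℕ)
    (hL : ∀ j : Fin d, r * N ^ ((j : ℕ) + 1) < L j)
    (hA : ∀ x ∈ A, 0 ≤ x ∧ x < N) (hp : ∀ x ∈ A, ∃ p : ℕ, p.Prime ∧ (p : ℤ) = x + h) :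
    (Jc r d A : ℝ) ≤ 4 ^ r * ((R : ℝ) ^ (2 * r) + av L (fun α => ‖S.K N h α‖ ^ (2 * r))) := by
  have hA' : ∀ x ∈ A, 0 ≤ x ∧ x ≤ N := fun x hx => by have := hA x hx; omega
  have hI : ∀ x ∈ Ico (0 : ℤ) (N : ℤ), 0 ≤ x ∧ x ≤ N := fun x hx => by have := mem_Ico.1 hx; omega
  obtain ⟨A1, hA1⟩ : ∃ A1, A1 = A.filter fun x => x + h ≤ R := ⟨_, rfl⟩
  obtain ⟨A2, hA2⟩ : ∃ A2, A2 = A.filter fun x => ¬ x + h ≤ R := ⟨_, rfl⟩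
  have hA1s : A1 ⊆ A := by rw [hA1]; exact filter_subset _ _
  have hA2s : A2 ⊆ Ico (0 : ℤ) (N : ℤ) := by
    intro x hx
    rw [hA2] at hx
    exact mem_Ico.2 (hA x (mem_filter.1 hx).1)
  have hsum : ∀ α : Fin d → ℝ, fs A α = fs A1 α + fs A2 α := by
    intro α
    unfold fs
    rw [hA1, hA2, sum_filter_add_sum_filter_not]
  have hcard : A1.card ≤ R := by
    have hsub : A1.image (fun x => x + h) ⊆ (Icc 1 R).image fun n : ℕ => (n : ℤ) := by
      intro y hy
      obtain ⟨x, hx, rfl⟩ := mem_image.1 hy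
      rw [hA1] at hx
      obtain ⟨hx1, hx2⟩ := mem_filter.1 hx
      obtain ⟨p, hp1, hp2⟩ := hp x hx1
      refine mem_image.2 ⟨p, mem_Icc.2 ⟨hp1.one_lt.le, by omega⟩, hp2⟩
    have h1 := card_le_card hsub
    rw [card_image_of_injective _ (add_left_injective h)] at h1
    refine h1.trans (card_image_le.trans ?_)
    simp
  have hm1 : av L (fun α => ‖fs A1 α‖ ^ (2 * r)) ≤ (R : ℝ) ^ (2 * r) := by
    rw [moment_fs L r N A1 (fun x hx => hA' x (hA1s hx)) hL]
    have h1 := Jc_le (t := r) (d := d) A1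
    calc (Jc r d A1 : ℝ) ≤ ((A1.card ^ (2 * r) : ℕ) : ℝ) := by exact_mod_cast h1
      _ ≤ _ := by push_cast; gcongr
  have hm2 : av L (fun α => ‖fs A2 α‖ ^ (2 * r)) ≤ av L (fun α => ‖S.K N h α‖ ^ (2 * r)) := by
    have e : ∀ α : Fin d → ℝ, fs A2 α = fsw (fun x => if x ∈ A2 then 1 else 0) (Ico 0 (N : ℤ)) α := by
      intro α
      unfold fs fsw
      rw [← sum_subset hA2s (fun x _ hx => by simp [hx])]
      refine sum_congr rfl fun x hx => by simp [hx]
    simp_rw [e, S.K_fsw]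
    refine moment_mono L r N _ _ _ hI hL (fun x _ => by split_ifs <;> norm_num) fun x _ => ?_
    split_ifs with hx
    · rw [hA2] at hx
      obtain ⟨hx1, hx2⟩ := mem_filter.1 hx
      obtain ⟨p, hp1, hp2⟩ := hp x hx1
      refine le_of_eq (Eq.symm (S.hone _ ?_))
      intro q hq hqR hdv
      rw [← hp2] at hdv
      have hdv' : q ∣ p := by exact_mod_cast hdv
      have := (Nat.prime_dvd_prime_iff_eq hq hp1).1 hdv'
      subst this
      apply hx2; rw [← hp2]; exact_mod_cast hqR
    · exact S.nu_nonneg _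
  rw [← moment_fs L r N A hA' hL]
  have hpt : ∀ α : Fin d → ℝ, ‖fs A α‖ ^ (2 * r) ≤ 4 ^ r * (‖fs A1 α‖ ^ (2 * r) + ‖fs A2 α‖ ^ (2 * r)) := by
    intro α
    rw [hsum]
    calc ‖fs A1 α + fs A2 α‖ ^ (2 * r) ≤ (‖fs A1 α‖ + ‖fs A2 α‖) ^ (2 * r) := by gcongr; exact norm_add_le _ _
      _ ≤ 2 ^ (2 * r - 1) * (‖fs A1 α‖ ^ (2 * r) + ‖fs A2 α‖ ^ (2 * r)) := add_pow_le (norm_nonneg _) (norm_nonneg _) _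
      _ ≤ _ := by
        refine mul_le_mul_of_nonneg_right ?_ (by positivity)
        calc (2 : ℝ) ^ (2 * r - 1) ≤ 2 ^ (2 * r) := pow_le_pow_right₀ (by norm_num) (by omega)
          _ = 4 ^ r := by rw [pow_mul]; norm_num
  refine (av_mono _ hpt).trans ?_
  rw [av_mul, av_add]
  gcongr

theorem count_le (d r : ℕ) (X Y : ℝ) (hX : 0 ≤ X) (hY : 1 ≤ Y) :
    Nat.card {pp : (Fin r → ℕ) × (Fin r → ℕ) |
            (∀ i, (pp.1 i).Prime ∧ Y ≤ (pp.1 i : ℝ) ∧ (pp.1 i : ℝ) ≤ Y + X) ∧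
            (∀ i, (pp.2 i).Prime ∧ Y ≤ (pp.2 i : ℝ) ∧ (pp.2 i : ℝ) ≤ Y + X) ∧
            ∀ j ∈ Finset.Icc 1 d, ∑ i, pp.1 i ^ j = ∑ i, pp.2 i ^ j} ≤
    Jc r d (((Icc ⌈Y⌉₊ ⌊Y + X⌋₊).filter Nat.Prime).image fun p : ℕ => (p : ℤ) - ⌈Y⌉₊) := by
  obtain ⟨A, hA⟩ : ∃ A : Finset ℤ, A = ((Icc ⌈Y⌉₊ ⌊Y + X⌋₊).filter Nat.Prime).image fun p : ℕ => (p : ℤ) - ⌈Y⌉₊ := ⟨_, rfl⟩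
  rw [← hA, ← Jc_affine r d A 1 (⌈Y⌉₊ : ℤ) one_ne_zero]
  have hmem : ∀ p : ℕ, p.Prime ∧ Y ≤ (p : ℝ) ∧ (p : ℝ) ≤ Y + X → (p : ℤ) ∈ A.image fun x => 1 * x + (⌈Y⌉₊ : ℤ) := by
    rintro p ⟨h1, h2, h3⟩
    refine mem_image.2 ⟨(p : ℤ) - ⌈Y⌉₊, ?_, by ring⟩
    rw [hA]
    refine mem_image.2 ⟨p, mem_filter.2 ⟨mem_Icc.2 ⟨Nat.ceil_le.2 h2, Nat.le_floor h3⟩, h1⟩, rfl⟩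
  unfold Jc
  obtain ⟨B, hB⟩ : ∃ B, B = A.image fun x => 1 * x + (⌈Y⌉₊ : ℤ) := ⟨_, rfl⟩
  rw [← hB] at hmem ⊢
  rw [Nat.card_coe_set_eq, ← Set.ncard_coe_finset]
  refine Set.ncard_le_ncard_of_injOn (fun pp => ((fun i => (pp.1 i : ℤ)), (fun i => (pp.2 i : ℤ)))) ?_ ?_ (finite_toSet _)
  · rintro pp ⟨h1, h2, h3⟩
    rw [mem_coe, mem_filter, mem_product, Fintype.mem_piFinset, Fintype.mem_piFinset]
    refine ⟨⟨fun i => hmem _ (h1 i), fun i => hmem _ (h2 i)⟩, ?_⟩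
    funext j
    have := h3 ((j : ℕ) + 1) (mem_Icc.2 ⟨by omega, j.2⟩)
    simp only [pv]
    exact_mod_cast this
  · rintro pp _ qq _ he
    have h1 := congrArg Prod.fst he
    have h2 := congrArg Prod.snd he
    refine Prod.ext (funext fun i => ?_) (funext fun i => ?_)
    · have := congrFun h1 i
      simpa using this
    · have := congrFun h2 i
      simpa using this

theorem final (d r : ℕ) (hd : 2 ≤ d) (hr : d * (d + 1) < r) :
    ∃ C X₀ Y₀ : ℝ, 0 < C ∧ 0 < X₀ ∧ 0 < Y₀ ∧
      ∀ X Y : ℝ, X₀ ≤ X → Y₀ ≤ Y →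
        (Nat.card {pp : (Fin r → ℕ) × (Fin r → ℕ) |
            (∀ i, (pp.1 i).Prime ∧ Y ≤ (pp.1 i : ℝ) ∧ (pp.1 i : ℝ) ≤ Y + X) ∧
            (∀ i, (pp.2 i).Prime ∧ Y ≤ (pp.2 i : ℝ) ∧ (pp.2 i : ℝ) ≤ Y + X) ∧
            ∀ j ∈ Finset.Icc 1 d, ∑ i, pp.1 i ^ j = ∑ i, pp.2 i ^ j} : ℝ) ≤
          C * X ^ (2 * (r : ℝ) - d * (d + 1) / 2) / Real.log X ^ (2 * r) := by
  obtain ⟨c1, A, hc1, hA1, hK⟩ := Kmom hd r hr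
  have hc1r : (0 : ℝ) < c1 := by positivity
  have hD2 := two_DD d
  have hDr : 2 * DD d < r := by omega
  obtain ⟨e, he⟩ : ∃ e, e = 2 * r - DD d := ⟨_, rfl⟩
  refine ⟨4 ^ r * (1 + A) * 2 ^ e * (4 * c1) ^ (2 * r), 2 ^ c1 * 2, 1, by positivity, by positivity, one_pos, ?_⟩
  intro X Y hX hY
  have h2c : (1 : ℝ) ≤ 2 ^ c1 := one_le_pow₀ (by norm_num)
  have hX2 : 2 ≤ X := by linarith
  have hX0 : 0 < X := by linarith
  obtain ⟨n, hn⟩ : ∃ n, n = ⌊X⌋₊ := ⟨_, rfl⟩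
  have hnX : (n : ℝ) ≤ X := by rw [hn]; exact Nat.floor_le hX0.le
  have hXn : X < n + 1 := by rw [hn]; exact Nat.lt_floor_add_one X
  have hnc : 2 ^ c1 ≤ n := by rw [hn]; refine Nat.le_floor ?_; push_cast; linarith
  have hn0 : n ≠ 0 := by have : 0 < 2 ^ c1 := by positivity
                         omega
  obtain ⟨μ, hμ⟩ : ∃ μ, μ = Nat.log 2 n + 1 := ⟨_, rfl⟩
  have hμ1 : n < 2 ^ μ := by rw [hμ]; exact Nat.lt_pow_succ_log_self (by norm_num) n
  have hμ2 : 2 ^ μ ≤ 2 * n := by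
    rw [hμ, pow_succ, mul_comm]
    have := Nat.pow_log_le_self 2 hn0
    omega
  have hμc : c1 ≤ μ := by
    have h1 : 2 ^ c1 < 2 ^ μ := by omega
    exact ((Nat.pow_lt_pow_iff_right (by norm_num)).1 h1).le
  obtain ⟨s, hs⟩ : ∃ s, s = μ / c1 := ⟨_, rfl⟩
  have hs1 : 1 ≤ s := by rw [hs]; exact (Nat.one_le_div_iff (by omega)).2 hμc
  have hsμ : s * c1 ≤ μ := by rw [hs]; exact Nat.div_mul_le_self _ _
  have hμs : μ ≤ (s + 1) * c1 := by
    rw [hs, mul_comm]; exact (Nat.lt_mul_div_succ μ (by omega)).le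
  obtain ⟨R, hR⟩ : ∃ R : ℕ, R = 2 ^ s := ⟨_, rfl⟩
  have hR1 : 1 ≤ R := by rw [hR]; exact Nat.one_le_pow _ _ (by norm_num)
  obtain ⟨S⟩ := exists_SD R hR1
  obtain ⟨Y0, hY0⟩ : ∃ Y0, Y0 = (r + 1) * (2 ^ μ).factorial := ⟨_, rfl⟩
  have hY0r : r < Y0 := by
    rw [hY0]
    have := Nat.factorial_pos (2 ^ μ)
    calc r < (r + 1) * 1 := by omega
      _ ≤ _ := Nat.mul_le_mul_left _ this
  have hY0d : ∀ q, 1 ≤ q → q ≤ 2 ^ μ → q ∣ Y0 := by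
    intro q hq hqN
    rw [hY0]
    exact (Nat.dvd_factorial hq hqN).mul_left _
  obtain ⟨L, hL⟩ : ∃ L : Fin d → ℕ, L = fun j : Fin d => (2 ^ μ * Y0) ^ ((j : ℕ) + 2) := ⟨_, rfl⟩
  have hLr : ∀ j : Fin d, r * (2 ^ μ) ^ ((j : ℕ) + 1) < L j := by
    intro j
    rw [hL]
    dsimp only
    rw [mul_pow, mul_comm r]
    have hle : (2 ^ μ) ^ ((j : ℕ) + 1) ≤ (2 ^ μ) ^ ((j : ℕ) + 2) := Nat.pow_le_pow_right (Nat.one_le_pow _ _ (by norm_num)) (by omega)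
    have h0 : 0 < (2 ^ μ) ^ ((j : ℕ) + 1) := by positivity
    have h2 : Y0 ≤ Y0 ^ ((j : ℕ) + 2) := Nat.le_self_pow (by omega) _
    calc (2 ^ μ) ^ ((j : ℕ) + 1) * r < (2 ^ μ) ^ ((j : ℕ) + 1) * Y0 := (Nat.mul_lt_mul_left h0).2 (by omega)
      _ ≤ _ := Nat.mul_le_mul hle h2
  have hKm := hK s μ R hR hs1 hsμ hμs S Y0 hY0r hY0d (⌈Y⌉₊ : ℤ) L (fun j => by rw [hL])
  have hJ := Jc_bound S (2 ^ μ) r (by omega) (⌈Y⌉₊ : ℤ)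
    (((Icc ⌈Y⌉₊ ⌊Y + X⌋₊).filter Nat.Prime).image fun p : ℕ => (p : ℤ) - ⌈Y⌉₊) L hLr
    (by
      intro x hx
      obtain ⟨p, hp, rfl⟩ := mem_image.1 hx
      obtain ⟨h1, h2⟩ := mem_Icc.1 (mem_filter.1 hp).1
      have h3 : p ≤ ⌈Y⌉₊ + n := by
        have h4 : (p : ℝ) ≤ Y + X := (Nat.le_floor_iff (by linarith)).1 h2
        have h5 := Nat.le_ceil Y
        have h6 : (p : ℝ) < ((⌈Y⌉₊ + n + 1 : ℕ) : ℝ) := by push_cast; linarith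
        have h7 : p < ⌈Y⌉₊ + n + 1 := by exact_mod_cast h6
        omega
      have h8 : (n : ℤ) < ((2 ^ μ : ℕ) : ℤ) := by exact_mod_cast hμ1
      omega)
    (by
      intro x hx
      obtain ⟨p, hp, rfl⟩ := mem_image.1 hx
      exact ⟨p, (mem_filter.1 hp).2, by ring⟩)
  have hcnt := count_le d r X Y hX0.le hY
  -- numerics
  obtain ⟨N, hN⟩ : ∃ N : ℝ, N = 2 ^ μ := ⟨_, rfl⟩
  rw [← hN] at hKm
  have hN0 : 0 < N := by rw [hN]; positivity
  have hNX : N ≤ 2 * X := by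
    have : ((2 ^ μ : ℕ) : ℝ) ≤ ((2 * n : ℕ) : ℝ) := by exact_mod_cast hμ2
    push_cast at this
    rw [hN]; linarith
  have hXN : X ≤ N := by
    have : ((n + 1 : ℕ) : ℝ) ≤ ((2 ^ μ : ℕ) : ℝ) := by exact_mod_cast hμ1
    push_cast at this
    rw [hN]; linarith
  have hG0 : 0 < S.G := lt_of_lt_of_le one_pos S.hG1
  have hGR := S.hGR
  have hR1r : (1 : ℝ) ≤ R := by exact_mod_cast hR1
  have hlogX : 0 < Real.log X := Real.log_pos (by linarith)
  have hlog : Real.log X ≤ 4 * c1 * S.G := by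
    have h1 : Real.log X ≤ μ * Real.log 2 := by
      rw [← Real.log_pow, ← hN]; exact Real.log_le_log hX0 hXN
    have h2 := S.hlog
    have h3 : Real.log R = s * Real.log 2 := by rw [hR]; push_cast; rw [Real.log_pow]
    have h4 : (μ : ℝ) ≤ 2 * s * c1 := by
      have : μ ≤ 2 * s * c1 := hμs.trans (Nat.mul_le_mul_right _ (by omega))
      exact_mod_cast this
    have h5 : 0 < Real.log 2 := Real.log_pos (by norm_num)
    calc Real.log X ≤ μ * Real.log 2 := h1
      _ ≤ 2 * s * c1 * Real.log 2 := by gcongr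
      _ = 4 * c1 * (Real.log R / 2) := by rw [h3]; ring
      _ ≤ _ := by gcongr
  have hRN : (R : ℝ) ^ 4 ≤ N := by
    rw [hN, hR]; push_cast
    rw [← pow_mul]
    exact pow_le_pow_right₀ (by norm_num) ((Nat.mul_le_mul_left s hc1).trans hsμ)
  have hN1 : 1 ≤ N := by linarith
  obtain ⟨Z, hZ⟩ : ∃ Z : ℝ, Z = (N / S.G) ^ (2 * r) / N ^ DD d := ⟨_, rfl⟩
  rw [← hZ] at hKm
  have hsplit : N ^ (2 * r) = N ^ e * N ^ DD d := by rw [← pow_add]; congr 1; omega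
  have hZ2 : Z = N ^ e / S.G ^ (2 * r) := by
    rw [hZ, div_pow, hsplit]; field_simp
  have hRZ : (R : ℝ) ^ (2 * r) ≤ Z := by
    rw [hZ2, le_div_iff₀ (by positivity)]
    calc (R : ℝ) ^ (2 * r) * S.G ^ (2 * r) ≤ (R : ℝ) ^ (2 * r) * (R : ℝ) ^ (2 * r) := by gcongr
      _ = ((R : ℝ) ^ 4) ^ r := by rw [← pow_add, ← pow_mul]; congr 1; ring
      _ ≤ N ^ r := by gcongr
      _ ≤ N ^ e := pow_le_pow_right₀ hN1 (by omega)
  have hXe : X ^ (2 * (r : ℝ) - d * (d + 1) / 2) = X ^ e := by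
    rw [← Real.rpow_natCast]
    congr 1
    have h2 : (2 : ℝ) * DD d = d * (d + 1) := by exact_mod_cast hD2
    rw [he, Nat.cast_sub (by omega)]
    push_cast; linarith
  rw [hXe]
  have hZX : Z ≤ (2 * X) ^ e * (4 * c1) ^ (2 * r) / Real.log X ^ (2 * r) := by
    rw [hZ2, div_le_div_iff₀ (by positivity) (by positivity)]
    calc N ^ e * Real.log X ^ (2 * r) ≤ (2 * X) ^ e * (4 * c1 * S.G) ^ (2 * r) := by gcongr
      _ = _ := by rw [mul_pow (4 * (c1 : ℝ))]; ring
  calc _ ≤ _ := (show (_ : ℝ) ≤ _ by exact_mod_cast hcnt)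
    _ ≤ _ := hJ
    _ ≤ 4 ^ r * (Z + A * Z) := by gcongr
    _ = 4 ^ r * (1 + A) * Z := by ring
    _ ≤ 4 ^ r * (1 + A) * ((2 * X) ^ e * (4 * c1) ^ (2 * r) / Real.log X ^ (2 * r)) := by gcongr
    _ = _ := by rw [mul_pow 2 X]; ring

end VMV
end

/-- Lemma 5.4 of the paper: for `d ≥ 2`, `r > d(d+1)` and `X ≫ Y/(log Y)^M`,
the number of solutions of the Vinogradov system of degree `d` in `2r` prime variables lying
in the translated interval `[Y, Y+X]` is `O(X^{2r-d(d+1)/2}/(log X)^{2r})`. -/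
theorem vinogradov_mean_value_primes_translated (d r : ℕ) (hd : 2 ≤ d)
    (hr : d * (d + 1) < r) (M : ℝ) (hM : 1 ≤ M) :
    ∃ C X₀ Y₀ : ℝ, 0 < C ∧ 0 < X₀ ∧ 0 < Y₀ ∧
      ∀ X Y : ℝ, X₀ ≤ X → Y₀ ≤ Y → Y / Real.log Y ^ M ≤ X →
        (Nat.card {pp : (Fin r → ℕ) × (Fin r → ℕ) |
            (∀ i, (pp.1 i).Prime ∧ Y ≤ (pp.1 i : ℝ) ∧ (pp.1 i : ℝ) ≤ Y + X) ∧
            (∀ i, (pp.2 i).Prime ∧ Y ≤ (pp.2 i : ℝ) ∧ (pp.2 i : ℝ) ≤ Y + X) ∧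
            ∀ j ∈ Finset.Icc 1 d, ∑ i, pp.1 i ^ j = ∑ i, pp.2 i ^ j} : ℝ) ≤
          C * X ^ (2 * (r : ℝ) - d * (d + 1) / 2) / Real.log X ^ (2 * r) := by
  obtain ⟨C, X₀, Y₀, hC, hX, hY, h⟩ := VMV.final d r hd hr
  exact ⟨C, X₀, Y₀, hC, hX, hY, fun X Y h1 h2 _ => h X Y h1 h2⟩
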